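/- arXiv:1910.12793 — 2 statements merged into one kernel-verified Lean document; each statement's English description precedes it below -/
import Mathlib

section
/- If a simplicial complex K is a combinatorial grape, then each connected component of the geometric realization of K is either contractible or homotopy equivalent to a wedge of spheres. -/
open Finset

/-- An abstract simplicial complex: a collection of finite sets closed under subsets. -/
def IsSimplicialComplex {α : Type*} (K : Set (Finset α)) : Prop :=
  ∀ σ ∈ K, ∀ τ, τ ⊆ σ → τ ∈ K

/-- The link `(K : a)` of the vertex `a` in `K`. -/
def linkC {α : Type*} [DecidableEq α] (K : Set (Finset α)) (a : α) : Set (Finset α) :=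
  {τ | τ ∈ K ∧ a ∉ τ ∧ insert a τ ∈ K}

/-- The face-deletion `(K, a)` of the vertex `a` in `K`. -/
def delC {α : Type*} [DecidableEq α] (K : Set (Finset α)) (a : α) : Set (Finset α) :=
  {τ | τ ∈ K ∧ a ∉ τ}

/-- The cone `C_a(L)` with apex `a`: faces are `τ ∪ s` with `τ ∈ L` and `s ⊆ {a}`. -/
def coneC {α : Type*} [DecidableEq α] (a : α) (L : Set (Finset α)) : Set (Finset α) :=
  {σ | ∃ τ ∈ L, ∃ s ⊆ ({a} : Finset α), σ = τ ∪ s}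

/-- A combinatorial grape: either `K` has at most one vertex, or there is a vertex `a` such that
the link `(K : a)` is contained in a cone contained in the face-deletion `(K, a)`, and both the
link and the face-deletion are combinatorial grapes. -/
inductive IsGrape {α : Type*} [DecidableEq α] : Set (Finset α) → Prop
  | atMostOneVertex (K : Set (Finset α)) (h : ∀ a b : α, {a} ∈ K → {b} ∈ K → a = b) :
      IsGrape K
  | wedge (K : Set (Finset α)) (a : α) (ha : {a} ∈ K)
      (hcone : ∃ (b : α) (L : Set (Finset α)), linkC K a ⊆ coneC b L ∧ coneC b L ⊆ delC K a)
      (hlink : IsGrape (linkC K a)) (hdel : IsGrape (delC K a)) : IsGrape K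

/-- Geometric realization of a complex on a finite vertex type, as the subspace of `α → ℝ`
of convex-coefficient vectors whose support is contained in a face. -/
def realization {α : Type*} [Fintype α] (K : Set (Finset α)) : Set (α → ℝ) :=
  {x | (∀ a, 0 ≤ x a) ∧ (∑ a, x a) = 1 ∧ ∃ σ ∈ K, ∀ a, x a ≠ 0 → a ∈ σ}

/-- A base point of the `d`-dimensional unit sphere. -/
noncomputable def spherePt (d : ℕ) : (Metric.sphere (0 : EuclideanSpace ℝ (Fin (d+1))) 1) :=
  ⟨EuclideanSpace.single 0 1, by simp⟩

/-- Wedge of spheres: one `d i`-dimensional sphere for each `i : ι`, with all base points glued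
together (to an extra point, so that the empty wedge is a single point). -/
def WedgeOfSpheres (ι : Type*) (d : ι → ℕ) : Type _ :=
  Quot (fun x y : Unit ⊕ (Σ i : ι, Metric.sphere (0 : EuclideanSpace ℝ (Fin (d i + 1))) 1) =>
    (x = Sum.inl () ∨ ∃ i, x = Sum.inr ⟨i, spherePt (d i)⟩) ∧
    (y = Sum.inl () ∨ ∃ i, y = Sum.inr ⟨i, spherePt (d i)⟩))

noncomputable instance (ι : Type*) (d : ι → ℕ) : TopologicalSpace (WedgeOfSpheres ι d) := by
  unfold WedgeOfSpheres; infer_instance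

/-! ### Pointed homotopy equivalences -/

/-- The wedge sum of two pointed spaces, as the union of the axes in their product. -/
def wedgeSum {X Y : Type*} (x : X) (y : Y) : Set (X × Y) := {p | p.1 = x ∨ p.2 = y}

/-- The base point of a wedge sum. -/
def wedgePt {X Y : Type*} (x : X) (y : Y) : wedgeSum x y := ⟨(x, y), Or.inl rfl⟩

theorem map_mem_wedgeSum {X Y X' Y' : Type*} {x : X} {y : Y} {x' : X'} {y' : Y'}
    {f : X → X'} {g : Y → Y'} (hf : f x = x') (hg : g y = y') (p : wedgeSum x y) :
    (f p.1.1, g p.1.2) ∈ wedgeSum x' y' := by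
  obtain ⟨⟨a, b⟩, h | h⟩ := p
  · exact Or.inl (by simp only at h ⊢; rw [h, hf])
  · exact Or.inr (by simp only at h ⊢; rw [h, hg])

section PointedEquivalences

variable {X Y Z X' Y' : Type*} [TopologicalSpace X] [TopologicalSpace Y] [TopologicalSpace Z]
  [TopologicalSpace X'] [TopologicalSpace Y']

theorem homotopicRel_singleton_of {f g : C(X, Y)} {x : X} (H : unitInterval × X → Y)
    (hH : Continuous H) (h0 : ∀ p, H (0, p) = f p) (h1 : ∀ p, H (1, p) = g p)
    (hx : ∀ t, H (t, x) = f x) : f.HomotopicRel g {x} :=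
  ⟨{ toFun := H, continuous_toFun := hH, map_zero_left := h0, map_one_left := h1
     prop' := fun t y hy => by rw [Set.mem_singleton_iff.1 hy]; exact hx t }⟩

theorem HomotopicRel.precomp_singleton {f g : C(Y, Z)} {k : C(X, Y)} {x : X} {y : Y}
    (h : f.HomotopicRel g {y}) (hk : k x = y) : (f.comp k).HomotopicRel (g.comp k) {x} := by
  obtain ⟨H⟩ := h
  refine homotopicRel_singleton_of (fun q => H (q.1, k q.2)) (by fun_prop) (by simp) (by simp) ?_
  intro t
  have := H.eq_fst t (x := k x) (by simp [hk])
  simpa using this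

/-- Homotopy equivalence of pointed spaces, with homotopies fixing the base points. -/
def PointedEquiv (x : X) (y : Y) : Prop :=
  ∃ (f : C(X, Y)) (g : C(Y, X)), f x = y ∧ g y = x ∧
    (g.comp f).HomotopicRel (ContinuousMap.id X) {x} ∧
    (f.comp g).HomotopicRel (ContinuousMap.id Y) {y}

theorem PointedEquiv.symm {x : X} {y : Y} (h : PointedEquiv x y) : PointedEquiv y x := by
  obtain ⟨f, g, hf, hg, h1, h2⟩ := h
  exact ⟨g, f, hg, hf, h2, h1⟩

theorem PointedEquiv.trans {x : X} {y : Y} {z : Z} (h : PointedEquiv x y)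
    (h' : PointedEquiv y z) : PointedEquiv x z := by
  obtain ⟨f, g, hf, hg, h1, h2⟩ := h
  obtain ⟨f', g', hf', hg', h1', h2'⟩ := h'
  refine ⟨f'.comp f, g.comp g', by simp [hf, hf'], by simp [hg, hg'], ?_, ?_⟩
  · exact ((HomotopicRel.precomp_singleton h1' hf).comp_continuousMap g).trans h1
  · exact ((HomotopicRel.precomp_singleton h2 hg').comp_continuousMap f').trans h2'

theorem PointedEquiv.of_inverse {x : X} {y : Y} (f : C(X, Y)) (g : C(Y, X)) (hf : f x = y)
    (hgf : ∀ p, g (f p) = p) (hfg : ∀ p, f (g p) = p) : PointedEquiv x y := by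
  refine ⟨f, g, hf, by rw [← hf, hgf], ?_, ?_⟩
  · rw [show g.comp f = ContinuousMap.id X from ContinuousMap.ext hgf]
    exact ContinuousMap.HomotopicRel.refl _
  · rw [show f.comp g = ContinuousMap.id Y from ContinuousMap.ext hfg]
    exact ContinuousMap.HomotopicRel.refl _

theorem PointedEquiv.nonempty_homotopyEquiv {x : X} {y : Y} (h : PointedEquiv x y) :
    Nonempty (ContinuousMap.HomotopyEquiv X Y) := by
  obtain ⟨f, g, -, -, h1, h2⟩ := h
  exact ⟨⟨f, g, h1.homotopic, h2.homotopic⟩⟩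

theorem ContinuousMap.HomotopyEquiv.pathConnectedSpace [PathConnectedSpace X]
    (e : ContinuousMap.HomotopyEquiv X Y) : PathConnectedSpace Y := by
  obtain ⟨H⟩ := e.right_inv
  have key (y : Y) : Joined y (e (e.invFun y)) :=
    ⟨⟨⟨fun t => H (unitInterval.symm t, y), by fun_prop⟩, by simp, by simp⟩⟩
  have : Nonempty X := PathConnectedSpace.nonempty
  refine ⟨this.map e, fun y y' => ?_⟩
  exact (key y).trans
    (((PathConnectedSpace.joined (e.invFun y) (e.invFun y')).map e.continuous).trans (key y').symm)

theorem homotopicRel_id_of_wedgeSum {x : X} {y : Y} {f : C(X, X)} {g : C(Y, Y)}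
    (hf : f.HomotopicRel (ContinuousMap.id X) {x}) (hg : g.HomotopicRel (ContinuousMap.id Y) {y})
    (k : C(wedgeSum x y, wedgeSum x y)) (hk : ∀ p, (k p).1 = (f p.1.1, g p.1.2)) :
    k.HomotopicRel (ContinuousMap.id _) {wedgePt x y} := by
  obtain ⟨F⟩ := hf
  obtain ⟨G⟩ := hg
  have hF (t) : F (t, x) = x := by simpa using F.eq_snd t (Set.mem_singleton x)
  have hG (t) : G (t, y) = y := by simpa using G.eq_snd t (Set.mem_singleton y)
  refine homotopicRel_singleton_of
    (fun q => ⟨(F (q.1, q.2.1.1), G (q.1, q.2.1.2)),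
      map_mem_wedgeSum (f := fun a => F (q.1, a)) (g := fun b => G (q.1, b)) (hF _) (hG _) q.2⟩)
    (by fun_prop) (fun p => ?_) (fun p => ?_) (fun t => ?_)
  · exact Subtype.ext (by simp [hk])
  · exact Subtype.ext (by simp)
  · have hF0 : f x = x := by rw [← F.apply_zero, hF]
    have hG0 : g y = y := by rw [← G.apply_zero, hG]
    exact Subtype.ext (by simp [hk, wedgePt, hF, hG, hF0, hG0])

theorem PointedEquiv.wedge {x : X} {y : Y} {x' : X'} {y' : Y'} (hX : PointedEquiv x x')
    (hY : PointedEquiv y y') : PointedEquiv (wedgePt x y) (wedgePt x' y') := by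
  obtain ⟨f, f', hf, hf', h1, h2⟩ := hX
  obtain ⟨g, g', hg, hg', h3, h4⟩ := hY
  refine ⟨⟨fun p => ⟨(f p.1.1, g p.1.2), map_mem_wedgeSum hf hg p⟩, by fun_prop⟩,
    ⟨fun p => ⟨(f' p.1.1, g' p.1.2), map_mem_wedgeSum hf' hg' p⟩, by fun_prop⟩,
    Subtype.ext (by simp [wedgePt, hf, hg]), Subtype.ext (by simp [wedgePt, hf', hg']),
    homotopicRel_id_of_wedgeSum h1 h3 _ fun p => rfl,
    homotopicRel_id_of_wedgeSum h2 h4 _ fun p => rfl⟩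

theorem pathConnectedSpace_left_of_wedgeSum {x : X} {y : Y}
    [PathConnectedSpace (wedgeSum x y)] : PathConnectedSpace X :=
  Function.Surjective.pathConnectedSpace (f := fun p : wedgeSum x y => p.1.1)
    (fun a => ⟨⟨(a, y), Or.inr rfl⟩, rfl⟩) (by fun_prop)

theorem pathConnectedSpace_right_of_wedgeSum {x : X} {y : Y}
    [PathConnectedSpace (wedgeSum x y)] : PathConnectedSpace Y :=
  Function.Surjective.pathConnectedSpace (f := fun p : wedgeSum x y => p.1.2)
    (fun b => ⟨⟨(x, b), Or.inl rfl⟩, rfl⟩) (by fun_prop)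

/-! ### Change of base point -/

/-- The space obtained from `X` by growing a whisker at `x`. -/
def whisker (x : X) : Set (X × ℝ) := {p | 0 ≤ p.2 ∧ p.2 ≤ 1 ∧ (p.1 = x ∨ p.2 = 0)}

/-- The free end of the whisker. -/
def whiskerTip (x : X) : whisker x := ⟨(x, 1), by simp [whisker]⟩

theorem continuous_whisker_glue {T : Type*} [TopologicalSpace T] [T1Space X] {x : X}
    {f : T × X → Z} {g : T × ℝ → Z} (hf : Continuous f) (hg : Continuous g)
    (h : ∀ t, g (t, 0) = f (t, x)) :
    Continuous fun q : T × whisker x =>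
      if q.2.1.2 = 0 then f (q.1, q.2.1.1) else g (q.1, q.2.1.2) := by
  have hA : IsClosed {q : T × whisker x | q.2.1.2 = 0} :=
    isClosed_eq (by fun_prop) continuous_const
  have hB : IsClosed {q : T × whisker x | q.2.1.1 = x} :=
    isClosed_singleton.preimage (f := fun q : T × whisker x => q.2.1.1) (by fun_prop)
  have hAB : {q : T × whisker x | q.2.1.2 = 0} ∪ {q : T × whisker x | q.2.1.1 = x} = Set.univ :=
    Set.eq_univ_of_forall fun q => q.2.2.2.2.symm
  rw [← continuousOn_univ, ← hAB]
  refine ContinuousOn.union_of_isClosed ?_ ?_ hA hB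
  · refine ContinuousOn.congr (f := fun q : T × whisker x => f (q.1, q.2.1.1))
      (by fun_prop) fun q hq => ?_
    simp only [Set.mem_ofPred_eq] at hq
    simp [hq]
  · refine ContinuousOn.congr (f := fun q : T × whisker x => g (q.1, q.2.1.2))
      (by fun_prop) fun q hq => ?_
    simp only [Set.mem_ofPred_eq] at hq
    split_ifs with h0
    · simp only [h0, h, hq]
    · rfl

/-- Sliding the foot of the whisker along a path. -/
noncomputable def whiskerSlide [T1Space X] {x y : X} (γ : Path x y) :
    C(whisker x, whisker y) where
  toFun p := ⟨if p.1.2 = 0 then (p.1.1, 0) else (γ.extend (2 * p.1.2), max 0 (2 * p.1.2 - 1)), by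
    obtain ⟨⟨a, s⟩, h0, h1, h2⟩ := p
    simp only at h0 h1 h2 ⊢
    split_ifs with hs
    · simp [whisker]
    · refine ⟨le_max_left _ _, max_le zero_le_one (by linarith), ?_⟩
      rcases le_total s (1 / 2) with h | h
      · exact Or.inr (max_eq_left (by linarith))
      · exact Or.inl (γ.extend_of_one_le (by linarith))⟩
  continuous_toFun := by
    refine Continuous.subtype_mk ?_ _
    have := continuous_whisker_glue (T := Unit) (x := x) (f := fun q => (q.2, (0 : ℝ)))
      (g := fun q => (γ.extend (2 * q.2), max 0 (2 * q.2 - 1))) (by fun_prop) (by fun_prop)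
      (by simp)
    exact this.comp (Continuous.prodMk_right ())

theorem whiskerSlide_tip [T1Space X] {x y : X} (γ : Path x y) :
    whiskerSlide γ (whiskerTip x) = whiskerTip y := by
  refine Subtype.ext ?_
  simp [whiskerSlide, whiskerTip, γ.extend_of_one_le one_le_two]
  norm_num

theorem whiskerSlide_symm_comp [T1Space X] {x y : X} (γ : Path x y) :
    ((whiskerSlide γ.symm).comp (whiskerSlide γ)).HomotopicRel (ContinuousMap.id _)
      {whiskerTip x} := by
  let m : unitInterval → ℝ → ℝ := fun t s => max 0 (min (2 * s) (3 * (1 - (t : ℝ)) - 4 * s))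
  let c : unitInterval → ℝ → ℝ := fun t s =>
    max 0 ((s - 3 / 4 * (1 - (t : ℝ))) / (1 - 3 / 4 * (1 - (t : ℝ))))
  have hden (t : unitInterval) : 0 < 1 - 3 / 4 * (1 - (t : ℝ)) := by linarith [t.2.1]
  have hm : Continuous fun q : unitInterval × ℝ => m q.1 q.2 := by fun_prop
  have hc : Continuous fun q : unitInterval × ℝ => c q.1 q.2 :=
    continuous_const.max (Continuous.div (by fun_prop) (by fun_prop) fun q => (hden q.1).ne')
  have hmem (t : unitInterval) (p : whisker x) :
      (if p.1.2 = 0 then (p.1.1, 0) else (γ.extend (m t p.1.2), c t p.1.2)) ∈ whisker x := by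
    obtain ⟨⟨a, s⟩, h0, h1, h2⟩ := p
    simp only at h0 h1 h2 ⊢
    split_ifs with hs
    · simp [whisker]
    · refine ⟨le_max_left _ _, max_le zero_le_one ?_, ?_⟩
      · rw [div_le_one (hden t)]; linarith
      · rcases le_total s (3 / 4 * (1 - (t : ℝ))) with h | h
        · exact Or.inr (max_eq_left (div_nonpos_of_nonpos_of_nonneg (by linarith) (hden t).le))
        · refine Or.inl (γ.extend_of_le_zero (max_le le_rfl ((min_le_right _ _).trans ?_)))
          linarith
  refine homotopicRel_singleton_of (fun q => ⟨_, hmem q.1 q.2⟩) ?_ ?_ ?_ ?_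
  · refine Continuous.subtype_mk ?_ _
    refine continuous_whisker_glue (T := unitInterval) (x := x) (f := fun q => (q.2, (0 : ℝ)))
      (g := fun q => (γ.extend (m q.1 q.2), c q.1 q.2)) (by fun_prop) (by fun_prop) fun t => ?_
    have h1 : m t 0 ≤ 0 := by simp [m]
    have h2 : c t 0 = 0 :=
      max_eq_left (div_nonpos_of_nonpos_of_nonneg (by linarith [t.2.2]) (hden t).le)
    rw [γ.extend_of_le_zero h1, h2]
  · rintro ⟨⟨a, s⟩, h0, h1, h2⟩
    refine Subtype.ext ?_
    simp only at h0 h1 h2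
    by_cases hs : s = 0
    · simp [whiskerSlide, hs]
    · simp only [whiskerSlide, hs, ContinuousMap.comp_apply, ContinuousMap.coe_mk, if_false, m, c,
        Path.extend_symm_apply]
      rcases le_total s (1 / 2) with h | h
      · rw [max_eq_left (by linarith : 2 * s - 1 ≤ 0), if_pos rfl]
        simp only [Set.Icc.coe_zero]
        rw [min_eq_left (by linarith), max_eq_right (by linarith),
          max_eq_left (div_nonpos_of_nonpos_of_nonneg (by linarith) (by norm_num))]
      · rw [max_eq_right (by linarith : 0 ≤ 2 * s - 1)]
        simp only [Set.Icc.coe_zero]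
        rw [min_eq_right (by linarith)]
        have e1 : (s - 3 / 4 * (1 - 0)) / (1 - 3 / 4 * (1 - 0)) = 2 * (2 * s - 1) - 1 := by ring
        rw [e1]
        split_ifs with h3
        · have : s = 1 / 2 := by linarith
          subst this
          norm_num
        · have e2 : 1 - 2 * (2 * s - 1) = 3 * (1 - 0) - 4 * s := by ring
          rw [e2]
          rcases le_total (3 * (1 - 0) - 4 * s) 0 with h4 | h4
          · rw [max_eq_left h4, γ.extend_of_le_zero h4, γ.extend_zero]
          · rw [max_eq_right h4]
  · rintro ⟨⟨a, s⟩, h0, h1, h2⟩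
    refine Subtype.ext ?_
    simp only at h0 h1 h2
    by_cases hs : s = 0
    · simp [hs]
    · have e : m 1 s = 0 := max_eq_left ((min_le_right _ _).trans (by simp [h0]))
      simp [hs, e, c, h0, h2.resolve_right hs]
  · intro t
    refine Subtype.ext ?_
    rw [ContinuousMap.comp_apply, whiskerSlide_tip, whiskerSlide_tip]
    have e : m t 1 = 0 := max_eq_left ((min_le_right _ _).trans (by linarith [t.2.1]))
    simp [whiskerTip, e, c, div_self (hden t).ne']

theorem PointedEquiv.whisker_of_joined [T1Space X] {x y : X} (h : Joined x y) :
    PointedEquiv (whiskerTip x) (whiskerTip y) := by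
  obtain ⟨γ⟩ := h
  refine ⟨whiskerSlide γ, whiskerSlide γ.symm, whiskerSlide_tip _, whiskerSlide_tip _,
    whiskerSlide_symm_comp γ, ?_⟩
  simpa using whiskerSlide_symm_comp γ.symm

/-- The space can be deformed, fixing `x`, so that a neighbourhood of `x` is pushed into `x`. -/
def ContractsNear (x : X) : Prop :=
  ∃ (H : unitInterval × X → X) (w : X → ℝ), Continuous H ∧ Continuous w ∧
    (∀ p, H (0, p) = p) ∧ (∀ t, H (t, x) = x) ∧ w x = 1 ∧ (∀ p, 0 ≤ w p ∧ w p ≤ 1) ∧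
    ∀ p, 0 < w p → H (1, p) = x

theorem ContractsNear.pointedEquiv_whisker {x : X} (h : ContractsNear x) :
    PointedEquiv (whiskerTip x) x := by
  obtain ⟨H, w, hH, hw, H0, Hx, wx, w01, hwH⟩ := h
  have hg (p : X) : (H (1, p), w p) ∈ whisker x :=
    ⟨(w01 p).1, (w01 p).2, (w01 p).1.eq_or_lt.symm.imp (hwH p) Eq.symm⟩
  refine ⟨⟨fun p => p.1.1, by fun_prop⟩, ⟨fun p => ⟨_, hg p⟩, by fun_prop⟩, rfl,
    Subtype.ext (by simp [Hx, wx, whiskerTip]), ?_, ?_⟩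
  · let k : C(whisker x, whisker x) := ⟨fun p => ⟨(H (1, p.1.1), p.1.2), p.2.1, p.2.2.1,
      p.2.2.2.imp_left fun h => by rw [h, Hx]⟩, by fun_prop⟩
    have hmem (q : unitInterval × whisker x) :
        (H (1, q.2.1.1), (1 - (q.1 : ℝ)) * w q.2.1.1 + q.1 * q.2.1.2) ∈ whisker x := by
      obtain ⟨t, ⟨⟨a, s⟩, h0, h1, h2⟩⟩ := q
      simp only at h0 h1 h2 ⊢
      have ht := t.2.1
      have ht' : 0 ≤ 1 - (t : ℝ) := by linarith [t.2.2]
      refine ⟨?_, ?_, ?_⟩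
      · have := mul_nonneg ht' (w01 a).1
        have := mul_nonneg ht h0
        simp only; linarith
      · have := mul_le_mul_of_nonneg_left (w01 a).2 ht'
        have := mul_le_mul_of_nonneg_left h1 ht
        simp only; linarith
      · rcases h2 with rfl | rfl
        · exact Or.inl (Hx _)
        · rcases (w01 a).1.eq_or_lt with h | h
          · right; simp [← h]
          · exact Or.inl (hwH _ h)
    have hmem' (q : unitInterval × whisker x) : (H (q.1, q.2.1.1), q.2.1.2) ∈ whisker x :=
      ⟨q.2.2.1, q.2.2.2.1, q.2.2.2.2.imp_left fun h => by rw [h, Hx]⟩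
    refine ContinuousMap.HomotopicRel.trans (g := k) ?_ ?_
    · exact homotopicRel_singleton_of (fun q => ⟨_, hmem q⟩) (by fun_prop)
        (fun p => Subtype.ext (by simp)) (fun p => Subtype.ext (by simp [k]))
        (fun t => Subtype.ext (by simp [whiskerTip, Hx, wx]))
    · exact (homotopicRel_singleton_of (f := ContinuousMap.id _) (fun q => ⟨_, hmem' q⟩)
        (by fun_prop)
        (fun p => Subtype.ext (by simp [H0])) (fun p => Subtype.ext (by simp [k]))
        (fun t => Subtype.ext (by simp [whiskerTip, Hx]))).symm
  · exact (homotopicRel_singleton_of H hH H0 (fun p => rfl) Hx).symm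

theorem ContractsNear.pointedEquiv_of_joined [T1Space X] {x y : X} (hx : ContractsNear x)
    (hy : ContractsNear y) (h : Joined x y) : PointedEquiv x y :=
  hx.pointedEquiv_whisker.symm.trans
    ((PointedEquiv.whisker_of_joined h).trans hy.pointedEquiv_whisker)

end PointedEquivalences


/-! ### Bouquets of spheres -/

section Bouquets

variable {ι κ : Type*}

/-- A bouquet of spheres, as the union of the axes in a product of spheres. -/
def bouquet (d : ι → ℕ) : Set (∀ i, Metric.sphere (0 : EuclideanSpace ℝ (Fin (d i + 1))) 1) :=
  {f | ∀ i j, i ≠ j → f i = spherePt (d i) ∨ f j = spherePt (d j)}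

/-- The base point of a bouquet of spheres. -/
noncomputable def bouquetPt (d : ι → ℕ) : bouquet d :=
  ⟨fun i => spherePt (d i), fun _ _ _ => Or.inl rfl⟩

theorem bouquet_sumElim_pointedEquiv (d : ι → ℕ) (e : κ → ℕ) :
    PointedEquiv (wedgePt (bouquetPt d) (bouquetPt e)) (bouquetPt (Sum.elim d e)) := by
  have hf (p : wedgeSum (bouquetPt d) (bouquetPt e)) :
      (fun i => Sum.rec (fun i => p.1.1.1 i) (fun k => p.1.2.1 k) i :
        ∀ i, Metric.sphere (0 : EuclideanSpace ℝ (Fin (Sum.elim d e i + 1))) 1) ∈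
      bouquet (Sum.elim d e) := by
    obtain ⟨⟨⟨u, hu⟩, ⟨v, hv⟩⟩, h⟩ := p
    have h' : (∀ i, u i = spherePt (d i)) ∨ (∀ k, v k = spherePt (e k)) :=
      h.imp (fun h i => congrFun (congrArg Subtype.val h) i)
        (fun h i => congrFun (congrArg Subtype.val h) i)
    rintro (i | i) (j | j) hij
    · exact hu i j fun h => hij (by rw [h])
    · exact h'.imp (fun h => h i) (fun h => h j)
    · exact (h'.imp (fun h => h j) (fun h => h i)).symm
    · exact hv i j fun h => hij (by rw [h])
  have hg1 (w : bouquet (Sum.elim d e)) : (fun i => w.1 (Sum.inl i)) ∈ bouquet d :=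
    fun i j hij => w.2 (Sum.inl i) (Sum.inl j) (by simpa using hij)
  have hg2 (w : bouquet (Sum.elim d e)) : (fun i => w.1 (Sum.inr i)) ∈ bouquet e :=
    fun i j hij => w.2 (Sum.inr i) (Sum.inr j) (by simpa using hij)
  have hg (w : bouquet (Sum.elim d e)) : ((⟨_, hg1 w⟩, ⟨_, hg2 w⟩) : bouquet d × bouquet e) ∈
      wedgeSum (bouquetPt d) (bouquetPt e) := by
    by_cases h : ∀ i, w.1 (Sum.inl i) = spherePt (d i)
    · exact Or.inl (Subtype.ext (funext h))
    · push Not at h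
      obtain ⟨i, hi⟩ := h
      exact Or.inr (Subtype.ext (funext fun j =>
        (w.2 (Sum.inl i) (Sum.inr j) Sum.inl_ne_inr).resolve_left hi))
  refine PointedEquiv.of_inverse ⟨fun p => ⟨_, hf p⟩, ?_⟩ ⟨fun w => ⟨_, hg w⟩, ?_⟩ ?_ ?_ ?_
  · refine Continuous.subtype_mk (continuous_pi ?_) _
    rintro (i | i)
    · exact (continuous_apply i).comp (by fun_prop)
    · exact (continuous_apply i).comp (by fun_prop)
  · have hcomp (i : ι ⊕ κ) : Continuous fun w : bouquet (Sum.elim d e) => w.1 i :=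
      (continuous_apply i).comp continuous_subtype_val
    exact Continuous.subtype_mk (Continuous.prodMk
      (Continuous.subtype_mk (continuous_pi fun i =>
        hcomp (Sum.inl i)) _)
      (Continuous.subtype_mk (continuous_pi fun i =>
        hcomp (Sum.inr i)) _)) _
  · exact Subtype.ext (funext (by rintro (i | i) <;> rfl))
  · exact fun p => rfl
  · exact fun w => Subtype.ext (funext (by rintro (i | i) <;> rfl))

open Classical in
theorem nonempty_homeomorph_bouquet [Fintype ι] {n : ℕ} (e : Fin n ≃ ι) (d : ι → ℕ) :
    Nonempty (WedgeOfSpheres (Fin n) (d ∘ e) ≃ₜ bouquet d) := by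
  let b : ∀ i, Metric.sphere (0 : EuclideanSpace ℝ (Fin (d i + 1))) 1 := fun i => spherePt (d i)
  have hmem (i : ι) (p) : Function.update b i p ∈ bouquet d := by
    intro j k hjk
    by_cases hj : j = i
    · exact Or.inr (Function.update_of_ne (fun h => hjk (by rw [hj, h])) _ _)
    · exact Or.inl (Function.update_of_ne hj _ _)
  let f₀ : Unit ⊕ (Σ i : Fin n, Metric.sphere (0 : EuclideanSpace ℝ (Fin ((d ∘ e) i + 1))) 1) →
      bouquet d :=
    Sum.elim (fun _ => bouquetPt d) fun q => ⟨Function.update b (e q.1) q.2, hmem _ _⟩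
  have hf₀ : Continuous f₀ := by
    refine continuous_const.sumElim (continuous_sigma fun i => ?_)
    exact Continuous.subtype_mk
      (Continuous.update (f := fun _ : Metric.sphere _ _ => b) continuous_const (e i)
        continuous_id) _
  have hbase (x) (hx : x = Sum.inl () ∨ ∃ i, x = Sum.inr ⟨i, spherePt ((d ∘ e) i)⟩) :
      f₀ x = bouquetPt d := by
    rcases hx with rfl | ⟨i, rfl⟩
    · rfl
    · exact Subtype.ext (Function.update_eq_self (e i) b)
  let f : WedgeOfSpheres (Fin n) (d ∘ e) → bouquet d :=
    Quot.lift f₀ fun x y h => by rw [hbase x h.1, hbase y h.2]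
  have hf : Continuous f := continuous_quot_lift _ hf₀
  have : CompactSpace (WedgeOfSpheres (Fin n) (d ∘ e)) := by
    unfold WedgeOfSpheres; infer_instance
  have hinj : Function.Injective f := by
    have key (i : Fin n) (p) (w : bouquet d) (h : f₀ (Sum.inr ⟨i, p⟩) = w) (j : Fin n) :
        w.1 (e j) = if h : j = i then h ▸ p else spherePt _ := by
      subst h
      change Function.update b (e i) p (e j) = _
      split_ifs with h
      · subst h; exact Function.update_self _ _ _
      · exact Function.update_of_ne (fun h' => h (e.injective h')) _ _
    have base (i : Fin n) (p) (h : f₀ (Sum.inr ⟨i, p⟩) = bouquetPt d) :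
        p = spherePt ((d ∘ e) i) := by
      simpa [bouquetPt] using (key i p _ h i).symm
    have glue (i : Fin n) (p) (h : f₀ (Sum.inr ⟨i, p⟩) = bouquetPt d) :
        Quot.mk (fun x y : Unit ⊕ (Σ i : Fin n,
          Metric.sphere (0 : EuclideanSpace ℝ (Fin ((d ∘ e) i + 1))) 1) =>
          (x = Sum.inl () ∨ ∃ i, x = Sum.inr ⟨i, spherePt ((d ∘ e) i)⟩) ∧
          (y = Sum.inl () ∨ ∃ i, y = Sum.inr ⟨i, spherePt ((d ∘ e) i)⟩)) (Sum.inr ⟨i, p⟩) =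
        Quot.mk _ (Sum.inl ()) :=
      Quot.sound ⟨Or.inr ⟨i, by rw [base i p h]⟩, Or.inl rfl⟩
    rintro ⟨⟨⟩ | ⟨i, p⟩⟩ ⟨⟨⟩ | ⟨j, q⟩⟩ h
    · rfl
    · exact (glue j q h.symm).symm
    · exact glue i p h
    · change f₀ (Sum.inr ⟨i, p⟩) = f₀ (Sum.inr ⟨j, q⟩) at h
      by_cases hij : i = j
      · subst hij
        have h1 := key i p _ h i
        have h2 := key i q _ rfl i
        simp only [dite_true] at h1 h2
        rw [show p = q from h1.symm.trans h2]
      · have hp : f₀ (Sum.inr ⟨i, p⟩) = bouquetPt d := by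
          have h1 := key i p _ rfl i
          have h2 := key j q _ h.symm i
          rw [h1] at h2
          simp only [hij, dite_true, dite_false] at h2
          rw [h2]
          exact hbase _ (Or.inr ⟨i, rfl⟩)
        exact (glue i p hp).trans (glue j q (h ▸ hp)).symm
  have hsurj : Function.Surjective f := by
    intro w
    by_cases h : ∀ i, w.1 i = spherePt (d i)
    · exact ⟨Quot.mk _ (Sum.inl ()), Subtype.ext (funext fun i => (h i).symm)⟩
    · push Not at h
      obtain ⟨i, hi⟩ := h
      obtain ⟨j, rfl⟩ := e.surjective i
      refine ⟨Quot.mk _ (Sum.inr ⟨j, w.1 (e j)⟩), Subtype.ext (funext fun k => ?_)⟩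
      change Function.update b (e j) (w.1 (e j)) k = w.1 k
      by_cases hk : k = e j
      · subst hk; simp
      · rw [Function.update_of_ne hk]
        exact ((w.2 _ _ (Ne.symm hk)).resolve_left hi).symm
  exact ⟨Continuous.homeoOfEquivCompactToT2 (f := Equiv.ofBijective f ⟨hinj, hsurj⟩) hf⟩

variable {X Y : Type*} [TopologicalSpace X] [TopologicalSpace Y]

/-- The pointed space `(X, x)` is homotopy equivalent to a finite bouquet of spheres of positive
dimensions. -/
def IsHomotopyBouquet (x : X) : Prop :=
  ∃ (ι : Type) (_ : Fintype ι) (d : ι → ℕ), (∀ i, 0 < d i) ∧ PointedEquiv x (bouquetPt d)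

theorem IsHomotopyBouquet.of_pointedEquiv {x : X} {y : Y} (h : IsHomotopyBouquet y)
    (e : PointedEquiv x y) : IsHomotopyBouquet x := by
  obtain ⟨ι, hι, d, hd, h⟩ := h
  exact ⟨ι, hι, d, hd, e.trans h⟩

theorem IsHomotopyBouquet.wedge {x : X} {y : Y} (hx : IsHomotopyBouquet x)
    (hy : IsHomotopyBouquet y) : IsHomotopyBouquet (wedgePt x y) := by
  obtain ⟨ι, _, d, hd, hX⟩ := hx
  obtain ⟨κ, _, e, he, hY⟩ := hy
  exact ⟨ι ⊕ κ, inferInstance, Sum.elim d e, by rintro (i | i) <;> simp [hd, he],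
    (hX.wedge hY).trans (bouquet_sumElim_pointedEquiv d e)⟩

theorem IsHomotopyBouquet.exists_homotopyEquiv {x : X} (h : IsHomotopyBouquet x) :
    ∃ (n : ℕ) (d : Fin n → ℕ), (∀ i, 0 < d i) ∧
      Nonempty (ContinuousMap.HomotopyEquiv X (WedgeOfSpheres (Fin n) d)) := by
  obtain ⟨ι, _, d, hd, e⟩ := h
  let σ := (Fintype.equivFin ι).symm
  obtain ⟨φ⟩ := nonempty_homeomorph_bouquet σ d
  obtain ⟨ψ⟩ := e.nonempty_homotopyEquiv
  exact ⟨_, d ∘ σ, fun i => hd _, ⟨ψ.trans φ.symm.toHomotopyEquiv⟩⟩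

theorem isHomotopyBouquet_of_contracts {x : X} (H : unitInterval × X → X) (hH : Continuous H)
    (h0 : ∀ p, H (0, p) = p) (h1 : ∀ p, H (1, p) = x) (hx : ∀ t, H (t, x) = x) :
    IsHomotopyBouquet x := by
  refine ⟨Empty, inferInstance, Empty.elim, fun i => i.elim,
    ⟨fun _ => bouquetPt _, by fun_prop⟩, ⟨fun _ => x, by fun_prop⟩, rfl, rfl, ?_, ?_⟩
  · exact (homotopicRel_singleton_of (f := ContinuousMap.id X) H hH h0 h1 hx).symm
  · rw [show ContinuousMap.comp _ _ = ContinuousMap.id _ from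
      ContinuousMap.ext fun w => Subtype.ext (funext fun i => i.elim)]
    exact ContinuousMap.HomotopicRel.refl _

end Bouquets


/-! ### Radial models of iterated suspensions -/

section Models

variable {α : Type*} {S : Set α} {K L : Set (Finset α)} {a b : α}

/-- Vectors whose coordinates outside `S` are nonnegative and supported in a face of `K`. -/
def modelCone (S : Set α) (K : Set (Finset α)) : Set (α → ℝ) :=
  {x | (∀ a ∉ S, 0 ≤ x a) ∧ ∃ σ ∈ K, ∀ a ∉ S, x a ≠ 0 → a ∈ σ}

theorem modelCone_mono (h : K ⊆ L) : modelCone S K ⊆ modelCone S L :=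
  fun _ hx => ⟨hx.1, hx.2.imp fun _ hσ => ⟨h hσ.1, hσ.2⟩⟩

theorem zero_mem_modelCone (h : ∅ ∈ K) : (0 : α → ℝ) ∈ modelCone S K :=
  ⟨fun _ _ => le_rfl, ∅, h, by simp⟩

theorem smul_mem_modelCone {x : α → ℝ} (hx : x ∈ modelCone S K) {c : ℝ} (hc : 0 ≤ c) :
    c • x ∈ modelCone S K :=
  ⟨fun a ha => mul_nonneg hc (hx.1 a ha), hx.2.imp fun _ hσ =>
    ⟨hσ.1, fun a ha h => hσ.2 a ha (right_ne_zero_of_mul h)⟩⟩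

theorem add_mem_modelCone {x y : α → ℝ} (hx : x ∈ modelCone S K) (hy : y ∈ modelCone S K)
    (h : ∀ a ∉ S, y a ≠ 0 → x a ≠ 0) : x + y ∈ modelCone S K := by
  refine ⟨fun a ha => add_nonneg (hx.1 a ha) (hy.1 a ha), hx.2.imp fun σ hσ =>
    ⟨hσ.1, fun a ha h' => hσ.2 a ha fun h0 => h' ?_⟩⟩
  rw [Pi.add_apply, h0, zero_add]
  by_contra h1
  exact h a ha h1 h0

section Vertex

variable [DecidableEq α]

theorem single_mem_modelCone_iff {r : ℝ} (hr : 0 < r) (ha : a ∉ S) (hK : IsSimplicialComplex K) :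
    Pi.single a r ∈ modelCone S K ↔ {a} ∈ K := by
  constructor
  · rintro ⟨-, σ, hσ, h⟩
    exact hK σ hσ _ (singleton_subset_iff.2 (h a ha (by simpa using hr.ne')))
  · intro h
    refine ⟨fun c _ => ?_, _, h, fun c _ hc => ?_⟩
    · by_cases hca : c = a
      · subst hca; simpa using hr.le
      · simp [hca]
    · by_contra hca
      exact hc (by simp [mem_singleton.not.1 hca])

theorem apply_eq_zero_of_mem_modelCone {x : α → ℝ} (hx : x ∈ modelCone S (delC K a))
    (ha : a ∉ S) : x a = 0 := by
  obtain ⟨-, σ, hσ, h⟩ := hx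
  by_contra h0
  exact hσ.2 (h a ha h0)

theorem update_mem_modelCone_delC (hK : IsSimplicialComplex K) {x : α → ℝ}
    (hx : x ∈ modelCone S K) : Function.update x a 0 ∈ modelCone S (delC K a) := by
  obtain ⟨h0, σ, hσ, h⟩ := hx
  refine ⟨fun c hc => ?_, σ.erase a, ⟨hK σ hσ _ (erase_subset _ _), by simp⟩, fun c hc hx => ?_⟩
  · by_cases hca : c = a
    · subst hca; simp
    · simpa [hca] using h0 c hc
  · by_cases hca : c = a
    · subst hca; simp at hx
    · exact mem_erase.2 ⟨hca, h c hc (by simpa [hca] using hx)⟩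

theorem update_mem_modelCone_linkC (hK : IsSimplicialComplex K) {x : α → ℝ}
    (hx : x ∈ modelCone S K) (ha : a ∉ S) (hxa : x a ≠ 0) :
    Function.update x a 0 ∈ modelCone S (linkC K a) := by
  obtain ⟨h0, σ, hσ, h⟩ := hx
  refine ⟨fun c hc => ?_, σ.erase a, ⟨hK σ hσ _ (erase_subset _ _), by simp, ?_⟩,
    fun c hc hx => ?_⟩
  · by_cases hca : c = a
    · subst hca; simp
    · simpa [hca] using h0 c hc
  · rwa [insert_erase (h a ha hxa)]
  · by_cases hca : c = a
    · subst hca; simp at hx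
    · exact mem_erase.2 ⟨hca, h c hc (by simpa [hca] using hx)⟩

theorem add_single_mem_modelCone {x : α → ℝ} (hx : x ∈ modelCone S L) {r : ℝ} (hr : 0 ≤ r)
    (h : ∀ σ ∈ L, insert b σ ∈ K) : x + Pi.single b r ∈ modelCone S K := by
  obtain ⟨h0, σ, hσ, h'⟩ := hx
  refine ⟨fun c hc => add_nonneg (h0 c hc) ?_, _, h σ hσ, fun c hc hx => ?_⟩
  · by_cases hca : c = b
    · subst hca; simpa using hr
    · simp [hca]
  · by_cases hca : c = b
    · simp [hca]
    · exact mem_insert_of_mem (h' c hc (by simpa [hca] using hx))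

theorem update_mem_modelCone_of_insert {x : α → ℝ} (hx : x ∈ modelCone (insert a S) L) :
    Function.update x a 0 ∈ modelCone S L := by
  obtain ⟨h0, σ, hσ, h⟩ := hx
  refine ⟨fun c hc => ?_, σ, hσ, fun c hc hx => ?_⟩
  · by_cases hca : c = a
    · subst hca; simp
    · simpa [hca] using h0 c (by simp [hca, hc])
  · by_cases hca : c = a
    · subst hca; simp at hx
    · exact h c (by simp [hca, hc]) (by simpa [hca] using hx)

theorem add_single_mem_modelCone_insert {x : α → ℝ} (hx : x ∈ modelCone S L) (r : ℝ) :
    x + Pi.single a r ∈ modelCone (insert a S) L := by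
  obtain ⟨h0, σ, hσ, h⟩ := hx
  refine ⟨fun c hc => ?_, σ, hσ, fun c hc hx => ?_⟩
  · rw [Set.mem_insert_iff, not_or] at hc
    simpa [hc.1] using h0 c hc.2
  · rw [Set.mem_insert_iff, not_or] at hc
    exact h c hc.2 (by simpa [hc.1] using hx)

theorem update_zero_add_single (x : α → ℝ) (a : α) :
    Function.update x a 0 + Pi.single a (x a) = x := by
  funext c
  by_cases hca : c = a
  · subst hca; simp
  · simp [hca]

end Vertex

variable [Fintype α]

/-- The points of `modelCone S K` of norm one. Radially, this is the join of the realization of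
`K` with one two-point space for every element of `S`. -/
def modelSpace (S : Set α) (K : Set (Finset α)) : Set (α → ℝ) := {x | x ∈ modelCone S K ∧ ‖x‖ = 1}

/-- Radial projection to the model space. -/
noncomputable def radial (x : α → ℝ) (h : x ∈ modelCone S K ∧ x ≠ 0) : modelSpace S K :=
  ⟨‖x‖⁻¹ • x, smul_mem_modelCone h.1 (by positivity), norm_smul_inv_norm h.2⟩

theorem radial_eq {x : α → ℝ} {h : x ∈ modelCone S K ∧ x ≠ 0} {p : modelSpace S K} {c : ℝ}
    (hc : 0 < c) (hx : x = c • p.1) : radial x h = p := by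
  refine Subtype.ext ?_
  subst hx
  simp only [radial]
  rw [norm_smul, p.2.2, Real.norm_of_nonneg hc.le, mul_one, smul_smul, inv_mul_cancel₀ hc.ne',
    one_smul]

theorem radial_eq_radial {x y : α → ℝ} {hx : x ∈ modelCone S K ∧ x ≠ 0}
    {hy : y ∈ modelCone S K ∧ y ≠ 0} {c : ℝ} (hc : 0 < c) (h : x = c • y) :
    radial x hx = radial y hy := by
  have h0 := norm_pos_iff.2 hy.2
  refine radial_eq (c := c * ‖y‖) (by positivity) ?_
  rw [radial, smul_smul, mul_assoc, mul_inv_cancel₀ h0.ne', mul_one, h]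

theorem continuous_radial {T : Type*} [TopologicalSpace T] {w : T → α → ℝ} (hw : Continuous w)
    (h : ∀ q, w q ∈ modelCone S K ∧ w q ≠ 0) : Continuous fun q => radial (w q) (h q) :=
  Continuous.subtype_mk
    ((hw.norm.inv₀ fun q => norm_ne_zero_iff.2 (h q).2).smul hw) _

theorem modelSpace_ne_zero (p : modelSpace S K) : p.1 ≠ 0 :=
  norm_ne_zero_iff.1 (by rw [p.2.2]; exact one_ne_zero)

variable [DecidableEq α]

theorem norm_single_real (a : α) (r : ℝ) : ‖(Pi.single a r : α → ℝ)‖ = |r| := by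
  rw [Pi.norm_single, Real.norm_eq_abs]

theorem contractsNear_of_eq_single {p : modelSpace S K} {ε : ℝ} (hp : p.1 = Pi.single a ε) :
    ContractsNear p := by
  have hε : |ε| = 1 := by simpa [hp, norm_single_real] using p.2.2
  have hε2 : ε * ε = 1 := by rw [← abs_mul_abs_self, hε, one_mul]
  have hle (q : modelSpace S K) : ε * q.1 a ≤ 1 := by
    refine (le_abs_self _).trans ?_
    rw [abs_mul, hε, one_mul, ← q.2.2]
    exact norm_le_pi_norm q.1 a
  let m : modelSpace S K → ℝ := fun q => min 1 (2 * max 0 (ε * q.1 a))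
  have ha : Continuous fun q : modelSpace S K => q.1 a :=
    (continuous_apply a).comp continuous_subtype_val
  have hm : Continuous m :=
    continuous_const.min (continuous_const.mul (continuous_const.max (continuous_const.mul ha)))
  have hm0 (q) : 0 ≤ m q := le_min zero_le_one (by positivity)
  have hm1 (q) : m q ≤ 1 := min_le_left _ _
  have hmp : m p = 1 := by simp [m, hp, hε2]
  have hmem (q : unitInterval × modelSpace S K) :
      (1 - q.1 * m q.2) • q.2.1 + (q.1 * m q.2) • p.1 ∈ modelCone S K ∧
      (1 - q.1 * m q.2) • q.2.1 + (q.1 * m q.2) • p.1 ≠ 0 := by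
    obtain ⟨t, q⟩ := q
    have h0 : 0 ≤ t * m q := mul_nonneg t.2.1 (hm0 q)
    have h1 : t * m q ≤ 1 := mul_le_one₀ t.2.2 (hm0 q) (hm1 q)
    simp only
    rcases le_or_gt (ε * q.1 a) 0 with h | h
    · have : m q = 0 := by simp [m, max_eq_left h]
      simpa [this] using ⟨q.2.1, modelSpace_ne_zero q⟩
    · have hq : q.1 a ≠ 0 := right_ne_zero_of_mul h.ne'
      by_cases ht : t * m q = 1
      · simpa [ht] using ⟨p.2.1, modelSpace_ne_zero p⟩
      have h1' : 0 < 1 - t * m q := sub_pos.2 (lt_of_le_of_ne h1 ht)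
      constructor
      · refine add_mem_modelCone (smul_mem_modelCone q.2.1 h1'.le)
          (smul_mem_modelCone p.2.1 h0) fun c _ hc => ?_
        have : c = a := by
          by_contra hca
          simp [hp, hca] at hc
        subst this
        exact mul_ne_zero h1'.ne' hq
      · intro h2
        have h3 := congrArg (ε * ·) (congrFun h2 a)
        simp only [hp, Pi.add_apply, Pi.smul_apply, smul_eq_mul, Pi.single_eq_same,
          Pi.zero_apply, mul_zero] at h3
        have h4 : (1 - t * m q) * (ε * q.1 a) + t * m q * (ε * ε) = 0 := by linarith
        have := mul_pos h1' h
        nlinarith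
  refine ⟨fun q => radial _ (hmem q), fun q => max 0 (2 * (ε * q.1 a) - 1),
    continuous_radial (by fun_prop) hmem,
    continuous_const.max ((continuous_const.mul (continuous_const.mul ha)).sub continuous_const),
    fun q => ?_, fun t => ?_, ?_, fun q => ?_,
    fun q hq => ?_⟩
  · exact radial_eq one_pos (by simp)
  · exact radial_eq one_pos (by simp [hmp, ← add_smul])
  · simp [hp, hε2]; norm_num
  · exact ⟨le_max_left _ _, max_le zero_le_one (by linarith [hle q])⟩
  · have h1 : 0 < 2 * (ε * q.1 a) - 1 := by simpa using hq
    have h2 : m q = 1 := min_eq_left (by linarith [le_max_right 0 (ε * q.1 a)])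
    exact radial_eq one_pos (by simp [h2])

theorem norm_eq_norm_update_or (x : α → ℝ) (a : α) :
    ‖x‖ = ‖Function.update x a 0‖ ∨ ‖x‖ = |x a| := by
  rcases le_total ‖Function.update x a 0‖ |x a| with h | h
  · refine Or.inr (le_antisymm ((pi_norm_le_iff_of_nonneg (abs_nonneg _)).2 fun c => ?_)
      (norm_le_pi_norm x a))
    by_cases hca : c = a
    · subst hca; rfl
    · refine le_trans ?_ h
      simpa [hca] using norm_le_pi_norm (Function.update x a 0) c
  · refine Or.inl (le_antisymm ((pi_norm_le_iff_of_nonneg (norm_nonneg _)).2 fun c => ?_)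
      ((pi_norm_le_iff_of_nonneg (norm_nonneg _)).2 fun c => ?_))
    · by_cases hca : c = a
      · subst hca; exact h
      · simpa [hca] using norm_le_pi_norm (Function.update x a 0) c
    · by_cases hca : c = a
      · subst hca; simp
      · simpa [hca] using norm_le_pi_norm x c

end Models

/-! ### Splitting off a vertex whose link lies in a cone -/

section Splitting

variable {α : Type*} [DecidableEq α] {S : Set α} {K : Set (Finset α)} {a b : α}

/-- The link of the vertex `a` is contained in a cone with apex `b` in the deletion of `a`; both
vertices lie outside `S`. -/
structure IsSplitting (S : Set α) (K : Set (Finset α)) (a b : α) : Prop where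
  complex : IsSimplicialComplex K
  notMem_left : a ∉ S
  notMem_right : b ∉ S
  ne : b ≠ a
  vertex : {a} ∈ K
  insert_mem : ∀ τ ∈ linkC K a, insert b τ ∈ delC K a

theorem IsSplitting.zero_mem (h : IsSplitting S K a b) : (0 : α → ℝ) ∈ modelCone S (linkC K a) :=
  zero_mem_modelCone ⟨h.complex _ h.vertex _ (empty_subset _), by simp, h.vertex⟩

theorem delC_subset : delC K a ⊆ K := fun _ h => h.1

theorem smul_add_single_ne_zero {y : α → ℝ} {A r : ℝ} (hy : y a = 0)
    (h : r ≠ 0 ∨ (A ≠ 0 ∧ y ≠ 0)) : A • y + Pi.single a r ≠ 0 := by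
  intro h0
  have hr : r = 0 := by simpa [hy] using congrFun h0 a
  subst hr
  rw [Pi.single_zero, add_zero, smul_eq_zero] at h0
  tauto

theorem smul_add_single_ne_zero_of_nonneg {y : α → ℝ} {A r : ℝ} (hy : 0 ≤ y a) (hA : 0 ≤ A)
    (hr : 0 ≤ r) (h : r ≠ 0 ∨ (A ≠ 0 ∧ y ≠ 0)) : A • y + Pi.single a r ≠ 0 := by
  intro h0
  have hr' : A * y a + r = 0 := by simpa using congrFun h0 a
  have hr : r = 0 := le_antisymm (by linarith [mul_nonneg hA hy]) hr
  subst hr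
  rw [Pi.single_zero, add_zero, smul_eq_zero] at h0
  tauto

theorem continuous_smul_add_single {T : Type*} [TopologicalSpace T] {A r : T → ℝ}
    {y : T → α → ℝ} (hA : Continuous A) (hy : Continuous y) (hr : Continuous r) (a : α) :
    Continuous fun q => A q • y q + Pi.single a (r q) :=
  (hA.smul hy).add ((continuous_single (A := fun _ : α => ℝ) a).comp hr)

theorem continuous_update_zero {T : Type*} [TopologicalSpace T] {y : T → α → ℝ}
    (hy : Continuous y) (a : α) : Continuous fun q => Function.update (y q) a 0 :=
  hy.update a continuous_const

/-- The map gluing the two parts of the wedge. -/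
noncomputable def glueVec (a : α) (d z : α → ℝ) : α → ℝ :=
  Function.update z a 0 + Pi.single a (max 0 (z a)) + max 0 (-z a) • d

theorem glueVec_of_eq_single (d : α → ℝ) : glueVec a d (Pi.single a (-1)) = d := by
  have : Function.update (Pi.single a (-1) : α → ℝ) a 0 = 0 := by simp [Pi.single]
  simp [glueVec, this]

theorem glueVec_smul (d z : α → ℝ) {c : ℝ} (hc : 0 ≤ c) :
    glueVec a d (c • z) = c • glueVec a d z := by
  have h1 : max 0 (c * z a) = c * max 0 (z a) := by rw [mul_max_of_nonneg _ _ hc, mul_zero]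
  have h2 : max 0 (-(c * z a)) = c * max 0 (-z a) := by
    rw [mul_max_of_nonneg _ _ hc, mul_zero, mul_neg]
  have h3 : Function.update (c • z) a 0 = c • Function.update z a 0 := by
    rw [← Function.update_smul, smul_zero]
  rw [glueVec, glueVec, h3, Pi.smul_apply, smul_eq_mul, h1, h2, smul_add, smul_add, smul_smul,
    ← Pi.single_smul, smul_eq_mul]

theorem continuous_glueVec (a : α) :
    Continuous fun q : (α → ℝ) × (α → ℝ) => glueVec a q.1 q.2 := by
  have ha : Continuous fun q : (α → ℝ) × (α → ℝ) => q.2 a :=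
    (continuous_apply a).comp continuous_snd
  exact ((continuous_update_zero continuous_snd a).add
    ((continuous_single (A := fun _ : α => ℝ) a).comp (continuous_const.max ha))).add
    ((continuous_const.max ha.neg).smul continuous_fst)

/-- The two parameters of a homotopy performed in two stages. -/
theorem exists_stages : ∃ u v : unitInterval → ℝ, Continuous u ∧ Continuous v ∧
    (∀ t, 0 ≤ u t) ∧ (∀ t, u t ≤ 1) ∧ (∀ t, 0 ≤ v t) ∧ (∀ t, v t ≤ 1) ∧
    (∀ t, v t = 0 ∨ u t = 1) ∧ u 0 = 0 ∧ v 0 = 0 ∧ u 1 = 1 ∧ v 1 = 1 := by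
  refine ⟨fun t => min 1 (2 * (t : ℝ)), fun t => max 0 (2 * (t : ℝ) - 1), by fun_prop,
    by fun_prop, fun t => ?_, fun t => min_le_left _ _, fun t => le_max_left _ _, fun t => ?_,
    fun t => ?_, ?_, ?_, ?_, ?_⟩
  · exact le_min zero_le_one (by linarith [t.2.1])
  · exact max_le zero_le_one (by linarith [t.2.2])
  · rcases le_total (2 * (t : ℝ)) 1 with h | h
    · exact Or.inl (max_eq_left (by linarith))
    · exact Or.inr (min_eq_left h)
  all_goals norm_num

variable [Fintype α]

theorem modelSpace_bounds (p : modelSpace S K) (ha : a ∉ S) : 0 ≤ p.1 a ∧ p.1 a ≤ 1 ∧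
    0 ≤ ‖Function.update p.1 a 0‖ ∧ ‖Function.update p.1 a 0‖ ≤ 1 ∧
    (‖Function.update p.1 a 0‖ = 1 ∨ p.1 a = 1) := by
  have h0 := p.2.1.1 a ha
  have h1 := norm_eq_norm_update_or p.1 a
  rw [p.2.2, abs_of_nonneg h0] at h1
  refine ⟨h0, ?_, norm_nonneg _, ?_, h1.imp Eq.symm Eq.symm⟩
  · have := norm_le_pi_norm p.1 a
    rwa [p.2.2, Real.norm_of_nonneg h0] at this
  · rw [← p.2.2]
    refine (pi_norm_le_iff_of_nonneg (norm_nonneg _)).2 fun c => ?_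
    by_cases hca : c = a
    · subst hca; simp
    · simpa [hca] using norm_le_pi_norm p.1 c

/-- The first coordinate of the splitting map. -/
noncomputable def splitFst (a b : α) (x : α → ℝ) : α → ℝ :=
  max 0 (‖Function.update x a 0‖ - x a) • Function.update x a 0 + Pi.single b (x a)

/-- The second coordinate of the splitting map. -/
noncomputable def splitSnd (a : α) (x : α → ℝ) : α → ℝ :=
  max 0 (x a - ‖Function.update x a 0‖) • Function.update x a 0 +
    Pi.single a (x a - 2 * ‖Function.update x a 0‖)

theorem IsSplitting.splitFst_mem (h : IsSplitting S K a b) (p : modelSpace S K) :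
    splitFst a b p.1 ∈ modelCone S (delC K a) ∧ splitFst a b p.1 ≠ 0 := by
  obtain ⟨ht, ht1, hn, hn1, hnt⟩ := modelSpace_bounds p h.notMem_left
  constructor
  · by_cases h0 : p.1 a = 0
    · simp only [splitFst, h0, Pi.single_zero, add_zero]
      exact smul_mem_modelCone (update_mem_modelCone_delC h.complex p.2.1) (le_max_left _ _)
    · exact add_single_mem_modelCone (smul_mem_modelCone
        (update_mem_modelCone_linkC h.complex p.2.1 h.notMem_left h0) (le_max_left _ _)) ht
        h.insert_mem
  · refine smul_add_single_ne_zero_of_nonneg ?_ (le_max_left _ _) ht ?_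
    · simpa [h.ne] using p.2.1.1 b h.notMem_right
    · by_cases h0 : p.1 a = 0
      · have hn : ‖Function.update p.1 a 0‖ = 1 := by simpa [h0] using hnt
        exact Or.inr ⟨by simp [hn, h0], norm_ne_zero_iff.1 (by simp [hn])⟩
      · exact Or.inl h0

theorem IsSplitting.splitSnd_mem (h : IsSplitting S K a b) (p : modelSpace S K) :
    splitSnd a p.1 ∈ modelCone (insert a S) (linkC K a) ∧ splitSnd a p.1 ≠ 0 := by
  obtain ⟨ht, ht1, hn, hn1, hnt⟩ := modelSpace_bounds p h.notMem_left
  constructor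
  · refine add_single_mem_modelCone_insert ?_ _
    rcases le_or_gt (p.1 a) ‖Function.update p.1 a 0‖ with h0 | h0
    · rw [max_eq_left (by linarith), zero_smul]
      exact h.zero_mem
    · exact smul_mem_modelCone (update_mem_modelCone_linkC h.complex p.2.1 h.notMem_left
        (by linarith)) (le_max_left _ _)
  · refine smul_add_single_ne_zero (by simp) ?_
    by_contra! h'
    have h1 : p.1 a = 1 := by rcases hnt with h2 | h2 <;> linarith
    have h2 : ‖Function.update p.1 a 0‖ = 1 / 2 := by linarith
    rw [h1, h2] at h'
    have h3 := h'.2 (by norm_num)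
    rw [h3, norm_zero] at h2
    norm_num at h2

theorem IsSplitting.radial_splitSnd (h : IsSplitting S K a b)
    {z : modelSpace (insert a S) (linkC K a)} (hz : z.1 = Pi.single a (-1)) (p : modelSpace S K)
    (h0 : p.1 a ≤ ‖Function.update p.1 a 0‖) : radial _ (h.splitSnd_mem p) = z := by
  obtain ⟨ht, ht1, hn, hn1, hnt⟩ := modelSpace_bounds p h.notMem_left
  have h1 : ‖Function.update p.1 a 0‖ = 1 := hnt.elim id fun h2 => by linarith
  refine radial_eq (c := 2 - p.1 a) (by linarith) ?_
  rw [splitSnd, max_eq_left (by linarith), hz, ← Pi.single_smul, h1]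
  simp

theorem IsSplitting.radial_splitFst (h : IsSplitting S K a b) {d : modelSpace S (delC K a)}
    (hd : d.1 = Pi.single b 1) (p : modelSpace S K)
    (h0 : ‖Function.update p.1 a 0‖ ≤ p.1 a) : radial _ (h.splitFst_mem p) = d := by
  obtain ⟨ht, ht1, hn, hn1, hnt⟩ := modelSpace_bounds p h.notMem_left
  have h1 : p.1 a = 1 := hnt.elim (fun h2 => by linarith) id
  refine radial_eq (c := 1) one_pos ?_
  rw [splitFst, max_eq_left (by linarith), hd, h1]
  simp

theorem IsSplitting.split_mem (h : IsSplitting S K a b) {d : modelSpace S (delC K a)}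
    {z : modelSpace (insert a S) (linkC K a)} (hd : d.1 = Pi.single b 1)
    (hz : z.1 = Pi.single a (-1)) (p : modelSpace S K) :
    (radial _ (h.splitFst_mem p), radial _ (h.splitSnd_mem p)) ∈ wedgeSum d z :=
  (le_total (p.1 a) ‖Function.update p.1 a 0‖).symm.imp (h.radial_splitFst hd p)
    (h.radial_splitSnd hz p)

theorem IsSplitting.glueVec_mem (h : IsSplitting S K a b) {d : modelSpace S (delC K a)}
    {z : modelSpace (insert a S) (linkC K a)} (hd : d.1 = Pi.single b 1)
    (hz : z.1 = Pi.single a (-1)) (p : wedgeSum d z) :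
    glueVec a p.1.1.1 p.1.2.1 ∈ modelCone S K ∧ glueVec a p.1.1.1 p.1.2.1 ≠ 0 := by
  obtain ⟨⟨d', z'⟩, h0⟩ := p
  simp only [wedgeSum, Set.mem_ofPred_eq] at h0 ⊢
  rcases h0 with rfl | rfl
  · have hy := update_mem_modelCone_of_insert z'.2.1
    have hL : ∀ σ ∈ linkC K a, insert b σ ∈ K := fun σ hσ => (h.insert_mem σ hσ).1
    rw [glueVec, hd]
    rcases le_total (z'.1 a) 0 with hs | hs
    · rw [max_eq_left hs, max_eq_right (by linarith), Pi.single_zero, add_zero, ← Pi.single_smul,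
        smul_eq_mul, mul_one]
      refine ⟨add_single_mem_modelCone hy (by linarith) hL, ?_⟩
      have := smul_add_single_ne_zero_of_nonneg (A := 1) (r := -z'.1 a)
        (hy.1 b h.notMem_right) zero_le_one (by linarith) ?_
      · simpa using this
      · by_contra! h1
        refine modelSpace_ne_zero z' ?_
        rw [← update_zero_add_single z'.1 a, h1.2 one_ne_zero, neg_eq_zero.1 h1.1]
        simp
    · rw [max_eq_right hs, max_eq_left (by linarith), zero_smul, add_zero]
      refine ⟨add_single_mem_modelCone hy hs fun σ hσ => hσ.2.2, ?_⟩
      rw [update_zero_add_single]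
      exact modelSpace_ne_zero z'
  · rw [hz, glueVec_of_eq_single]
    exact ⟨modelCone_mono delC_subset d'.2.1, modelSpace_ne_zero d'⟩

theorem continuous_splitFst (a b : α) : Continuous (splitFst a b) := by
  have hy := continuous_update_zero (continuous_id (X := α → ℝ)) a
  exact continuous_smul_add_single (continuous_const.max (hy.norm.sub (continuous_apply a))) hy
    (continuous_apply a) b

theorem continuous_splitSnd (a : α) : Continuous (splitSnd a) := by
  have hy := continuous_update_zero (continuous_id (X := α → ℝ)) a
  exact continuous_smul_add_single (continuous_const.max ((continuous_apply a).sub hy.norm)) hy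
    ((continuous_apply a).sub (continuous_const.mul hy.norm)) a

end Splitting

section SplittingEquivalence

variable {α : Type*} [DecidableEq α] [Fintype α] {S : Set α} {K : Set (Finset α)} {a b : α}

/-- The splitting map to the wedge. -/
noncomputable def IsSplitting.split (h : IsSplitting S K a b) {d : modelSpace S (delC K a)}
    {z : modelSpace (insert a S) (linkC K a)} (hd : d.1 = Pi.single b 1)
    (hz : z.1 = Pi.single a (-1)) : C(modelSpace S K, wedgeSum d z) where
  toFun p := ⟨_, h.split_mem hd hz p⟩
  continuous_toFun := Continuous.subtype_mk
    ((continuous_radial ((continuous_splitFst a b).comp continuous_subtype_val) _).prodMk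
      (continuous_radial ((continuous_splitSnd a).comp continuous_subtype_val) _)) _

/-- The gluing map from the wedge. -/
noncomputable def IsSplitting.glue (h : IsSplitting S K a b) {d : modelSpace S (delC K a)}
    {z : modelSpace (insert a S) (linkC K a)} (hd : d.1 = Pi.single b 1)
    (hz : z.1 = Pi.single a (-1)) : C(wedgeSum d z, modelSpace S K) where
  toFun p := radial _ (h.glueVec_mem hd hz p)
  continuous_toFun := continuous_radial ((continuous_glueVec a).comp
    (f := fun p : wedgeSum d z => (p.1.1.1, p.1.2.1)) (by fun_prop)) _

theorem IsSplitting.triple_mem (h : IsSplitting S K a b) (p : modelSpace S K) {u v : ℝ}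
    (hu : 0 ≤ u) (hu1 : u ≤ 1) (hv : 0 ≤ v) (hv1 : v ≤ 1) (huv : v = 0 ∨ u = 1) :
    ((1 - u) * |p.1 a - ‖Function.update p.1 a 0‖| + u) • Function.update p.1 a 0 +
      Pi.single a ((1 - v) * max 0 (p.1 a - 2 * ‖Function.update p.1 a 0‖) + v * p.1 a) +
      Pi.single b ((1 - u) * min (p.1 a) (max 0 (2 * ‖Function.update p.1 a 0‖ - p.1 a))) ∈
        modelCone S K ∧
    ((1 - u) * |p.1 a - ‖Function.update p.1 a 0‖| + u) • Function.update p.1 a 0 +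
      Pi.single a ((1 - v) * max 0 (p.1 a - 2 * ‖Function.update p.1 a 0‖) + v * p.1 a) +
      Pi.single b ((1 - u) * min (p.1 a) (max 0 (2 * ‖Function.update p.1 a 0‖ - p.1 a))) ≠
        0 := by
  obtain ⟨ht, ht1, hn, hn1, hnt⟩ := modelSpace_bounds p h.notMem_left
  have hD := update_mem_modelCone_delC (a := a) h.complex p.2.1
  have hL := update_mem_modelCone_linkC h.complex p.2.1 h.notMem_left
  have hyb : 0 ≤ Function.update p.1 a 0 b := by simpa [h.ne] using p.2.1.1 b h.notMem_right
  have hya : Function.update p.1 a 0 a = 0 := by simp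
  have hn0 := norm_eq_zero (a := Function.update p.1 a 0)
  generalize Function.update p.1 a 0 = y at *
  generalize p.1 a = t at *
  generalize ‖y‖ = n at *
  have hA : 0 ≤ (1 - u) * |t - n| + u := by
    have := mul_nonneg (sub_nonneg.2 hu1) (abs_nonneg (t - n)); linarith
  rcases ht.eq_or_lt with rfl | ht0
  · have : n = 1 := by simpa using hnt
    subst this
    have hy : y ≠ 0 := fun h0 => one_ne_zero (hn0.2 h0)
    simpa [hy] using modelCone_mono delC_subset hD
  replace hL := smul_mem_modelCone (hL ht0.ne') hA
  have hinl : ∀ σ ∈ linkC K a, insert a σ ∈ K := fun σ hσ => hσ.2.2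
  have hinr : ∀ σ ∈ linkC K a, insert b σ ∈ K := fun σ hσ => (h.insert_mem σ hσ).1
  have hB : 0 ≤ (1 - v) * max 0 (t - 2 * n) + v * t := by
    have := mul_nonneg (sub_nonneg.2 hv1) (le_max_left 0 (t - 2 * n))
    have := mul_nonneg hv ht
    linarith
  have hC : 0 ≤ (1 - u) * min t (max 0 (2 * n - t)) :=
    mul_nonneg (sub_nonneg.2 hu1) (le_min ht (le_max_left _ _))
  rcases le_or_gt (2 * n) t with h2 | h2
  · have h1 : t = 1 := hnt.elim (fun h3 => by linarith) id
    subst h1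
    rw [max_eq_left (by linarith : 2 * n - 1 ≤ 0), min_eq_right zero_le_one, mul_zero,
      Pi.single_zero, add_zero]
    refine ⟨add_single_mem_modelCone hL hB hinl, smul_add_single_ne_zero hya ?_⟩
    by_cases hy : y = 0
    · left; simp [hn0.2 hy]
    · right
      refine ⟨?_, hy⟩
      rw [abs_of_nonneg (by linarith)]
      nlinarith
  rcases huv with rfl | rfl
  · rw [max_eq_left (by linarith : t - 2 * n ≤ 0), mul_zero, zero_mul, add_zero,
      Pi.single_zero, add_zero]
    refine ⟨add_single_mem_modelCone hL hC hinr,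
      smul_add_single_ne_zero_of_nonneg hyb hA hC ?_⟩
    rcases hu1.eq_or_lt with rfl | hu1
    · right
      exact ⟨by simp, fun hy => by linarith [hn0.2 hy]⟩
    · left
      exact (mul_pos (sub_pos.2 hu1) (lt_min ht0 (lt_max_of_lt_right (by linarith)))).ne'
  · rw [sub_self, zero_mul, zero_mul, Pi.single_zero, add_zero]
    rw [sub_self, zero_mul] at hL
    refine ⟨add_single_mem_modelCone hL hB hinl, smul_add_single_ne_zero hya ?_⟩
    by_cases hy : y = 0
    · have h0 := hn0.2 hy
      subst h0
      have h1 : t = 1 := hnt.elim (fun h3 => by linarith) id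
      left; simp [h1]
    · right
      exact ⟨by simp, hy⟩

theorem IsSplitting.glue_comp_split (h : IsSplitting S K a b) {d : modelSpace S (delC K a)}
    {z : modelSpace (insert a S) (linkC K a)} (hd : d.1 = Pi.single b 1)
    (hz : z.1 = Pi.single a (-1)) {p : modelSpace S K} (hp : p.1 = Pi.single b 1) :
    ((h.glue hd hz).comp (h.split hd hz)).HomotopicRel (ContinuousMap.id _) {p} := by
  obtain ⟨u, v, hu, hv, hu0, hu1, hv0, hv1, huv, u0, v0, u1, v1⟩ := exists_stages
  have hmem (q : unitInterval × modelSpace S K) :=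
    h.triple_mem q.2 (hu0 q.1) (hu1 q.1) (hv0 q.1) (hv1 q.1) (huv q.1)
  have hk (q) : (h.glue hd hz).comp (h.split hd hz) q = radial _ (hmem (0, q)) := by
    obtain ⟨ht, ht1, hn, hn1, hnt⟩ := modelSpace_bounds q h.notMem_left
    symm
    rcases le_total (q.1 a) ‖Function.update q.1 a 0‖ with h0 | h0
    · have h1 : ‖Function.update q.1 a 0‖ = 1 := hnt.elim id fun h2 => by linarith
      have h2 := norm_pos_iff.2 (h.splitFst_mem q).2
      refine radial_eq_radial (hy := h.glueVec_mem hd hz (h.split hd hz q))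
        (c := ‖splitFst a b q.1‖) h2 ?_
      simp only [IsSplitting.split, ContinuousMap.coe_mk, h.radial_splitSnd hz q h0, hz,
        glueVec_of_eq_single]
      simp only [radial]
      rw [smul_smul, mul_inv_cancel₀ h2.ne', one_smul, splitFst, u0, v0, h1,
        abs_of_nonpos (by linarith), max_eq_left (by linarith), max_eq_right (by linarith),
        min_eq_left (by linarith [le_max_right 0 (2 * 1 - q.1 a)])]
      simp [max_eq_right (sub_nonneg.2 ht1)]
    · have h1 : q.1 a = 1 := hnt.elim (fun h2 => by linarith) id
      have h2 := norm_pos_iff.2 (h.splitSnd_mem q).2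
      refine radial_eq_radial (hy := h.glueVec_mem hd hz (h.split hd hz q))
        (c := ‖splitSnd a q.1‖) h2 ?_
      simp only [IsSplitting.split, ContinuousMap.coe_mk, h.radial_splitFst hd q h0, hd]
      simp only [radial]
      rw [glueVec_smul _ _ (by positivity), smul_smul, mul_inv_cancel₀ h2.ne', one_smul, u0, v0,
        abs_of_nonneg (by linarith), min_eq_right (max_le (by linarith) (by linarith))]
      have e1 : splitSnd a q.1 a = q.1 a - 2 * ‖Function.update q.1 a 0‖ := by simp [splitSnd]
      have e2 : Function.update (splitSnd a q.1) a 0 =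
          (q.1 a - ‖Function.update q.1 a 0‖) • Function.update q.1 a 0 := by
        funext c
        by_cases hc : c = a
        · subst hc; simp
        · simp [hc, splitSnd, max_eq_right (sub_nonneg.2 h0)]
      rw [glueVec, e1, e2, ← Pi.single_smul]
      simp
  have hx : Continuous fun q : unitInterval × modelSpace S K => q.2.1 := by fun_prop
  have ht : Continuous fun q : unitInterval × modelSpace S K => q.2.1 a :=
    (continuous_apply a).comp hx
  have hy := continuous_update_zero hx a
  have hu' := hu.comp (continuous_fst (X := unitInterval) (Y := modelSpace S K))
  have hv' := hv.comp (continuous_fst (X := unitInterval) (Y := modelSpace S K))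
  refine homotopicRel_singleton_of (fun q => radial _ (hmem q)) (continuous_radial ?_ _)
    (fun q => (hk q).symm) (fun q => ?_) (fun t => ?_)
  · refine (continuous_smul_add_single
      (((continuous_const.sub hu').mul (ht.sub hy.norm).abs).add hu') hy
      (((continuous_const.sub hv').mul (continuous_const.max
        (ht.sub (continuous_const.mul hy.norm)))).add (hv'.mul ht)) a).add
      ((continuous_single (A := fun _ : α => ℝ) b).comp ((continuous_const.sub hu').mul
        (ht.min (continuous_const.max ((continuous_const.mul hy.norm).sub ht)))))
  · refine radial_eq one_pos ?_
    simp [u1, v1, update_zero_add_single]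
  · have e : ∀ t, radial _ (hmem (t, p)) = p := fun t => by
      have hpa : p.1 a = 0 := by simp [hp, h.ne.symm]
      have hpy : Function.update p.1 a 0 = p.1 := by rw [← hpa, Function.update_eq_self]
      refine radial_eq one_pos ?_
      simp [hpa, hpy, p.2.2]
    rw [hk, e, e]

theorem IsSplitting.glue_cases (h : IsSplitting S K a b) {d : modelSpace S (delC K a)}
    {z : modelSpace (insert a S) (linkC K a)} (hd : d.1 = Pi.single b 1)
    (hz : z.1 = Pi.single a (-1)) (p : wedgeSum d z) :
    (p.1.2 = z ∧ (h.glue hd hz p).1 = p.1.1.1) ∨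
    (p.1.1 = d ∧ (0 ≤ p.1.2.1 a → (h.glue hd hz p).1 = p.1.2.1) ∧
      ∃ c : ℝ, 0 < c ∧ (h.glue hd hz p).1 a = c * max 0 (p.1.2.1 a) ∧
      Function.update (h.glue hd hz p).1 a 0 =
        c • Function.update p.1.2.1 a 0 + Pi.single b (c * max 0 (-p.1.2.1 a))) := by
  rcases p.2.symm with h0 | h0
  · refine Or.inl ⟨h0, ?_⟩
    simp only [IsSplitting.glue, ContinuousMap.coe_mk, radial, h0, hz, glueVec_of_eq_single]
    rw [p.1.1.2.2, inv_one, one_smul]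
  · have hw := norm_pos_iff.2 (h.glueVec_mem hd hz p).2
    refine Or.inr ⟨h0, fun hs => ?_, _, inv_pos.2 hw, ?_, ?_⟩
    · have : glueVec a p.1.1.1 p.1.2.1 = p.1.2.1 := by
        rw [glueVec, max_eq_right hs, max_eq_left (by linarith), zero_smul, add_zero,
          update_zero_add_single]
      simp only [IsSplitting.glue, ContinuousMap.coe_mk, radial, this]
      rw [p.1.2.2.2, inv_one, one_smul]
    · simp [IsSplitting.glue, radial, glueVec, h0, hd, h.ne.symm]
    · funext c
      by_cases hc : c = a
      · subst hc; simp [h.ne.symm]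
      · simp only [IsSplitting.glue, ContinuousMap.coe_mk, radial]
        simp [hc, glueVec, h0, hd, Pi.single_apply]

theorem IsSplitting.fst_mem (h : IsSplitting S K a b) {d : modelSpace S (delC K a)}
    {z : modelSpace (insert a S) (linkC K a)} (hd : d.1 = Pi.single b 1)
    (hz : z.1 = Pi.single a (-1)) (p : wedgeSum d z) {x : modelSpace S K}
    (hx : x = h.glue hd hz p) {u : ℝ} (hu : 0 ≤ u) (hu1 : u ≤ 1) :
    ((1 - u) * max 0 (‖Function.update x.1 a 0‖ - x.1 a)) • Function.update x.1 a 0 +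
      (x.1 a + u) • p.1.1.1 ∈ modelCone S (delC K a) ∧
    ((1 - u) * max 0 (‖Function.update x.1 a 0‖ - x.1 a)) • Function.update x.1 a 0 +
      (x.1 a + u) • p.1.1.1 ≠ 0 := by
  obtain ⟨ht, ht1, hn, hn1, hnt⟩ := modelSpace_bounds x h.notMem_left
  have hA : 0 ≤ (1 - u) * max 0 (‖Function.update x.1 a 0‖ - x.1 a) :=
    mul_nonneg (sub_nonneg.2 hu1) (le_max_left _ _)
  rcases h.glue_cases hd hz p with ⟨h1, h2⟩ | ⟨h1, -, c, hc, h2, h3⟩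
  · rw [← hx] at h2
    have hxa : x.1 a = 0 := by
      rw [h2]; exact apply_eq_zero_of_mem_modelCone p.1.1.2.1 h.notMem_left
    have hxy : Function.update x.1 a 0 = x.1 := by rw [← hxa, Function.update_eq_self]
    rw [hxy, hxa, x.2.2, h2, ← add_smul, sub_zero, max_eq_right zero_le_one, mul_one, zero_add,
      sub_add_cancel, one_smul]
    exact ⟨p.1.1.2.1, modelSpace_ne_zero _⟩
  · rw [← hx] at h2 h3
    rw [h1, hd, ← Pi.single_smul, smul_eq_mul, mul_one]
    constructor
    · rw [h3, smul_add, smul_smul, add_assoc, ← Pi.single_smul, ← Pi.single_add, ← h3]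
      refine add_single_mem_modelCone (smul_mem_modelCone
        (update_mem_modelCone_of_insert p.1.2.2.1) (mul_nonneg hA hc.le)) ?_ h.insert_mem
      have := mul_nonneg hA (mul_nonneg hc.le (le_max_left 0 (-p.1.2.1 a)))
      rw [smul_eq_mul]
      linarith
    · refine smul_add_single_ne_zero_of_nonneg ?_ hA (by linarith) ?_
      · simpa [h.ne] using x.2.1.1 b h.notMem_right
      · by_contra! h4
        have h5 : u = 0 := by linarith
        have h6 : x.1 a = 0 := by linarith
        have h7 : ‖Function.update x.1 a 0‖ = 1 := hnt.elim id fun h8 => by linarith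
        have h8 := h4.2 (by rw [h5, h6, h7]; norm_num)
        rw [h8, norm_zero] at h7
        exact zero_ne_one h7

theorem IsSplitting.snd_mem (h : IsSplitting S K a b) {d : modelSpace S (delC K a)}
    {z : modelSpace (insert a S) (linkC K a)} (hd : d.1 = Pi.single b 1)
    (hz : z.1 = Pi.single a (-1)) (p : wedgeSum d z) {x : modelSpace S K}
    (hx : x = h.glue hd hz p) {v : ℝ} (hv : 0 ≤ v) (hv1 : v ≤ 1) :
    ((1 - v) * max 0 (x.1 a - ‖Function.update x.1 a 0‖) + v) • Function.update p.1.2.1 a 0 +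
      Pi.single a ((1 - v) * (x.1 a - 2 * ‖Function.update x.1 a 0‖) + v * p.1.2.1 a) ∈
        modelCone (insert a S) (linkC K a) ∧
    ((1 - v) * max 0 (x.1 a - ‖Function.update x.1 a 0‖) + v) • Function.update p.1.2.1 a 0 +
      Pi.single a ((1 - v) * (x.1 a - 2 * ‖Function.update x.1 a 0‖) + v * p.1.2.1 a) ≠ 0 := by
  obtain ⟨ht, ht1, hn, hn1, hnt⟩ := modelSpace_bounds x h.notMem_left
  have hA : 0 ≤ (1 - v) * max 0 (x.1 a - ‖Function.update x.1 a 0‖) :=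
    mul_nonneg (sub_nonneg.2 hv1) (le_max_left _ _)
  refine ⟨add_single_mem_modelCone_insert (smul_mem_modelCone
    (update_mem_modelCone_of_insert p.1.2.2.1) (by linarith)) _,
    smul_add_single_ne_zero (by simp) ?_⟩
  by_contra! h0
  obtain ⟨h0, h0'⟩ := h0
  rcases h.glue_cases hd hz p with ⟨h1, h2⟩ | ⟨h1, h4, c, hc, h2, h3⟩
  · rw [← hx] at h2
    have hxa : x.1 a = 0 := by
      rw [h2]; exact apply_eq_zero_of_mem_modelCone p.1.1.2.1 h.notMem_left
    have h3 : ‖Function.update x.1 a 0‖ = 1 := hnt.elim id fun h8 => by linarith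
    rw [h1, hz, Pi.single_eq_same, hxa, h3] at h0
    linarith
  · rw [← hx] at h2 h3 h4
    rcases le_or_gt (p.1.2.1 a) 0 with hs | hs
    · rw [max_eq_left hs, mul_zero] at h2
      have h5 : ‖Function.update x.1 a 0‖ = 1 := hnt.elim id fun h8 => by linarith
      rw [h5, h2] at h0 h0'
      have h6 : v = 1 := by
        have := mul_nonpos_of_nonneg_of_nonpos hv hs
        linarith
      rw [h6] at h0 h0'
      have h7 : p.1.2.1 a = 0 := by linarith
      refine modelSpace_ne_zero p.1.2 ?_
      rw [← update_zero_add_single p.1.2.1 a, h0' (by norm_num), h7]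
      simp
    · rw [← h4 hs.le] at h0 h0'
      by_cases h7 : Function.update x.1 a 0 = 0
      · have h8 : x.1 a = 1 := hnt.elim (fun h8 => by simp [h7] at h8) id
        rw [h7, h8, norm_zero] at h0
        linarith
      · have h8 : (1 - v) * max 0 (x.1 a - ‖Function.update x.1 a 0‖) + v = 0 := by
          by_contra h8; exact h7 (h0' h8)
        have h9 : v = 0 := by linarith
        rw [h9] at h0 h8
        have h10 := le_max_right 0 (x.1 a - ‖Function.update x.1 a 0‖)
        rcases hnt with h11 | h11 <;> linarith

theorem IsSplitting.pair_mem (h : IsSplitting S K a b) {d : modelSpace S (delC K a)}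
    {z : modelSpace (insert a S) (linkC K a)} (hd : d.1 = Pi.single b 1)
    (hz : z.1 = Pi.single a (-1)) (p : wedgeSum d z) {x : modelSpace S K}
    (hx : x = h.glue hd hz p) {u v : ℝ} (hu : 0 ≤ u) (hu1 : u ≤ 1) (hv : 0 ≤ v) (hv1 : v ≤ 1)
    (huv : v = 0 ∨ u = 1) :
    (radial _ (h.fst_mem hd hz p hx hu hu1), radial _ (h.snd_mem hd hz p hx hv hv1)) ∈
      wedgeSum d z := by
  obtain ⟨ht, ht1, hn, hn1, hnt⟩ := modelSpace_bounds x h.notMem_left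
  rcases h.glue_cases hd hz p with ⟨h1, h2⟩ | ⟨h1, -, -⟩
  · rw [← hx] at h2
    have hxa : x.1 a = 0 := by
      rw [h2]; exact apply_eq_zero_of_mem_modelCone p.1.1.2.1 h.notMem_left
    have h3 : ‖Function.update x.1 a 0‖ = 1 := hnt.elim id fun h8 => by linarith
    have h4 : Function.update (Pi.single a (-1) : α → ℝ) a 0 = 0 := by simp [Pi.single]
    refine Or.inr (radial_eq (h := h.snd_mem hd hz p hx hv hv1) (c := 2 - v) (by linarith) ?_)
    rw [h1, hz, h4, hxa, h3, smul_zero, zero_add, Pi.single_eq_same, ← Pi.single_smul,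
      smul_eq_mul]
    congr 1
    ring
  · rcases huv with rfl | rfl
    · rcases le_total (x.1 a) ‖Function.update x.1 a 0‖ with h0 | h0
      · have h3 : ‖Function.update x.1 a 0‖ = 1 := hnt.elim id fun h8 => by linarith
        refine Or.inr (radial_eq (h := h.snd_mem hd hz p hx hv hv1) (c := 2 - x.1 a)
          (by linarith) ?_)
        rw [hz, max_eq_left (by linarith), h3, ← Pi.single_smul]
        simp
      · have h3 : x.1 a = 1 := hnt.elim (fun h8 => by linarith) id
        refine Or.inl (radial_eq (h := h.fst_mem hd hz p hx hu hu1) (c := 1 + u)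
          (by linarith) ?_)
        rw [h1, max_eq_left (by linarith), h3]
        simp
    · refine Or.inl (radial_eq (h := h.fst_mem hd hz p hx hu hu1) (c := x.1 a + 1)
        (by linarith) ?_)
      rw [h1]
      simp

theorem IsSplitting.split_comp_glue (h : IsSplitting S K a b) {d : modelSpace S (delC K a)}
    {z : modelSpace (insert a S) (linkC K a)} (hd : d.1 = Pi.single b 1)
    (hz : z.1 = Pi.single a (-1)) :
    ((h.split hd hz).comp (h.glue hd hz)).HomotopicRel (ContinuousMap.id _) {wedgePt d z} := by
  obtain ⟨u, v, hu, hv, hu0, hu1, hv0, hv1, huv, u0, v0, u1, v1⟩ := exists_stages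
  have hmem1 (q : unitInterval × wedgeSum d z) :=
    h.fst_mem hd hz q.2 rfl (hu0 q.1) (hu1 q.1)
  have hmem2 (q : unitInterval × wedgeSum d z) :=
    h.snd_mem hd hz q.2 rfl (hv0 q.1) (hv1 q.1)
  have hmem (q : unitInterval × wedgeSum d z) :
      (radial _ (hmem1 q), radial _ (hmem2 q)) ∈ wedgeSum d z :=
    h.pair_mem hd hz q.2 rfl (hu0 q.1) (hu1 q.1) (hv0 q.1) (hv1 q.1) (huv q.1)
  have hk (q) : (h.split hd hz).comp (h.glue hd hz) q = ⟨_, hmem (0, q)⟩ := by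
    symm
    refine Subtype.ext (Prod.ext ?_ ?_)
    · refine radial_eq_radial (hx := hmem1 (0, q)) (hy := h.splitFst_mem (h.glue hd hz q))
        one_pos ?_
      rw [one_smul, splitFst, u0]
      congr 1
      · simp
      · rcases h.glue_cases hd hz q with ⟨h1, h2⟩ | ⟨h1, -, -⟩
        · have hxa : (h.glue hd hz q).1 a = 0 := by
            rw [h2]; exact apply_eq_zero_of_mem_modelCone q.1.1.2.1 h.notMem_left
          simp [hxa]
        · rw [h1, hd, ← Pi.single_smul]
          simp
    · refine radial_eq_radial (hx := hmem2 (0, q)) (hy := h.splitSnd_mem (h.glue hd hz q))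
        one_pos ?_
      obtain ⟨ht, ht1, hn, hn1, hnt⟩ := modelSpace_bounds (h.glue hd hz q) h.notMem_left
      rw [one_smul, splitSnd, v0]
      congr 1
      · rw [sub_zero, one_mul, add_zero]
        rcases le_or_gt ((h.glue hd hz q).1 a) ‖Function.update (h.glue hd hz q).1 a 0‖
          with h0 | h0
        · rw [max_eq_left (by linarith), zero_smul, zero_smul]
        · rcases h.glue_cases hd hz q with ⟨h1, h2⟩ | ⟨h1, h4, c, hc, h2, h3⟩
          · have hxa : (h.glue hd hz q).1 a = 0 := by
              rw [h2]; exact apply_eq_zero_of_mem_modelCone q.1.1.2.1 h.notMem_left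
            linarith
          · rcases le_total 0 (q.1.2.1 a) with hs | hs
            · rw [h4 hs]
            · rw [max_eq_left hs] at h2
              linarith
      · simp
  have h1 (q) : (⟨_, hmem (1, q)⟩ : wedgeSum d z) = q := by
    refine Subtype.ext (Prod.ext ?_ ?_)
    · obtain ⟨ht, -⟩ := modelSpace_bounds (h.glue hd hz q) h.notMem_left
      refine radial_eq (h := hmem1 (1, q)) (c := (h.glue hd hz q).1 a + 1) (by linarith) ?_
      simp [u1]
    · refine radial_eq (h := hmem2 (1, q)) one_pos ?_
      simp [v1, update_zero_add_single]
  have hpt (t) : (⟨_, hmem (t, wedgePt d z)⟩ : wedgeSum d z) = wedgePt d z := by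
    have hx : (h.glue hd hz (wedgePt d z)).1 = d.1 := congrArg Subtype.val <|
      radial_eq (h := h.glueVec_mem hd hz (wedgePt d z))
        (p := ⟨d.1, modelCone_mono delC_subset d.2.1, d.2.2⟩) one_pos
        (by simp [wedgePt, hz, glueVec_of_eq_single])
    have hxa : d.1 a = 0 := by simp [hd, h.ne.symm]
    have hxy : Function.update d.1 a 0 = d.1 := by rw [← hxa, Function.update_eq_self]
    refine Subtype.ext (Prod.ext ?_ ?_)
    · refine radial_eq (h := hmem1 (t, wedgePt d z)) one_pos ?_
      simp only [hx, hxa, hxy, d.2.2]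
      rw [sub_zero, max_eq_right zero_le_one, mul_one, zero_add]
      exact (add_smul _ _ _).symm.trans (by rw [sub_add_cancel]; rfl)
    · refine radial_eq (h := hmem2 (t, wedgePt d z)) (c := 2 - v t) (by linarith [hv1 t]) ?_
      have h4 : Function.update (Pi.single a (-1) : α → ℝ) a 0 = 0 := by simp [Pi.single]
      have hw : (wedgePt d z).1.2.1 = Pi.single a (-1) := hz
      simp only [hx, hxa, hxy, d.2.2, hw, h4]
      rw [smul_zero, zero_add, Pi.single_eq_same, ← Pi.single_smul, smul_eq_mul]
      congr 1
      ring
  refine homotopicRel_singleton_of (fun q => ⟨_, hmem q⟩) ?_ (fun q => (hk q).symm) h1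
    fun t => by rw [hk, hpt, hpt]
  have hg : Continuous fun q : unitInterval × wedgeSum d z => (h.glue hd hz q.2).1 :=
    continuous_subtype_val.comp ((h.glue hd hz).continuous.comp continuous_snd)
  have hx : Continuous fun q : unitInterval × wedgeSum d z => q.2.1.1.1 := by fun_prop
  have hw : Continuous fun q : unitInterval × wedgeSum d z => q.2.1.2.1 := by fun_prop
  have hwa := (continuous_apply a).comp hw
  have ht := (continuous_apply a).comp hg
  have hy := continuous_update_zero hg a
  have hu' := hu.comp (continuous_fst (X := unitInterval) (Y := wedgeSum d z))
  have hv' := hv.comp (continuous_fst (X := unitInterval) (Y := wedgeSum d z))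
  refine Continuous.subtype_mk ((continuous_radial ?_ _).prodMk (continuous_radial ?_ _)) _
  · exact (((continuous_const.sub hu').mul (continuous_const.max (hy.norm.sub ht))).smul hy).add
      ((ht.add hu').smul hx)
  · exact continuous_smul_add_single (((continuous_const.sub hv').mul
      (continuous_const.max (ht.sub hy.norm))).add hv') (continuous_update_zero hw a)
      (((continuous_const.sub hv').mul (ht.sub (continuous_const.mul hy.norm))).add
        (hv'.mul hwa)) a

theorem IsSplitting.pointedEquiv (h : IsSplitting S K a b) {d : modelSpace S (delC K a)}
    {z : modelSpace (insert a S) (linkC K a)} (hd : d.1 = Pi.single b 1)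
    (hz : z.1 = Pi.single a (-1)) {p : modelSpace S K} (hp : p.1 = Pi.single b 1) :
    PointedEquiv p (wedgePt d z) := by
  have hpa : p.1 a = 0 := by simp [hp, h.ne.symm]
  have hpy : Function.update p.1 a 0 = p.1 := by rw [← hpa, Function.update_eq_self]
  refine ⟨h.split hd hz, h.glue hd hz, Subtype.ext (Prod.ext ?_ ?_), ?_,
    h.glue_comp_split hd hz hp, h.split_comp_glue hd hz⟩
  · refine radial_eq (h := h.splitFst_mem p) one_pos ?_
    rw [splitFst, hpy, hpa, p.2.2]
    simp [wedgePt, hd, hp]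
  · exact h.radial_splitSnd hz p (by rw [hpa]; positivity)
  · refine radial_eq (h := h.glueVec_mem hd hz (wedgePt d z)) one_pos ?_
    simp [wedgePt, hz, glueVec_of_eq_single, hd, hp]

end SplittingEquivalence

/-! ### Grapes and bouquets -/

section Complexes

variable {α : Type*} [DecidableEq α] {S : Set α} {K : Set (Finset α)} {a b : α}

theorem IsSimplicialComplex.linkC (hK : IsSimplicialComplex K) (a : α) :
    IsSimplicialComplex (linkC K a) := fun σ hσ τ hτ =>
  ⟨hK σ hσ.1 τ hτ, fun h => hσ.2.1 (hτ h), hK _ hσ.2.2 _ (insert_subset_insert a hτ)⟩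

theorem IsSimplicialComplex.delC (hK : IsSimplicialComplex K) (a : α) :
    IsSimplicialComplex (delC K a) := fun σ hσ τ hτ =>
  ⟨hK σ hσ.1 τ hτ, fun h => hσ.2 (hτ h)⟩

theorem insert_mem_of_linkC_subset_coneC {L : Set (Finset α)} (h : linkC K a ⊆ coneC b L)
    (h' : coneC b L ⊆ delC K a) {τ : Finset α} (hτ : τ ∈ linkC K a) : insert b τ ∈ delC K a := by
  obtain ⟨σ, hσ, s, hs, rfl⟩ := h hτ
  refine h' ⟨σ, hσ, {b}, subset_rfl, ?_⟩
  ext c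
  have := @hs c
  simp only [mem_singleton] at this
  simp only [mem_insert, mem_union, mem_singleton]
  tauto

theorem empty_mem_linkC (hK : IsSimplicialComplex K) (ha : {a} ∈ K) : ∅ ∈ linkC K a :=
  ⟨hK _ ha _ (empty_subset _), by simp, ha⟩

theorem singleton_mem_delC_of_insert_mem (hK : IsSimplicialComplex K) (ha : {a} ∈ K)
    (h : ∀ τ ∈ linkC K a, insert b τ ∈ delC K a) : {b} ∈ K ∧ b ≠ a := by
  obtain ⟨h1, h2⟩ := h ∅ (empty_mem_linkC hK ha)
  exact ⟨h1, fun hab => h2 (by simp [hab])⟩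

variable [Fintype α]

/-- The point of the model space at a vertex. -/
noncomputable def vertexPt (hK : IsSimplicialComplex K) (ha : a ∉ S) (h : {a} ∈ K) :
    modelSpace S K :=
  ⟨Pi.single a 1, (single_mem_modelCone_iff one_pos ha hK).2 h, by simp [norm_single_real]⟩

theorem isHomotopyBouquet_vertexPt_of_unique (hK : IsSimplicialComplex K) (ha : a ∉ S)
    (h : {a} ∈ K) (huniq : ∀ b, {b} ∈ K → b = a) :
    IsHomotopyBouquet (vertexPt hK ha h) := by
  have hmem (q : unitInterval × modelSpace S K) :
      (1 - (q.1 : ℝ)) • q.2.1 + Pi.single a (q.1 : ℝ) ∈ modelCone S K ∧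
      (1 - (q.1 : ℝ)) • q.2.1 + Pi.single a (q.1 : ℝ) ≠ 0 := by
    obtain ⟨t, x⟩ := q
    have ht := t.2.1
    have ht1 := t.2.2
    constructor
    · refine add_single_mem_modelCone (smul_mem_modelCone x.2.1 (by linarith)) ht fun σ hσ => ?_
      refine hK _ h _ fun c hc => ?_
      rcases mem_insert.1 hc with rfl | hc
      · simp
      · simp [huniq c (hK _ hσ _ (singleton_subset_iff.2 hc))]
    · refine smul_add_single_ne_zero_of_nonneg (x.2.1.1 a ha) (by linarith) ht ?_
      by_cases h0 : (t : ℝ) = 0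
      · exact Or.inr ⟨by simp [h0], modelSpace_ne_zero x⟩
      · exact Or.inl h0
  refine isHomotopyBouquet_of_contracts (fun q => radial _ (hmem q)) (continuous_radial ?_ _)
    (fun p => radial_eq one_pos ?_) (fun p => radial_eq one_pos ?_)
    (fun t => radial_eq one_pos ?_)
  · exact continuous_smul_add_single (by fun_prop) (by fun_prop) (by fun_prop) a
  · simp
  · simp [vertexPt]
  · simp only [vertexPt, ← Pi.single_smul, ← Pi.single_add]
    simp

theorem exists_isHomotopyBouquet_of_no_vertex (hK : IsSimplicialComplex K) (h : ∀ a, {a} ∉ K)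
    [PathConnectedSpace (modelSpace S K)] :
    ∃ p : modelSpace S K, ContractsNear p ∧ IsHomotopyBouquet p := by
  classical
  obtain ⟨x⟩ := PathConnectedSpace.nonempty (X := modelSpace S K)
  have hsupp (x : modelSpace S K) (c : α) (hc : c ∉ S) : x.1 c = 0 := by
    obtain ⟨-, σ, hσ, h'⟩ := x.2.1
    by_contra h0
    exact h c (hK σ hσ _ (singleton_subset_iff.2 (h' c hc h0)))
  have hmem {y : α → ℝ} (hy : ∀ c ∉ S, y c = 0) : y ∈ modelCone S K := by
    obtain ⟨-, σ, hσ, -⟩ := x.2.1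
    exact ⟨fun c hc => (hy c hc).ge, σ, hσ, fun c hc h' => absurd (hy c hc) h'⟩
  obtain ⟨c, hc⟩ : ∃ c, x.1 c ≠ 0 := Function.ne_iff.1 (modelSpace_ne_zero x)
  have hcS : c ∈ S := by
    by_contra hcS
    exact hc (hsupp x c hcS)
  have hsingle (r : ℝ) : (Pi.single c r : α → ℝ) ∈ modelCone S K :=
    hmem fun e he => by simp [show e ≠ c from fun h' => he (h' ▸ hcS)]
  let p : modelSpace S K := ⟨Pi.single c 1, hsingle 1, by simp [norm_single_real]⟩
  refine ⟨p, contractsNear_of_eq_single rfl, ?_⟩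
  obtain ⟨d, hd⟩ : ∃ d, Fintype.card S = d + 1 :=
    Nat.exists_eq_succ_of_ne_zero (Fintype.card_pos_iff.2 ⟨⟨c, hcS⟩⟩).ne'
  have hd0 : 0 < d := by
    by_contra hd0
    obtain rfl : d = 0 := by omega
    have hS (e) (he : e ∈ S) : e = c := congrArg Subtype.val
      (Fintype.card_le_one_iff.1 hd.le ⟨e, he⟩ ⟨c, hcS⟩)
    let p' : modelSpace S K := ⟨Pi.single c (-1), hsingle _, by simp [norm_single_real]⟩
    have hcont : Continuous fun q : modelSpace S K => q.1 c :=
      (continuous_apply c).comp continuous_subtype_val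
    obtain ⟨q, hq⟩ := intermediate_value_univ p' p hcont
      (show (0 : ℝ) ∈ Set.Icc _ _ by simp [p, p'])
    refine modelSpace_ne_zero q (funext fun e => ?_)
    by_cases he : e ∈ S
    · rw [hS e he]; exact hq
    · exact hsupp q e he
  obtain ⟨e, he⟩ : ∃ e : S ≃ Fin (d + 1), e ⟨c, hcS⟩ = 0 := by
    let e := Fintype.equivFinOfCardEq hd
    exact ⟨e.trans (Equiv.swap (e ⟨c, hcS⟩) 0), by simp⟩
  let φ : (α → ℝ) → EuclideanSpace ℝ (Fin (d + 1)) :=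
    fun x => WithLp.toLp 2 fun i => x (e.symm i)
  let ψ : EuclideanSpace ℝ (Fin (d + 1)) → α → ℝ :=
    fun w a => if h : a ∈ S then w (e ⟨a, h⟩) else 0
  have hφ : Continuous φ := by fun_prop
  have hψ : Continuous ψ := continuous_pi fun a => by
    by_cases ha : a ∈ S
    · simp only [ψ, ha, dite_true]; fun_prop
    · simp only [ψ, ha, dite_false]; fun_prop
  have hφψ (w) : φ (ψ w) = w := by ext i; simp [φ, ψ]
  have hψφ (q : modelSpace S K) : ψ (φ q.1) = q.1 := by
    funext a
    by_cases ha : a ∈ S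
    · simp [φ, ψ, ha]
    · simp [φ, ψ, ha, hsupp q a ha]
  have hφs (r : ℝ) (x) : φ (r • x) = r • φ x := rfl
  have hψs (r : ℝ) (w) : ψ (r • w) = r • ψ w := by
    funext a
    by_cases ha : a ∈ S <;> simp [ψ, ha]
  have hφ0 (q : modelSpace S K) : φ q.1 ≠ 0 := fun h0 => modelSpace_ne_zero q <| by
    rw [← hψφ q, h0]; funext a; simp [ψ]
  have hψ0 (w : Metric.sphere (0 : EuclideanSpace ℝ (Fin (d + 1))) 1) :
      ψ w ∈ modelCone S K ∧ ψ w ≠ 0 := by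
    refine ⟨hmem fun a ha => by simp [ψ, ha], fun h0 => ?_⟩
    have h1 : (w : EuclideanSpace ℝ (Fin (d + 1))) = 0 := by
      rw [← hφψ w.1, h0]; ext i; simp [φ]
    exact ne_zero_of_mem_unit_sphere w h1
  let f (q : modelSpace S K) : Metric.sphere (0 : EuclideanSpace ℝ (Fin (d + 1))) 1 :=
    ⟨‖φ q.1‖⁻¹ • φ q.1, by simpa using norm_smul_inv_norm (𝕜 := ℝ) (hφ0 q)⟩
  have hf : Continuous f := Continuous.subtype_mk
    (((hφ.comp continuous_subtype_val).norm.inv₀ fun q => norm_ne_zero_iff.2 (hφ0 q)).smul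
      (hφ.comp continuous_subtype_val)) _
  refine ⟨Unit, inferInstance, fun _ => d, fun _ => hd0, PointedEquiv.of_inverse
    ⟨fun q => ⟨fun _ => f q, fun i j hij => absurd (Subsingleton.elim i j) hij⟩, by fun_prop⟩
    ⟨fun w => radial _ (hψ0 (w.1 ())), continuous_radial (hψ.comp
      (continuous_subtype_val.comp ((continuous_apply ()).comp continuous_subtype_val))) _⟩ ?_
    (fun q => ?_) (fun w => ?_)⟩
  · refine Subtype.ext (funext fun _ => Subtype.ext ?_)
    have : φ p.1 = EuclideanSpace.single 0 1 := by
      ext i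
      by_cases hi : i = 0
      · subst hi
        simp [φ, p, ← he]
      · have : (e.symm i : α) ≠ c := fun h' => hi <| by
          rw [← he, ← e.symm_apply_eq]
          exact Subtype.ext h'
        simp [φ, p, hi, this]
    simp [f, this, bouquetPt, spherePt]
  · refine radial_eq (h := hψ0 (f q)) (inv_pos.2 (norm_pos_iff.2 (hφ0 q))) ?_
    simp only [f, hψs, hψφ]
  · refine Subtype.ext (funext fun _ => Subtype.ext ?_)
    have hw : ‖(w.1 () : EuclideanSpace ℝ (Fin (d + 1)))‖ = 1 := by simp
    have h0 := norm_pos_iff.2 (hψ0 (w.1 ())).2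
    simp only [ContinuousMap.coe_mk, f, radial, hφs, hφψ, norm_smul, hw]
    rw [norm_inv, norm_norm, mul_one, inv_inv, smul_smul, mul_inv_cancel₀ h0.ne', one_smul]

theorem IsGrape.isHomotopyBouquet (hG : IsGrape K) (hK : IsSimplicialComplex K)
    (hS : ∀ s ∈ S, {s} ∉ K) [PathConnectedSpace (modelSpace S K)] {p : modelSpace S K}
    (hp : ContractsNear p) : IsHomotopyBouquet p := by
  suffices h : ∃ q : modelSpace S K, ContractsNear q ∧ IsHomotopyBouquet q by
    obtain ⟨q, hq, h⟩ := h
    exact h.of_pointedEquiv (hp.pointedEquiv_of_joined hq (PathConnectedSpace.joined p q))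
  clear hp p
  induction hG generalizing S with
  | atMostOneVertex K h =>
    by_cases hv : ∃ a, {a} ∈ K
    · obtain ⟨a, ha⟩ := hv
      have haS : a ∉ S := fun h' => hS a h' ha
      exact ⟨vertexPt hK haS ha, contractsNear_of_eq_single rfl,
        isHomotopyBouquet_vertexPt_of_unique hK haS ha fun b hb => h b a hb ha⟩
    · exact exists_isHomotopyBouquet_of_no_vertex hK (by simpa using hv)
  | wedge K a ha hcone hlink hdel ihlink ihdel =>
    obtain ⟨b, L, hL, hL'⟩ := hcone
    have hins : ∀ τ ∈ linkC K a, insert b τ ∈ delC K a := fun τ hτ =>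
      insert_mem_of_linkC_subset_coneC hL hL' hτ
    obtain ⟨hb, hba⟩ := singleton_mem_delC_of_insert_mem hK ha hins
    have haS : a ∉ S := fun h' => hS a h' ha
    have hbS : b ∉ S := fun h' => hS b h' hb
    have hsplit : IsSplitting S K a b := ⟨hK, haS, hbS, hba, ha, hins⟩
    let d : modelSpace S (delC K a) := vertexPt (hK.delC a) hbS ⟨hb, by simpa using hba.symm⟩
    let z : modelSpace (insert a S) (linkC K a) := ⟨Pi.single a (-1), by
      simpa using add_single_mem_modelCone_insert hsplit.zero_mem (-1), by
      simp [norm_single_real]⟩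
    have he := hsplit.pointedEquiv (d := d) (z := z) (p := vertexPt hK hbS hb) rfl rfl rfl
    obtain ⟨ε⟩ := he.nonempty_homotopyEquiv
    have := ε.pathConnectedSpace
    have := pathConnectedSpace_left_of_wedgeSum (x := d) (y := z)
    have := pathConnectedSpace_right_of_wedgeSum (x := d) (y := z)
    obtain ⟨d', hd', hd⟩ := ihdel (S := S) (hK.delC a) fun s hs h => hS s hs h.1
    obtain ⟨z', hz', hz⟩ := ihlink (S := insert a S) (hK.linkC a) fun s hs h => by
      rcases hs with rfl | hs
      · exact h.2.1 (mem_singleton_self _)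
      · exact hS s hs h.1
    refine ⟨vertexPt hK hbS hb, contractsNear_of_eq_single rfl,
      IsHomotopyBouquet.of_pointedEquiv (IsHomotopyBouquet.wedge ?_ ?_) he⟩
    · exact hd.of_pointedEquiv ((contractsNear_of_eq_single (ε := 1) rfl).pointedEquiv_of_joined
        hd' (PathConnectedSpace.joined _ _))
    · exact hz.of_pointedEquiv ((contractsNear_of_eq_single (ε := -1) rfl).pointedEquiv_of_joined
        hz' (PathConnectedSpace.joined _ _))

end Complexes

/-! ### Components of a complex -/

section Restriction

variable {α : Type*} {K : Set (Finset α)} {C : Set α}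

/-- The faces of `K` all of whose vertices lie in `C`. -/
def restrictC (K : Set (Finset α)) (C : Set α) : Set (Finset α) := {σ | σ ∈ K ∧ ∀ v ∈ σ, v ∈ C}

theorem IsSimplicialComplex.restrictC (hK : IsSimplicialComplex K) (C : Set α) :
    IsSimplicialComplex (restrictC K C) := fun σ hσ τ hτ =>
  ⟨hK σ hσ.1 τ hτ, fun v hv => hσ.2 v (hτ hv)⟩

theorem exists_apply_ne_zero [Fintype α] (y : realization K) : ∃ v, y.1 v ≠ 0 := by
  by_contra! h
  simpa [h] using y.2.2.1

theorem sum_pos_of_mem_modelSpace [Fintype α] (q : modelSpace ∅ K) :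
    0 < ∑ a, q.1 a := by
  obtain ⟨v, hv⟩ := Function.ne_iff.1 (modelSpace_ne_zero q)
  exact sum_pos' (fun a _ => q.2.1.1 a (Set.notMem_empty a))
    ⟨v, mem_univ v, (q.2.1.1 v (Set.notMem_empty v)).lt_of_ne' hv⟩

variable [DecidableEq α]

theorem IsGrape.of_insert_mem {a b : α} (ha : {a} ∈ K)
    (h : ∀ τ ∈ linkC K a, insert b τ ∈ delC K a) (hlink : IsGrape (linkC K a))
    (hdel : IsGrape (delC K a)) : IsGrape K := by
  refine .wedge K a ha ⟨b, linkC K a, fun τ hτ => ⟨τ, hτ, ∅, empty_subset _, by simp⟩, ?_⟩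
    hlink hdel
  rintro _ ⟨τ, hτ, s, hs, rfl⟩
  rcases subset_singleton_iff.1 hs with rfl | rfl
  · exact ⟨by simpa using hτ.1, by simpa using hτ.2.1⟩
  · rw [union_comm]
    exact h τ hτ

theorem linkC_restrictC {a : α} (ha : a ∈ C) :
    linkC (restrictC K C) a = restrictC (linkC K a) C := by
  ext τ
  simp only [linkC, restrictC, Set.mem_ofPred_eq, forall_mem_insert]
  tauto

theorem delC_restrictC (a : α) : delC (restrictC K C) a = restrictC (delC K a) C := by
  ext τ
  simp only [delC, restrictC, Set.mem_ofPred_eq]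
  tauto

theorem IsGrape.restrictC (hG : IsGrape K) (hK : IsSimplicialComplex K)
    (hC : ∀ u v, {u, v} ∈ K → u ∈ C → v ∈ C) : IsGrape (restrictC K C) := by
  induction hG with
  | atMostOneVertex K h => exact .atMostOneVertex _ fun a b ha hb => h a b ha.1 hb.1
  | wedge K a ha hcone hlink hdel ihlink ihdel =>
    obtain ⟨b, L, hL, hL'⟩ := hcone
    have hdel' := ihdel (hK.delC a) fun u v h => hC u v h.1
    have hlink' := ihlink (hK.linkC a) fun u v h => hC u v h.1
    by_cases haC : a ∈ C
    · rw [← linkC_restrictC haC] at hlink'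
      rw [← delC_restrictC] at hdel'
      have haK : {a} ∈ _root_.restrictC K C := ⟨ha, by simpa using haC⟩
      have hins {τ} (hτ : τ ∈ linkC (_root_.restrictC K C) a) : insert b τ ∈ delC K a :=
        insert_mem_of_linkC_subset_coneC hL hL' ⟨hτ.1.1, hτ.2.1, hτ.2.2.1⟩
      by_cases hbC : b ∈ C
      · refine .of_insert_mem (b := b) haK (fun τ hτ => ⟨⟨(hins hτ).1, ?_⟩, (hins hτ).2⟩)
          hlink' hdel'
        exact forall_mem_insert .. |>.2 ⟨hbC, hτ.1.2⟩
      · by_cases hc : ∃ c, c ≠ a ∧ {c} ∈ _root_.restrictC K C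
        · obtain ⟨c, hca, hc⟩ := hc
          refine .of_insert_mem (b := c) haK (fun τ hτ => ?_) hlink' hdel'
          obtain rfl : τ = ∅ := by
            refine eq_empty_of_forall_notMem fun v hv => hbC (hC v b ?_ (hτ.1.2 v hv))
            refine hK _ (hins hτ).1 _ ?_
            simp [insert_subset_iff, hv]
          exact ⟨by simpa using hc, by simpa using hca.symm⟩
        · push Not at hc
          refine .atMostOneVertex _ fun u v hu hv => ?_
          rw [not_imp_not.1 (hc u) hu, not_imp_not.1 (hc v) hv]
    · convert hdel' using 1
      ext τ
      simp only [_root_.restrictC, delC, Set.mem_ofPred_eq]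
      exact ⟨fun h => ⟨⟨h.1, fun h' => haC (h.2 a h')⟩, h.2⟩, fun h => ⟨h.1.1, h.2⟩⟩

variable [Fintype α]

theorem joined_of_support_subset {y z : realization K} {σ : Finset α} (hσ : σ ∈ K)
    (hy : ∀ a, y.1 a ≠ 0 → a ∈ σ) (hz : ∀ a, z.1 a ≠ 0 → a ∈ σ) : Joined y z := by
  refine (JoinedIn.of_segment_subset ?_).joined_subtype
  rintro _ ⟨s, t, hs, ht, hst, rfl⟩
  refine ⟨fun a => add_nonneg (mul_nonneg hs (y.2.1 a)) (mul_nonneg ht (z.2.1 a)), ?_,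
    σ, hσ, fun a ha => ?_⟩
  · simp only [Pi.add_apply, Pi.smul_apply, smul_eq_mul, sum_add_distrib, ← mul_sum, y.2.2.1,
      z.2.2.1, mul_one, hst]
  · by_contra h
    refine ha ?_
    simp [not_imp_comm.1 (hy a) h, not_imp_comm.1 (hz a) h]

/-- The point of the realization at a vertex. -/
noncomputable def realizationVertex {v : α} (hv : {v} ∈ K) : realization K :=
  ⟨Pi.single v 1, fun a => by by_cases h : a = v <;> simp [h], by simp,
    {v}, hv, fun a => by by_cases h : a = v <;> simp [h]⟩

theorem support_realizationVertex {v : α} (hv : {v} ∈ K) {σ : Finset α} (hσ : v ∈ σ) (a : α)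
    (ha : (realizationVertex hv).1 a ≠ 0) : a ∈ σ := by
  by_cases h : a = v
  · rwa [h]
  · simp [realizationVertex, h] at ha

/-- The vertices in the path component of a point. -/
def componentVertices (x : realization K) : Set α :=
  {v | ∃ hv : {v} ∈ K, Joined x (realizationVertex hv)}

theorem mem_componentVertices_of_mem (hK : IsSimplicialComplex K) (x : realization K) (u v : α)
    (h : {u, v} ∈ K) (hu : u ∈ componentVertices x) : v ∈ componentVertices x := by
  obtain ⟨hu, hx⟩ := hu
  exact ⟨hK _ h _ (by simp), hx.trans (joined_of_support_subset h
    (support_realizationVertex _ (by simp)) (support_realizationVertex _ (by simp)))⟩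

theorem exists_joined_realizationVertex (hK : IsSimplicialComplex K) (y : realization K) {v : α}
    (hv : y.1 v ≠ 0) : ∃ hv : {v} ∈ K, Joined y (realizationVertex hv) := by
  obtain ⟨-, -, σ, hσ, h⟩ := y.2
  exact ⟨hK σ hσ _ (singleton_subset_iff.2 (h v hv)),
    joined_of_support_subset hσ h (support_realizationVertex _ (h v hv))⟩

theorem joined_iff_support_subset (hK : IsSimplicialComplex K) {x y : realization K} :
    Joined x y ↔ ∀ v, y.1 v ≠ 0 → v ∈ componentVertices x := by
  constructor
  · intro h v hv
    obtain ⟨hv, h'⟩ := exists_joined_realizationVertex hK y hv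
    exact ⟨hv, h.trans h'⟩
  · intro h
    obtain ⟨v, hv⟩ := exists_apply_ne_zero y
    obtain ⟨_, hx⟩ := h v hv
    obtain ⟨_, hy⟩ := exists_joined_realizationVertex hK y hv
    exact hx.trans hy.symm

theorem connectedComponent_eq_pathComponent (hK : IsSimplicialComplex K) (x : realization K) :
    connectedComponent x = pathComponent x := by
  refine Set.Subset.antisymm (IsClopen.connectedComponent_subset ?_ (mem_pathComponent_self x))
    (pathComponent_subset_component x)
  have hcont (v : α) : Continuous fun y : realization K => y.1 v :=
    (continuous_apply v).comp continuous_subtype_val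
  have h1 : pathComponent x = {y | ∀ v ∉ componentVertices x, y.1 v = 0} := by
    ext y
    refine (joined_iff_support_subset hK).trans (forall_congr' fun v => ?_)
    exact not_imp_comm
  have h2 : (pathComponent x)ᶜ = {y | ∀ v ∈ componentVertices x, y.1 v = 0} := by
    ext y
    rw [h1]
    simp only [Set.mem_compl_iff, Set.mem_ofPred_eq]
    constructor
    · intro h v hv
      by_contra hvy
      push Not at h
      obtain ⟨u, hu, huy⟩ := h
      obtain ⟨-, -, σ, hσ, hs⟩ := y.2
      refine hu (mem_componentVertices_of_mem hK x v u (hK σ hσ _ ?_) hv)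
      simp [insert_subset_iff, hs u huy, hs v hvy]
    · intro h h'
      obtain ⟨v, hv⟩ := exists_apply_ne_zero y
      by_cases hvx : v ∈ componentVertices x
      · exact hv (h v hvx)
      · exact hv (h' v hvx)
  constructor
  · rw [h1]
    simp only [Set.ofPred_forall]
    exact isClosed_iInter fun v => isClosed_iInter fun _ => isClosed_eq (hcont v) continuous_const
  · rw [← isClosed_compl_iff, h2]
    simp only [Set.ofPred_forall]
    exact isClosed_iInter fun v => isClosed_iInter fun _ => isClosed_eq (hcont v) continuous_const

theorem nonempty_homeomorph_modelSpace (hK : IsSimplicialComplex K) (x : realization K) :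
    Nonempty (connectedComponent x ≃ₜ modelSpace ∅ (restrictC K (componentVertices x))) := by
  have hiff (y : realization K) :
      y ∈ connectedComponent x ↔ ∀ v, y.1 v ≠ 0 → v ∈ componentVertices x := by
    rw [connectedComponent_eq_pathComponent hK]
    exact joined_iff_support_subset hK
  have hf (y : connectedComponent x) :
      y.1.1 ∈ modelCone ∅ (restrictC K (componentVertices x)) ∧ y.1.1 ≠ 0 := by
    classical
    obtain ⟨h0, h1, σ, hσ, h⟩ := y.1.2
    refine ⟨⟨fun a _ => h0 a, σ.filter (y.1.1 · ≠ 0), ⟨hK σ hσ _ (filter_subset _ _),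
      fun v hv => (hiff y.1).1 y.2 v (mem_filter.1 hv).2⟩,
      fun a _ ha => mem_filter.2 ⟨h a ha, ha⟩⟩, fun h0 => ?_⟩
    simp [h0] at h1
  have hg (q : modelSpace ∅ (restrictC K (componentVertices x))) :
      (∑ a, q.1 a)⁻¹ • q.1 ∈ realization K := by
    obtain ⟨h0, σ, hσ, h⟩ := q.2.1
    have hpos := sum_pos_of_mem_modelSpace q
    refine ⟨fun a => mul_nonneg (inv_nonneg.2 hpos.le) (h0 a (Set.notMem_empty a)), ?_, σ, hσ.1,
      fun a ha => h a (Set.notMem_empty a) (right_ne_zero_of_mul ha)⟩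
    simp only [Pi.smul_apply, smul_eq_mul, ← mul_sum]
    exact inv_mul_cancel₀ hpos.ne'
  have hg' (q : modelSpace ∅ (restrictC K (componentVertices x))) :
      (⟨_, hg q⟩ : realization K) ∈ connectedComponent x := by
    refine (hiff _).2 fun v hv => ?_
    obtain ⟨h0, σ, hσ, h⟩ := q.2.1
    exact hσ.2 v (h v (Set.notMem_empty v) (right_ne_zero_of_mul hv))
  refine ⟨{
    toFun := fun y => radial _ (hf y)
    invFun := fun q => ⟨⟨_, hg q⟩, hg' q⟩
    left_inv := fun y => ?_
    right_inv := fun q => ?_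
    continuous_toFun := continuous_radial (by fun_prop) _
    continuous_invFun := Continuous.subtype_mk (Continuous.subtype_mk ?_ _) _ }⟩
  · refine Subtype.ext (Subtype.ext ?_)
    have hpos := norm_pos_iff.2 (hf y).2
    simp only [radial, Pi.smul_apply, smul_eq_mul, ← mul_sum, y.1.2.2.1]
    rw [mul_one, inv_inv, smul_smul, mul_inv_cancel₀ hpos.ne', one_smul]
  · exact radial_eq (inv_pos.2 (sum_pos_of_mem_modelSpace q)) rfl
  · refine Continuous.smul (Continuous.inv₀ (continuous_finsetSum _ fun a _ => ?_) fun q =>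
      (sum_pos_of_mem_modelSpace q).ne') continuous_subtype_val
    exact (continuous_apply a).comp continuous_subtype_val

end Restriction

/-- each connected component of the geometric realization of a combinatorial grape
is either contractible or homotopy equivalent to a wedge of spheres of positive dimensions
(a point in the case of the empty wedge). -/
theorem grape_components_wedge {α : Type*} [Fintype α] [DecidableEq α]
    (K : Set (Finset α)) (hK : IsSimplicialComplex K) (hG : IsGrape K)
    (x : realization K) :
    ContractibleSpace (connectedComponent x) ∨
      ∃ (n : ℕ) (d : Fin n → ℕ), (∀ i, 0 < d i) ∧
        Nonempty (ContinuousMap.HomotopyEquiv (connectedComponent x)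
          (WedgeOfSpheres (Fin n) d)) := by
  right
  have hL := hK.restrictC (componentVertices x)
  obtain ⟨e⟩ := nonempty_homeomorph_modelSpace hK x
  have : PathConnectedSpace (connectedComponent x) := by
    rw [connectedComponent_eq_pathComponent hK]
    exact isPathConnected_iff_pathConnectedSpace.1 isPathConnected_pathComponent
  have := e.toHomotopyEquiv.pathConnectedSpace
  obtain ⟨v, hv⟩ := exists_apply_ne_zero x
  have hvx := (joined_iff_support_subset hK).1 (Joined.refl x) v hv
  have hvL : {v} ∈ restrictC K (componentVertices x) := ⟨hvx.1, by simpa using hvx⟩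
  obtain ⟨n, d, hd, ⟨ε⟩⟩ := ((hG.restrictC hK (mem_componentVertices_of_mem hK x)
    ).isHomotopyBouquet hL (by simp) (contractsNear_of_eq_single (p := vertexPt hL
      (Set.notMem_empty v) hvL) rfl)).exists_homotopyEquiv
  exact ⟨n, d, hd, ⟨e.toHomotopyEquiv.trans ε⟩⟩
end

section
/- Let F be a forest with labelling λ : V(F) → ℕ. Then the geometric realization of BD^λ(F) is either contractible or homotopy equivalent to a wedge of spheres. -/
open Finset

/-- Degree of a vertex `v` in a finite set `H` of edges. -/
def edgeDeg {V : Type*} [DecidableEq V] (H : Finset (Sym2 V)) (v : V) : ℕ :=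
  (H.filter (fun e => v ∈ e)).card

/-- The bounded degree complex `BD^λ(G)`: its faces are the finite sets `H` of edges of `G`
such that every vertex `v` lies on at most `lam v` edges of `H`. -/
def BD {V : Type*} [DecidableEq V] (G : SimpleGraph V) (lam : V → ℕ) :
    Set (Finset (Sym2 V)) :=
  {H | ↑H ⊆ G.edgeSet ∧ ∀ v, edgeDeg H v ≤ lam v}

/-- A space has the homotopy type of a wedge of spheres: it is empty (a "`(-1)`-sphere"), or
homotopy equivalent to a finite wedge of spheres (a point in the case of the empty wedge). -/
def IsWedgeOfSpheres (X : Type*) [TopologicalSpace X] : Prop :=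
  IsEmpty X ∨
    ∃ (n : ℕ) (d : Fin n → ℕ),
      Nonempty (ContinuousMap.HomotopyEquiv X (WedgeOfSpheres (Fin n) d))

section Collapse

variable {α : Type*} [DecidableEq α]

/-- Families of finite sets obtained from the void family by adding free pairs
`σ, insert a σ` one at a time, i.e. the collapsible simplicial complexes and the void one. -/
inductive Collapsible : Set (Finset α) → Prop
  | void : Collapsible ∅
  | expand (A : Set (Finset α)) (σ : Finset α) (a : α) (hA : Collapsible A) (ha : a ∉ σ)
      (hσ : σ ∉ A) (hsub : ∀ ρ, ρ ⊂ insert a σ → ρ ≠ σ → ρ ∈ A) :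
      Collapsible (A ∪ {σ, insert a σ})

theorem isLowerSet_union_pair {A : Set (Finset α)} (hA : IsLowerSet A) {σ : Finset α} {a : α}
    (hsub : ∀ ρ, ρ ⊂ insert a σ → ρ ≠ σ → ρ ∈ A) : IsLowerSet (A ∪ {σ, insert a σ}) := by
  intro ρ π hle hρ
  have key : π ⊆ insert a σ → π ∈ A ∪ {σ, insert a σ} := by
    intro h
    by_cases h1 : π = σ
    · simp [h1]
    by_cases h2 : π = insert a σ
    · simp [h2]
    exact Or.inl (hsub π (h.ssubset_of_ne h2) h1)
  rcases hρ with hρ | rfl | rfl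
  · exact Or.inl (hA hle hρ)
  · exact key (le_trans hle (subset_insert _ _))
  · exact key hle

theorem Collapsible.isLowerSet {A : Set (Finset α)} (hA : Collapsible A) : IsLowerSet A := by
  induction hA with
  | void => exact isLowerSet_empty
  | expand A σ a _ _ _ hsub ih => exact isLowerSet_union_pair ih hsub

/-- The cone with apex `a` over a finite complex is collapsible. -/
theorem collapsible_cone (a : α) (L : Finset (Finset α)) (hL : IsLowerSet (L : Set (Finset α)))
    (ha : ∀ σ ∈ L, a ∉ σ) : Collapsible {H | H.erase a ∈ L} := by
  induction hn : L.card generalizing L with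
  | zero =>
    rw [Finset.card_eq_zero] at hn
    subst hn
    simpa using Collapsible.void
  | succ n ih =>
    have hne : L.Nonempty := by rw [← Finset.card_pos]; omega
    obtain ⟨σ, hσ⟩ := L.exists_maximal hne
    have haσ := ha σ hσ.1
    have hlow : IsLowerSet ((L.erase σ : Finset (Finset α)) : Set (Finset α)) := by
      intro ρ π hle hρ
      have hρ' : ρ ≠ σ ∧ ρ ∈ L := mem_erase.1 hρ
      have hπ : π ∈ L := hL hle hρ'.2
      have : π ≠ σ := by
        rintro rfl
        exact hρ'.1 (le_antisymm (hσ.2 hρ'.2 hle) hle)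
      exact mem_erase.2 ⟨this, hπ⟩
    have h := (ih (L.erase σ) hlow (fun ρ hρ => ha ρ (mem_of_mem_erase hρ))
      (by rw [card_erase_of_mem hσ.1]; omega)).expand _ σ a haσ
      (by simp [erase_eq_of_notMem haσ]) (by
        intro ρ hρ hne
        have hsub : ρ.erase a ⊆ σ := by
          intro x hx
          have := hρ.1 (mem_of_mem_erase hx)
          have := ne_of_mem_erase hx
          simp_all
        refine mem_erase.2 ⟨?_, hL hsub hσ.1⟩
        intro he
        by_cases haρ : a ∈ ρ
        · exact hρ.ne (by rw [← he, insert_erase haρ])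
        · exact hne (by rw [← he, erase_eq_of_notMem haρ]))
    convert h using 1
    ext H
    simp only [Set.mem_ofPred_eq, Set.mem_union, Set.mem_insert_iff, Set.mem_singleton_iff,
      mem_erase]
    constructor
    · intro hH
      by_cases he : H.erase a = σ
      · right
        by_cases haH : a ∈ H
        · right; rw [← he, insert_erase haH]
        · left; rw [← he, erase_eq_of_notMem haH]
      · exact Or.inl ⟨he, hH⟩
    · rintro (h | rfl | rfl)
      · exact h.2
      · rw [erase_eq_of_notMem haσ]; exact hσ.1
      · rw [erase_insert haσ]; exact hσ.1

/-- Attaching the cone over a collapsible subcomplex to a collapsible complex gives a collapsible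
complex. -/
theorem Collapsible.union_cone {D L : Set (Finset α)} (hD : Collapsible D) (hL : Collapsible L)
    (hLD : L ⊆ D) {e : α} (he : ∀ σ ∈ D, e ∉ σ) :
    Collapsible (D ∪ insert e '' L) := by
  induction hL with
  | void => simpa using hD
  | expand A σ a hA ha hσ hsub ih =>
    have hτD : insert a σ ∈ D := hLD (by simp)
    have heτ := he _ hτD
    have hea : e ≠ a := fun h => heτ (by simp [h])
    have heσ : e ∉ σ := fun h => heτ (by simp [h])
    have heA : ∀ ρ ∈ A, e ∉ ρ := fun ρ hρ => he ρ (hLD (Or.inl hρ))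
    have h := (ih (fun x hx => hLD (Or.inl hx))).expand _ (insert e σ) a
      (by simp [ha, hea.symm]) (by
        rintro (h | ⟨ρ, hρ, h⟩)
        · exact he _ h (mem_insert_self _ _)
        · apply hσ
          have := congrArg (fun s => s.erase e) h
          simp only [erase_insert heσ, erase_insert (heA ρ hρ)] at this
          exact this ▸ hρ) (by
        intro ρ hρ hne
        by_cases heρ : e ∈ ρ
        · refine Or.inr ⟨ρ.erase e, ?_, insert_erase heρ⟩
          apply hsub
          · refine ssubset_of_subset_of_ne ?_ ?_
            · intro x hx
              have h1 := hρ.1 (mem_of_mem_erase hx)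
              have h2 := ne_of_mem_erase hx
              simp only [mem_insert] at h1 ⊢
              tauto
            · intro h
              apply hρ.ne
              rw [← insert_erase heρ, h, Finset.insert_comm]
          · intro h
            exact hne (by rw [← h, insert_erase heρ])
        · refine Or.inl (hD.isLowerSet ?_ hτD)
          intro x hx
          have h1 := hρ.1 hx
          have h2 : x ≠ e := fun h => heρ (h ▸ hx)
          simp only [mem_insert] at h1 ⊢
          tauto)
    convert h using 1
    rw [Set.image_union, Set.image_insert_eq, Set.image_singleton, Set.union_assoc,
      Finset.insert_comm a e]

/-- A complex is a *facet extension* of a collapsible complex avoiding `f` if removing some facets,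
none of which contains a vertex satisfying `f`, leaves a collapsible (or void) complex. -/
def FacetExtension (K : Set (Finset α)) (f : α → Prop) : Prop :=
  ∃ A ⊆ K, Collapsible A ∧ ∀ σ ∈ K, σ ∉ A → (∀ b, b ∉ σ → insert b σ ∉ K) ∧ ∀ b ∈ σ, ¬ f b

end Collapse

section Leafy

/-- A set of edges is leafy if it has no loops and each nonempty subset has a leaf. -/
def Leafy {V : Type*} (E : Finset (Sym2 V)) : Prop :=
  (∀ e ∈ E, ¬ e.IsDiag) ∧ ∀ E' ⊆ E, E'.Nonempty →
    ∃ v w, v ≠ w ∧ s(v, w) ∈ E' ∧ ∀ e ∈ E', w ∈ e → e = s(v, w)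

theorem Leafy.mono {V : Type*} {E E' : Finset (Sym2 V)} (h : Leafy E) (hE : E' ⊆ E) : Leafy E' :=
  ⟨fun e he => h.1 e (hE he), fun E'' h'' => h.2 E'' (h''.trans hE)⟩

theorem SimpleGraph.IsAcyclic.exists_leaf {V : Type*} [Finite V] {G : SimpleGraph V}
    (hG : G.IsAcyclic) {a b : V} (hab : G.Adj a b) : ∃ v w, G.Adj v w ∧ ∀ u, G.Adj w u → u = v := by
  classical
  have := Fintype.ofFinite V
  have hT := hG.isTree_connectedComponent (G.connectedComponentMk a)
  have hb : G.connectedComponentMk b = G.connectedComponentMk a :=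
    SimpleGraph.ConnectedComponent.sound hab.symm.reachable
  have : Nontrivial (G.connectedComponentMk a) :=
    ⟨⟨a, rfl⟩, ⟨b, hb⟩, fun h => hab.ne (congrArg Subtype.val h)⟩
  have := Fintype.ofFinite (G.connectedComponentMk a)
  obtain ⟨w, hw⟩ := hT.exists_vert_degree_one_of_nontrivial
  obtain ⟨v, hv, huniq⟩ := SimpleGraph.degree_eq_one_iff_existsUnique_adj.1 hw
  refine ⟨v, w, SimpleGraph.Adj.symm hv, fun u hu => ?_⟩
  have hu' : G.connectedComponentMk u = G.connectedComponentMk a :=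
    (SimpleGraph.ConnectedComponent.sound hu.symm.reachable).trans w.2
  exact congrArg Subtype.val (huniq ⟨u, hu'⟩ hu)

theorem leafy_edgeFinset {V : Type*} [Finite V] {G : SimpleGraph V} [Fintype G.edgeSet]
    (hG : G.IsAcyclic) : Leafy G.edgeFinset := by
  classical
  refine ⟨fun e he => G.not_isDiag_of_mem_edgeFinset he, fun E' hE' hne => ?_⟩
  have hle : SimpleGraph.fromEdgeSet (E' : Set (Sym2 V)) ≤ G := by
    intro x y hxy
    have := hE' (by simpa using ((SimpleGraph.fromEdgeSet_adj _).1 hxy).1)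
    simpa using this
  obtain ⟨e, he⟩ := hne
  induction e using Sym2.ind with
  | _ a b =>
  have hab : G.Adj a b := by simpa using hE' he
  obtain ⟨v, w, hvw, hl⟩ := (hG.anti hle).exists_leaf
    ((SimpleGraph.fromEdgeSet_adj _).2 ⟨by simpa using he, hab.ne⟩)
  have h := (SimpleGraph.fromEdgeSet_adj _).1 hvw
  refine ⟨v, w, h.2, by simpa using h.1, fun e' he' hw => ?_⟩
  obtain ⟨u, rfl⟩ := hw
  have hwu : G.Adj w u := by simpa using hE' he'
  rw [hl u ((SimpleGraph.fromEdgeSet_adj _).2 ⟨by simpa using he', hwu.ne⟩), Sym2.eq_swap]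

end Leafy

section BoundedDegree

variable {V : Type*} [DecidableEq V]

/-- The bounded degree complex of a finite set of edges. -/
def boundedDegree (E : Finset (Sym2 V)) (lam : V → ℕ) : Set (Finset (Sym2 V)) :=
  {H | H ⊆ E ∧ ∀ v, edgeDeg H v ≤ lam v}

theorem edgeDeg_mono {H H' : Finset (Sym2 V)} (h : H ⊆ H') (v : V) :
    edgeDeg H v ≤ edgeDeg H' v :=
  card_le_card (filter_subset_filter _ h)

theorem edgeDeg_insert {H : Finset (Sym2 V)} {e : Sym2 V} (he : e ∉ H) (v : V) :
    edgeDeg (insert e H) v = edgeDeg H v + if v ∈ e then 1 else 0 := by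
  unfold edgeDeg
  rw [filter_insert]
  split_ifs with h
  · rw [card_insert_of_notMem (by simp [he])]
  · simp

theorem isLowerSet_boundedDegree (E : Finset (Sym2 V)) (lam : V → ℕ) :
    IsLowerSet (boundedDegree E lam) :=
  fun _ _ hle h => ⟨hle.trans h.1, fun v => (edgeDeg_mono hle v).trans (h.2 v)⟩

theorem boundedDegree_erase_of_eq_zero {E : Finset (Sym2 V)} {lam : V → ℕ} {e : Sym2 V} {v : V}
    (hv : v ∈ e) (h0 : lam v = 0) : boundedDegree (E.erase e) lam = boundedDegree E lam := by
  ext H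
  refine and_congr_left fun h => ⟨fun h' => h'.trans (erase_subset _ _), fun h' x hx => ?_⟩
  refine mem_erase.2 ⟨?_, h' hx⟩
  rintro rfl
  have h1 := h v
  rw [h0, Nat.le_zero, edgeDeg, card_eq_zero] at h1
  exact Finset.notMem_empty x (h1 ▸ mem_filter.2 ⟨hx, hv⟩)

/-- The link of `e` in a bounded degree complex is again a bounded degree complex. -/
theorem insert_mem_boundedDegree_iff {E H : Finset (Sym2 V)} {lam : V → ℕ} {e : Sym2 V}
    (he : e ∈ E) (heH : e ∉ H) (hlam : ∀ x ∈ e, lam x ≠ 0) :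
    insert e H ∈ boundedDegree E lam ↔
      H ∈ boundedDegree (E.erase e) (fun x => lam x - if x ∈ e then 1 else 0) := by
  unfold boundedDegree
  simp only [Set.mem_ofPred_eq, insert_subset_iff, he, true_and, edgeDeg_insert heH,
    subset_erase, heH, not_false_eq_true, and_true]
  refine and_congr_right fun _ => forall_congr' fun x => ?_
  split_ifs with hx
  · have := hlam x hx
    omega
  · simp

/-- A leaf edge may replace any edge adjacent to it at its inner vertex. -/
theorem insert_leaf_mem_boundedDegree {E H : Finset (Sym2 V)} {lam : V → ℕ} {v w : V}
    {e : Sym2 V} (hf : s(v, w) ∈ E) (hleaf : ∀ e' ∈ E, w ∈ e' → e' = s(v, w))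
    (hw : lam w ≠ 0) (hve : v ∈ e) (hne : e ≠ s(v, w)) (heH : e ∉ H)
    (hH : insert e H ∈ boundedDegree E lam) :
    insert s(v, w) H ∈ boundedDegree (E.erase e) lam := by
  have hHE : H ⊆ E.erase e := fun x hx =>
    mem_erase.2 ⟨fun h => heH (h ▸ hx), hH.1 (mem_insert_of_mem hx)⟩
  refine ⟨insert_subset (mem_erase.2 ⟨hne.symm, hf⟩) hHE, fun x => ?_⟩
  have h1 := hH.2 x
  rw [edgeDeg_insert heH] at h1
  by_cases hfH : s(v, w) ∈ H
  · rw [insert_eq_of_mem hfH]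
    omega
  rw [edgeDeg_insert hfH]
  by_cases hxv : x = v
  · subst hxv
    simpa [hve] using h1
  by_cases hxw : x = w
  · subst hxw
    have h0 : edgeDeg H x = 0 := by
      rw [edgeDeg, card_eq_zero, filter_eq_empty_iff]
      intro e' he' hx
      exact hfH (hleaf e' (erase_subset _ _ (hHE he')) hx ▸ he')
    simp [h0]
    omega
  · have : x ∉ s(v, w) := by simp [hxv, hxw]
    simp only [this, if_false]
    omega

/-- Gluing step: a facet extension of the deletion of `e` and one of the link of `e` combine, if
inserting `f` turns every face of the link into a face of the deletion. -/
theorem facetExtension_of_link_of_deletion {α : Type*} [DecidableEq α] {K D L : Set (Finset α)}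
    {e f : α} (hef : e ≠ f)
    (hD : ∀ H, H ∈ D ↔ H ∈ K ∧ e ∉ H) (hL : ∀ H, H ∈ L ↔ insert e H ∈ K ∧ e ∉ H)
    (hK : IsLowerSet K) (hLD : ∀ H ∈ L, insert f H ∈ D)
    (hD' : FacetExtension D (· = f)) (hL' : FacetExtension L (· = f)) :
    FacetExtension K (· = f) := by
  obtain ⟨A, hAD, hA, hAc⟩ := hD'
  obtain ⟨B, hBL, hB, hBc⟩ := hL'
  have hBA : B ⊆ A := by
    intro σ hσ
    by_contra hσA
    have h1 := hLD σ (hBL hσ)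
    have h2 := hAc σ ((hD σ).2 ⟨hK (subset_insert _ _) ((hL σ).1 (hBL hσ)).1,
      ((hL σ).1 (hBL hσ)).2⟩) hσA
    exact h2.1 f (fun h => h2.2 f h rfl) h1
  refine ⟨A ∪ insert e '' B, ?_, hA.union_cone hB hBA fun σ hσ => ((hD σ).1 (hAD hσ)).2, ?_⟩
  · rintro _ (h | ⟨ρ, hρ, rfl⟩)
    · exact ((hD _).1 (hAD h)).1
    · exact ((hL _).1 (hBL hρ)).1
  intro σ hσ hσA
  by_cases he : e ∈ σ
  · have hσe : σ.erase e ∈ L := (hL _).2 ⟨by rwa [insert_erase he], notMem_erase _ _⟩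
    have h := hBc _ hσe fun h => hσA (Or.inr ⟨_, h, insert_erase he⟩)
    refine ⟨fun b hb hbK => ?_, fun b hb hbf => ?_⟩
    · have hbe : e ≠ b := fun h => hb (h ▸ he)
      refine h.1 b (fun h => hb (mem_of_mem_erase h)) ((hL _).2 ⟨?_, by simp [hbe]⟩)
      rwa [Finset.insert_comm, insert_erase he]
    · subst hbf
      exact h.2 b (mem_erase.2 ⟨hef.symm, hb⟩) rfl
  · have h := hAc σ ((hD σ).2 ⟨hσ, he⟩) fun h => hσA (Or.inl h)
    refine ⟨fun b hb hbK => ?_, h.2⟩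
    by_cases hbe : b = e
    · subst hbe
      exact h.1 f (fun h' => h.2 f h' rfl) (hLD σ ((hL σ).2 ⟨hbK, he⟩))
    · exact h.1 b hb ((hD _).2 ⟨hbK, by simp [he, Ne.symm hbe]⟩)

theorem FacetExtension.of_forall {α : Type*} [DecidableEq α] {K : Set (Finset α)}
    {p q : α → Prop} (h : FacetExtension K p) (hq : ∀ σ ∈ K, ∀ b ∈ σ, ¬ q b) :
    FacetExtension K q := by
  obtain ⟨A, hAK, hA, hc⟩ := h
  exact ⟨A, hAK, hA, fun σ hσ hσA => ⟨(hc σ hσ hσA).1, hq σ hσ⟩⟩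

theorem facetExtension_boundedDegree (n : ℕ) : ∀ (E : Finset (Sym2 V)) (lam : V → ℕ),
    E.card = n → Leafy E → FacetExtension (boundedDegree E lam) (fun _ => False) ∧
      ∀ v w, v ≠ w → s(v, w) ∈ E → (∀ e ∈ E, w ∈ e → e = s(v, w)) → lam v ≠ 0 → lam w ≠ 0 →
        FacetExtension (boundedDegree E lam) (· = s(v, w)) := by
  induction n using Nat.strong_induction_on with
  | _ n ih =>
  intro E lam hcard hE
  have ih' : ∀ e ∈ E, ∀ lam, _ := fun e he lam =>
    ih _ (by rw [← hcard]; exact card_erase_lt_of_mem he) (E.erase e) lam rfl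
      (hE.mono (erase_subset _ _))
  have hP : ∀ v w, v ≠ w → s(v, w) ∈ E → (∀ e ∈ E, w ∈ e → e = s(v, w)) → lam v ≠ 0 →
      lam w ≠ 0 → FacetExtension (boundedDegree E lam) (· = s(v, w)) := by
    intro v w hvw hf hleaf hv hw
    by_cases hex : ∃ e ∈ E, v ∈ e ∧ e ≠ s(v, w)
    · obtain ⟨e, he, hve, hne⟩ := hex
      have hleaf' : ∀ e' ∈ E.erase e, w ∈ e' → e' = s(v, w) :=
        fun e' he' => hleaf e' (mem_of_mem_erase he')
      have hf' : s(v, w) ∈ E.erase e := mem_erase.2 ⟨hne.symm, hf⟩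
      have hwe : w ∉ e := fun h => hne (hleaf e he h)
      have hdel := (ih' e he lam).2 v w hvw hf' hleaf' hv hw
      by_cases hz : ∃ u ∈ e, lam u = 0
      · obtain ⟨u, hu, hu0⟩ := hz
        rwa [boundedDegree_erase_of_eq_zero hu hu0] at hdel
      push Not at hz
      refine facetExtension_of_link_of_deletion hne (D := boundedDegree (E.erase e) lam)
        (L := boundedDegree (E.erase e) (fun x => lam x - if x ∈ e then 1 else 0)) ?_ ?_
        (isLowerSet_boundedDegree _ _) ?_ hdel ?_
      · intro H
        simp only [boundedDegree, Set.mem_ofPred_eq, subset_erase]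
        tauto
      · intro H
        constructor
        · intro h
          have heH : e ∉ H := (subset_erase.1 h.1).2
          exact ⟨(insert_mem_boundedDegree_iff he heH hz).2 h, heH⟩
        · rintro ⟨h, heH⟩
          exact (insert_mem_boundedDegree_iff he heH hz).1 h
      · intro H h
        have heH : e ∉ H := (subset_erase.1 h.1).2
        exact insert_leaf_mem_boundedDegree hf hleaf hw hve hne heH
          ((insert_mem_boundedDegree_iff he heH hz).2 h)
      · by_cases hv1 : lam v - 1 = 0
        · refine (ih' e he _).1.of_forall ?_
          rintro σ hσ b hb rfl
          have := hσ.2 v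
          simp only [hve, if_true, hv1, Nat.le_zero, edgeDeg, card_eq_zero] at this
          exact Finset.notMem_empty s(v, w) (this ▸ mem_filter.2 ⟨hb, by simp⟩)
        · exact (ih' e he _).2 v w hvw hf' hleaf' (by simpa [hve] using hv1)
            (by simpa [hwe] using hw)
    · push Not at hex
      have hcone : ∀ H, H ∈ boundedDegree E lam ↔
          H.erase s(v, w) ∈ boundedDegree (E.erase s(v, w)) lam := by
        intro H
        constructor
        · intro h
          exact ⟨erase_subset_erase _ h.1, fun x =>
            (edgeDeg_mono (erase_subset _ _) x).trans (h.2 x)⟩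
        · intro h
          refine isLowerSet_boundedDegree E lam (insert_erase_subset s(v, w) H) ?_
          refine ⟨insert_subset hf (h.1.trans (erase_subset _ _)), fun x => ?_⟩
          rw [edgeDeg_insert (notMem_erase _ _)]
          by_cases hx : x ∈ s(v, w)
          · have h0 : edgeDeg (H.erase s(v, w)) x = 0 := by
              rw [edgeDeg, card_eq_zero, filter_eq_empty_iff]
              intro e' he' hxe
              have h1 := mem_erase.1 (h.1 he')
              rcases Sym2.mem_iff.1 hx with rfl | rfl
              · exact h1.1 (hex e' h1.2 hxe)
              · exact h1.1 (hleaf e' h1.2 hxe)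
            rw [h0]
            rcases Sym2.mem_iff.1 hx with rfl | rfl <;> simp <;> omega
          · simpa [hx] using h.2 x
      refine ⟨_, subset_rfl, ?_, fun σ hσ h => absurd hσ h⟩
      classical
      have := collapsible_cone s(v, w)
        ((E.erase s(v, w)).powerset.filter (fun H => ∀ x, edgeDeg H x ≤ lam x)) (by
          intro ρ π hle hρ
          simp only [coe_filter, mem_powerset, Set.mem_ofPred_eq] at hρ ⊢
          exact isLowerSet_boundedDegree _ lam hle hρ) (by
          intro σ hσ h
          simp only [mem_filter, mem_powerset] at hσ
          exact notMem_erase _ _ (hσ.1 h))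
      convert this using 1
      ext H
      rw [hcone]
      simp [boundedDegree]
  refine ⟨?_, hP⟩
  rcases E.eq_empty_or_nonempty with rfl | hne
  · refine ⟨∅, Set.empty_subset _, .void, fun σ _ _ => ⟨fun b _ hb => ?_, fun _ _ h => h⟩⟩
    exact Finset.notMem_empty b (hb.1 (mem_insert_self _ _))
  obtain ⟨v, w, hvw, hf, hleaf⟩ := hE.2 E subset_rfl hne
  by_cases hv : lam v = 0
  · have := (ih' _ hf lam).1
    rwa [boundedDegree_erase_of_eq_zero (Sym2.mem_mk_left v w) hv] at this
  by_cases hw : lam w = 0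
  · have := (ih' _ hf lam).1
    rwa [boundedDegree_erase_of_eq_zero (Sym2.mem_mk_right v w) hw] at this
  obtain ⟨A, hAK, hA, hc⟩ := hP v w hvw hf hleaf hv hw
  exact ⟨A, hAK, hA, fun σ hσ hσA => ⟨(hc σ hσ hσA).1, fun _ _ h => h⟩⟩

theorem facetExtension_BD [Fintype V] {G : SimpleGraph V} (hG : G.IsAcyclic) (lam : V → ℕ) :
    FacetExtension (BD G lam) (fun _ => False) := by
  classical
  have h := ((facetExtension_boundedDegree _ G.edgeFinset lam rfl (leafy_edgeFinset hG)).1)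
  convert h using 1
  ext H
  simp [BD, boundedDegree, ← Finset.coe_subset]

end BoundedDegree

section Deformation

open ContinuousMap Topology

/-- The identity of `X` is homotopic, through maps preserving `S`, to a map sending `S` into `T`. -/
def DeformsInto {X : Type*} [TopologicalSpace X] (S T : Set X) : Prop :=
  ∃ (f : C(X, X)) (H : (ContinuousMap.id X).Homotopy f),
    (∀ t, ∀ x ∈ S, H (t, x) ∈ S) ∧ ∀ x ∈ S, f x ∈ T

theorem DeformsInto.trans {X : Type*} [TopologicalSpace X] {S T U : Set X}
    (h₁ : DeformsInto S T) (h₂ : DeformsInto T U) (hTS : T ⊆ S) : DeformsInto S U := by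
  obtain ⟨f, F, hF, hf⟩ := h₁
  obtain ⟨g, G, hG, hg⟩ := h₂
  refine ⟨g.comp f, F.trans ((G.compContinuousMap f).cast (ContinuousMap.id_comp f).symm rfl),
    fun t x hx => ?_, fun x hx => hg _ (hf x hx)⟩
  rw [Homotopy.trans_apply]
  split_ifs
  · exact hF _ x hx
  · exact hTS (hG _ _ (hf x hx))

/-- Collapsing a subset which deforms to a point is a homotopy equivalence. -/
theorem nonempty_homotopyEquiv_of_isQuotientMap {X W : Type*} [TopologicalSpace X]
    [TopologicalSpace W] (q : C(X, W)) (hq : IsQuotientMap q) {S : Set X} {p : X}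
    (hS : ∀ x ∈ S, ∀ y ∈ S, q x = q y) (hqS : ∀ x y, q x = q y → x = y ∨ (x ∈ S ∧ y ∈ S))
    (h : DeformsInto S {p}) : Nonempty (X ≃ₕ W) := by
  obtain ⟨f, H, hH, hf⟩ := h
  have hfac : Function.FactorsThrough f q := by
    intro x y hxy
    rcases hqS x y hxy with rfl | ⟨hx, hy⟩
    · rfl
    · rw [hf x hx, hf y hy]
  have hg : ∀ x, hq.lift f hfac (q x) = f x := fun x =>
    DFunLike.congr_fun (hq.lift_comp f hfac) x
  have hr := Function.rightInverse_surjInv hq.surjective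
  have hHq : ∀ t x, q (H (t, Function.surjInv hq.surjective (q x))) = q (H (t, x)) := by
    intro t x
    rcases hqS _ _ (hr (q x)) with h | ⟨h, h'⟩
    · rw [h]
    · exact hS _ (hH t _ h) _ (hH t _ h')
  refine ⟨⟨q, hq.lift f hfac, ⟨H.symm.cast ?_ rfl⟩, ⟨ContinuousMap.Homotopy.symm ?_⟩⟩⟩
  · ext x
    exact (hg x).symm
  · refine ⟨⟨fun z => q (H (z.1, Function.surjInv hq.surjective z.2)), ?_⟩, ?_, ?_⟩
    · refine hq.continuous_lift_prod_right ?_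
      simp only [hHq]
      exact q.continuous.comp H.continuous
    · intro w
      simp [hr w]
    · intro w
      obtain ⟨x, rfl⟩ := hq.surjective w
      change q (H (1, Function.surjInv hq.surjective (q x))) = q (hq.lift f hfac (q x))
      rw [hHq, hg, H.apply_one]

end Deformation

section Realization

variable {α : Type*} [Fintype α]

/-- The support of a function, as a finset. -/
noncomputable def vsupp (x : α → ℝ) : Finset α := by
  classical exact univ.filter (fun a => x a ≠ 0)

@[simp]
theorem mem_vsupp {x : α → ℝ} {a : α} : a ∈ vsupp x ↔ x a ≠ 0 := by
  simp [vsupp]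

theorem mem_realization_iff {K : Set (Finset α)} (hK : IsLowerSet K) {x : α → ℝ} :
    x ∈ realization K ↔ (∀ a, 0 ≤ x a) ∧ ∑ a, x a = 1 ∧ vsupp x ∈ K := by
  refine and_congr_right fun _ => and_congr_right fun _ => ⟨?_, fun h => ⟨_, h, by simp⟩⟩
  rintro ⟨σ, hσ, h⟩
  exact hK (fun a ha => h a (mem_vsupp.1 ha)) hσ

theorem vsupp_nonempty {x : α → ℝ} (hx : ∑ a, x a = 1) : (vsupp x).Nonempty := by
  by_contra h
  rw [not_nonempty_iff_eq_empty] at h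
  have h0 : ∀ a, x a = 0 := fun a => by
    by_contra ha
    exact Finset.notMem_empty a (h ▸ mem_vsupp.2 ha)
  simp [h0] at hx

theorem isClosed_realization (K : Set (Finset α)) : IsClosed (realization K) := by
  have h : realization K =
      stdSimplex ℝ α ∩ ⋃ σ ∈ K, ⋂ a ∈ {a | a ∉ σ}, {x : α → ℝ | x a = 0} := by
    ext x
    simp only [realization, stdSimplex, Set.mem_ofPred_eq, Set.mem_inter_iff, Set.mem_iUnion,
      Set.mem_iInter, exists_prop, and_assoc]
    refine and_congr_right fun _ => and_congr_right fun _ => exists_congr fun σ =>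
      and_congr_right fun _ => forall_congr' fun a => not_imp_comm
  rw [h]
  refine (isClosed_stdSimplex ℝ α).inter ((Set.toFinite K).isClosed_biUnion fun σ _ => ?_)
  exact isClosed_biInter fun a _ => isClosed_eq (continuous_apply a) continuous_const

instance (K : Set (Finset α)) : CompactSpace (realization K) :=
  isCompact_iff_compactSpace.1 <| (isCompact_stdSimplex ℝ α).of_isClosed_subset
    (isClosed_realization K) fun _ h => ⟨h.1, h.2.1⟩

/-- The part of the realization of `K` carried by the faces in `B`. -/
def carried (K B : Set (Finset α)) : Set (realization K) :=
  {x | vsupp x.1 ∈ B}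

theorem isClosed_carried (K : Set (Finset α)) {B : Set (Finset α)} (hB : IsLowerSet B) :
    IsClosed (carried K B) := by
  have : carried K B = Subtype.val ⁻¹' realization B := by
    ext x
    simp only [carried, Set.mem_ofPred_eq, Set.mem_preimage, mem_realization_iff hB, x.2.1,
      x.2.2.1, implies_true, true_and]
  rw [this]
  exact (isClosed_realization B).preimage continuous_subtype_val

/-- Contiguous maps are joined by the affine homotopy. -/
theorem exists_affine_homotopy {K : Set (Finset α)} (hK : IsLowerSet K)
    (f g : C(realization K, realization K))
    (h : ∀ x, ∃ ρ ∈ K, vsupp (f x).1 ⊆ ρ ∧ vsupp (g x).1 ⊆ ρ) :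
    ∃ H : f.Homotopy g, ∀ t x ρ, vsupp (f x).1 ⊆ ρ → vsupp (g x).1 ⊆ ρ →
      vsupp (H (t, x)).1 ⊆ ρ := by
  let H (z : unitInterval × realization K) : α → ℝ := fun a =>
    (1 - (z.1 : ℝ)) * (f z.2).1 a + z.1 * (g z.2).1 a
  have hsupp : ∀ z ρ, vsupp (f z.2).1 ⊆ ρ → vsupp (g z.2).1 ⊆ ρ → vsupp (H z) ⊆ ρ := by
    intro z ρ h1 h2 a ha
    by_contra haρ
    have hf : (f z.2).1 a = 0 := by
      by_contra h
      exact haρ (h1 (mem_vsupp.2 h))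
    have hg : (g z.2).1 a = 0 := by
      by_contra h
      exact haρ (h2 (mem_vsupp.2 h))
    exact mem_vsupp.1 ha (by simp [H, hf, hg])
  have hmem : ∀ z, H z ∈ realization K := by
    intro z
    rw [mem_realization_iff hK]
    refine ⟨fun a => ?_, ?_, ?_⟩
    · exact add_nonneg (mul_nonneg (sub_nonneg.2 z.1.2.2) ((f z.2).2.1 a))
        (mul_nonneg z.1.2.1 ((g z.2).2.1 a))
    · simp only [H, sum_add_distrib, ← mul_sum, (f z.2).2.2.1, (g z.2).2.2.1]
      ring
    · obtain ⟨ρ, hρ, h1, h2⟩ := h z.2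
      exact hK (hsupp z ρ h1 h2) hρ
  refine ⟨⟨⟨fun z => ⟨H z, hmem z⟩, ?_⟩, ?_, ?_⟩, fun t x => hsupp (t, x)⟩
  · refine Continuous.subtype_mk (continuous_pi fun a => ?_) _
    have h1 : Continuous fun z : unitInterval × realization K => (f z.2).1 a :=
      (continuous_apply a).comp (continuous_subtype_val.comp (f.continuous.comp continuous_snd))
    have h2 : Continuous fun z : unitInterval × realization K => (g z.2).1 a :=
      (continuous_apply a).comp (continuous_subtype_val.comp (g.continuous.comp continuous_snd))
    have h3 : Continuous fun z : unitInterval × realization K => (z.1 : ℝ) :=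
      continuous_subtype_val.comp continuous_fst
    exact ((continuous_const.sub h3).mul h1).add (h3.mul h2)
  · intro x
    ext a
    simp [H]
  · intro x
    ext a
    simp [H]

end Realization

section Push

variable {α : Type*} [Fintype α] [DecidableEq α]

/-- The smallest barycentric coordinate at a vertex of `σ`. -/
noncomputable def minCoord (σ : Finset α) (hσ : σ.Nonempty) (x : α → ℝ) : ℝ :=
  σ.inf' hσ x

/-- The amount by which the coordinates in `σ` are decreased by `push σ _ a 1`: the excess of the
smallest coordinate at `σ` over the total mass outside of `insert a σ`. -/
noncomputable def pushAmount (σ : Finset α) (hσ : σ.Nonempty) (a : α) (x : α → ℝ) : ℝ :=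
  max 0 (minCoord σ hσ x - ∑ b ∈ (insert a σ)ᶜ, x b)

/-- A neighbourhood of the simplex `insert a σ` in any complex is retracted to that simplex,
which is then pushed away from its face `σ` for `u = 1`. -/
noncomputable def push (σ : Finset α) (hσ : σ.Nonempty) (a : α) (u : ℝ) (x : α → ℝ) (b : α) : ℝ :=
  if b ∈ σ then
    x b + (∑ c ∈ (insert a σ)ᶜ, (x c - max 0 (x c - minCoord σ hσ x))) / σ.card
      - u * pushAmount σ hσ a x
  else if b = a then x b + u * (σ.card * pushAmount σ hσ a x)
  else max 0 (x b - minCoord σ hσ x)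

variable {σ : Finset α} (hσ : σ.Nonempty) {a : α}

omit [Fintype α] [DecidableEq α] in
theorem continuous_minCoord : Continuous (minCoord σ hσ) := by
  unfold minCoord
  exact Continuous.finset_inf'_apply hσ fun b _ => continuous_apply b

theorem continuous_push (u : ℝ) : Continuous (push σ hσ a u) := by
  have hm := continuous_minCoord hσ
  have hs : Continuous (pushAmount σ hσ a) := by
    unfold pushAmount
    fun_prop
  refine continuous_pi fun b => ?_
  unfold push
  split_ifs <;> fun_prop

theorem sum_push (ha : a ∉ σ) (u : ℝ) (x : α → ℝ) : ∑ b, push σ hσ a u x b = ∑ b, x b := by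
  have hc : (σ.card : ℝ) ≠ 0 := by simpa using hσ.ne_empty
  rw [← sum_add_sum_compl (insert a σ), ← sum_add_sum_compl (insert a σ) x,
    sum_insert ha, sum_insert ha]
  have h1 : ∑ b ∈ σ, push σ hσ a u x b = ∑ b ∈ σ, x b
      + (∑ c ∈ (insert a σ)ᶜ, (x c - max 0 (x c - minCoord σ hσ x)))
      - σ.card * (u * pushAmount σ hσ a x) := by
    rw [sum_congr rfl fun b hb => by rw [push, if_pos hb], sum_sub_distrib, sum_add_distrib]
    simp only [sum_const, nsmul_eq_mul]
    field_simp
  have h2 : ∑ b ∈ (insert a σ)ᶜ, push σ hσ a u x b =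
      ∑ c ∈ (insert a σ)ᶜ, max 0 (x c - minCoord σ hσ x) := by
    refine sum_congr rfl fun b hb => ?_
    simp only [mem_compl, mem_insert, not_or] at hb
    rw [push, if_neg hb.2, if_neg hb.1]
  rw [h1, h2, sum_sub_distrib, push, if_neg ha, if_pos rfl]
  ring

variable {x : α → ℝ} (hx : ∀ b, 0 ≤ x b)
include hx

omit [Fintype α] [DecidableEq α] in
theorem minCoord_nonneg : 0 ≤ minCoord σ hσ x :=
  le_inf' _ _ fun b _ => hx b

omit [DecidableEq α] hx [Fintype α] in
theorem minCoord_le {b : α} (hb : b ∈ σ) : minCoord σ hσ x ≤ x b :=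
  inf'_le _ hb

theorem pushAmount_le : pushAmount σ hσ a x ≤ minCoord σ hσ x :=
  max_le (minCoord_nonneg hσ hx) (sub_le_self _ (sum_nonneg fun b _ => hx b))

theorem push_nonneg {u : ℝ} (hu0 : 0 ≤ u) (hu1 : u ≤ 1) (b : α) : 0 ≤ push σ hσ a u x b := by
  have hs : 0 ≤ pushAmount σ hσ a x := le_max_left _ _
  have hm := minCoord_nonneg hσ hx
  unfold push
  split_ifs with h1 h2
  · have h3 : 0 ≤ (∑ c ∈ (insert a σ)ᶜ, (x c - max 0 (x c - minCoord σ hσ x))) / σ.card :=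
      div_nonneg (sum_nonneg fun c _ => sub_nonneg.2 (max_le (hx c) (by linarith))) (by simp)
    have h4 := (pushAmount_le (a := a) hσ hx).trans (minCoord_le hσ h1)
    nlinarith
  · have := hx b
    positivity
  · exact le_max_left _ _

theorem push_eq_self (hm : minCoord σ hσ x = 0) (u : ℝ) : push σ hσ a u x = x := by
  have hs : pushAmount σ hσ a x = 0 :=
    le_antisymm (hm ▸ pushAmount_le hσ hx) (le_max_left _ _)
  funext b
  unfold push
  rw [hs, hm]
  split_ifs <;> simp [hx]

omit [DecidableEq α] in
theorem subset_vsupp_of_minCoord_ne_zero (hm : minCoord σ hσ x ≠ 0) : σ ⊆ vsupp x := by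
  intro b hb
  have h1 := (minCoord_nonneg hσ hx).lt_of_ne' hm
  have h2 := minCoord_le (x := x) hσ hb
  exact mem_vsupp.2 (by linarith)

theorem vsupp_push_subset {u : ℝ} (hu : u * pushAmount σ hσ a x = 0) :
    vsupp (push σ hσ a u x) ⊆ vsupp x := by
  by_cases hm : minCoord σ hσ x = 0
  · rw [push_eq_self hσ hx hm]
  intro b hb
  by_cases hbσ : b ∈ σ
  · exact subset_vsupp_of_minCoord_ne_zero hσ hx hm hbσ
  have hu' : u * (σ.card * pushAmount σ hσ a x) = 0 := by linear_combination σ.card * hu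
  rw [mem_vsupp, push, if_neg hbσ, hu'] at hb
  rw [mem_vsupp]
  intro h0
  apply hb
  have := minCoord_nonneg hσ hx
  split_ifs <;> simp [h0, this]

theorem vsupp_push_subset_insert (hs : pushAmount σ hσ a x ≠ 0) (u : ℝ) :
    vsupp (push σ hσ a u x) ⊆ insert a σ := by
  intro b hb
  by_contra hbτ
  have h1 : ∑ b ∈ (insert a σ)ᶜ, x b < minCoord σ hσ x := by
    by_contra! h
    exact hs (max_eq_left (sub_nonpos.2 h))
  have h2 : x b ≤ ∑ b ∈ (insert a σ)ᶜ, x b :=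
    single_le_sum (fun c _ => hx c) (mem_compl.2 hbτ)
  simp only [mem_insert, not_or] at hbτ
  rw [mem_vsupp, push, if_neg hbτ.2, if_neg hbτ.1] at hb
  exact hb (max_eq_left (by linarith))

theorem exists_vsupp_push_subset_erase (h : vsupp x ⊆ insert a σ) :
    ∃ b ∈ σ, vsupp (push σ hσ a 1 x) ⊆ (insert a σ).erase b := by
  have h0 : ∀ c ∉ insert a σ, x c = 0 := fun c hc => by
    by_contra hc0
    exact hc (h (mem_vsupp.2 hc0))
  have hm := minCoord_nonneg hσ hx
  have hs : pushAmount σ hσ a x = minCoord σ hσ x := by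
    rw [pushAmount, sum_eq_zero fun c hc => h0 c (mem_compl.1 hc), sub_zero, max_eq_right hm]
  obtain ⟨b, hb, hbm⟩ := exists_mem_eq_inf' hσ x
  refine ⟨b, hb, fun c hc => mem_erase.2 ⟨?_, ?_⟩⟩
  · rintro rfl
    rw [mem_vsupp, push, if_pos hb, hs] at hc
    apply hc
    rw [sum_eq_zero fun d hd => ?_]
    · rw [minCoord, ← hbm]
      ring
    · rw [h0 d (mem_compl.1 hd), max_eq_left (by linarith), sub_zero]
  · by_contra hcτ
    have hx0 := h0 c hcτ
    simp only [mem_insert, not_or] at hcτ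
    rw [mem_vsupp, push, if_neg hcτ.2, if_neg hcτ.1, hx0] at hc
    exact hc (max_eq_left (by linarith))

end Push

section CollapseDeformation

variable {α : Type*} [Fintype α] [DecidableEq α]

/-- An elementary collapse between subcomplexes of `K` is realized by a deformation of `K`. -/
theorem deformsInto_of_elementary_collapse {K A : Set (Finset α)} (hK : IsLowerSet K)
    (hA : IsLowerSet A) {σ : Finset α} {a : α} (hσ : σ.Nonempty) (ha : a ∉ σ) (hσA : σ ∉ A)
    (hτK : insert a σ ∈ K) (hsub : ∀ ρ, ρ ⊂ insert a σ → ρ ≠ σ → ρ ∈ A) :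
    DeformsInto (carried K (A ∪ {σ, insert a σ})) (carried K A) := by
  have hmem : ∀ u : ℝ, 0 ≤ u → u ≤ 1 → ∀ x : realization K,
      push σ hσ a u x.1 ∈ realization K := by
    intro u hu0 hu1 x
    refine (mem_realization_iff hK).2 ⟨push_nonneg hσ x.2.1 hu0 hu1,
      (sum_push hσ ha u x.1).trans x.2.2.1, ?_⟩
    by_cases hs : pushAmount σ hσ a x.1 = 0
    · exact hK (vsupp_push_subset hσ x.2.1 (by simp [hs])) ((mem_realization_iff hK).1 x.2).2.2
    · exact hK (vsupp_push_subset_insert hσ x.2.1 hs u) hτK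
  let P (u : ℝ) (hu0 : 0 ≤ u) (hu1 : u ≤ 1) : C(realization K, realization K) :=
    ⟨fun x => ⟨push σ hσ a u x.1, hmem u hu0 hu1 x⟩,
      ((continuous_push hσ u).comp continuous_subtype_val).subtype_mk _⟩
  have hP0 : ∀ x, vsupp (P 0 le_rfl zero_le_one x).1 ⊆ vsupp x.1 := fun x =>
    vsupp_push_subset hσ x.2.1 (by simp)
  have hPs : ∀ x : realization K, pushAmount σ hσ a x.1 = 0 →
      vsupp (P 1 zero_le_one le_rfl x).1 ⊆ vsupp x.1 := fun x hs =>
    vsupp_push_subset hσ x.2.1 (by simp [hs])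
  have hPτ : ∀ x : realization K, pushAmount σ hσ a x.1 ≠ 0 → ∀ u hu0 hu1,
      vsupp (P u hu0 hu1 x).1 ⊆ insert a σ := fun x hs u _ _ =>
    vsupp_push_subset_insert hσ x.2.1 hs u
  have hxK : ∀ x : realization K, vsupp x.1 ∈ K := fun x => ((mem_realization_iff hK).1 x.2).2.2
  obtain ⟨F, hF⟩ := exists_affine_homotopy hK (ContinuousMap.id _) (P 0 le_rfl zero_le_one)
    fun x => ⟨vsupp x.1, hxK x, subset_rfl, hP0 x⟩
  obtain ⟨G, hG⟩ := exists_affine_homotopy hK (P 0 le_rfl zero_le_one) (P 1 zero_le_one le_rfl)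
    fun x => by
      by_cases hs : pushAmount σ hσ a x.1 = 0
      · exact ⟨vsupp x.1, hxK x, hP0 x, hPs x hs⟩
      · exact ⟨insert a σ, hτK, hPτ x hs 0 le_rfl zero_le_one, hPτ x hs 1 zero_le_one le_rfl⟩
  have hlow : ∀ ρ π, ρ ∈ A ∪ {σ, insert a σ} → π ⊆ ρ → π ∈ A ∪ {σ, insert a σ} :=
    fun _ _ hρ hle => isLowerSet_union_pair hA hsub hle hρ
  refine ⟨_, F.trans G, fun t x hx => ?_, fun x hx => ?_⟩
  · rw [ContinuousMap.Homotopy.trans_apply]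
    split_ifs
    · exact hlow _ _ hx (hF _ x _ subset_rfl (hP0 x))
    · by_cases hs : pushAmount σ hσ a x.1 = 0
      · exact hlow _ _ hx (hG _ x _ (hP0 x) (hPs x hs))
      · exact hlow (insert a σ) _ (by simp) (hG _ x _ (hPτ x hs 0 le_rfl zero_le_one)
          (hPτ x hs 1 zero_le_one le_rfl))
  · have hτ : vsupp x.1 ⊆ insert a σ → vsupp (P 1 zero_le_one le_rfl x).1 ∈ A := by
      intro h
      obtain ⟨b, hb, hsupp⟩ := exists_vsupp_push_subset_erase hσ x.2.1 h
      refine hA hsupp (hsub _ (erase_ssubset (mem_insert_of_mem hb)) fun h => ?_)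
      exact notMem_erase b (insert a σ) (h.symm ▸ hb)
    rcases hx with hx | hx | hx
    · have hm : minCoord σ hσ x.1 = 0 := by
        by_contra hm
        exact hσA (hA (subset_vsupp_of_minCoord_ne_zero hσ x.2.1 hm) hx)
      change vsupp (push σ hσ a 1 x.1) ∈ A
      rwa [push_eq_self hσ x.2.1 hm]
    · exact hτ (hx.trans_subset (subset_insert _ _))
    · exact hτ (hx : vsupp x.1 = insert a σ).subset

theorem Collapsible.exists_deformsInto {K A : Set (Finset α)} (hK : IsLowerSet K)
    (hA : Collapsible A) (hAK : A ⊆ K) (hne : ∅ ∈ A) :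
    ∃ p ∈ carried K A, DeformsInto (carried K A) {p} := by
  induction hA with
  | void => exact absurd hne (Set.notMem_empty _)
  | expand A σ a hA ha hσA hsub ih =>
    rcases σ.eq_empty_or_nonempty with rfl | hσ
    · have hA0 : ∀ ρ, ρ ∉ A := fun ρ hρ => hσA (hA.isLowerSet (empty_subset ρ) hρ)
      have hp : Pi.single a 1 ∈ realization K := by
        refine ⟨fun b => ?_, by simp, {a}, hAK (by simp), fun b => ?_⟩
        · by_cases h : b = a
          · subst h; simp
          · simp [h]
        · by_cases h : b = a <;> simp [h]
      refine ⟨⟨Pi.single a 1, hp⟩, ?_, .id _, .refl _, fun t x hx => hx, fun x hx => ?_⟩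
      · right; right
        change vsupp _ = insert a ∅
        ext b
        by_cases h : b = a <;> simp [h]
      · have hx' : vsupp x.1 = {a} := by
          rcases hx with h | h | h
          · exact absurd h (hA0 _)
          · exact absurd h (vsupp_nonempty x.2.2.1).ne_empty
          · exact h
        have h0 : ∀ b, b ≠ a → x.1 b = 0 := fun b hb => by
          by_contra h
          exact hb (mem_singleton.1 (hx'.subset (mem_vsupp.2 h)))
        have h1 : x.1 a = 1 := by
          rw [← x.2.2.1]
          exact (sum_eq_single a (fun b _ hb => h0 b hb) (by simp)).symm
        apply Subtype.ext
        funext b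
        by_cases h : b = a
        · subst h; simpa using h1
        · simpa [h] using h0 b h
    · have h0 : ∅ ∈ A := hsub ∅ ((empty_ssubset).2 (insert_nonempty _ _)) hσ.ne_empty.symm
      obtain ⟨p, hpA, hp⟩ := ih (fun x hx => hAK (Or.inl hx)) h0
      have hle : carried K A ⊆ carried K (A ∪ {σ, insert a σ}) := fun x hx => Or.inl hx
      exact ⟨p, hle hpA, (deformsInto_of_elementary_collapse hK hA.isLowerSet hσ ha hσA
        (hAK (by simp)) hsub).trans hp hle⟩

end CollapseDeformation

section Cells

open Topology OnePoint

/-- Collapsing the complement of an open subspace maps onto its one-point compactification. -/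
theorem exists_continuousMap_onePoint {X Y : Type*} [TopologicalSpace X] [TopologicalSpace Y]
    [T2Space X] {j : Y → X} (hj : IsOpenEmbedding j) :
    ∃ p : C(X, OnePoint Y), (∀ y, p (j y) = y) ∧ ∀ x ∉ Set.range j, p x = ∞ := by
  classical
  let p (x : X) : OnePoint Y := if h : x ∈ Set.range j then ((h.choose : Y) : OnePoint Y) else ∞
  have hp : ∀ y, p (j y) = y := fun y => by
    have h : j y ∈ Set.range j := ⟨y, rfl⟩
    simp only [p, dif_pos h]
    rw [hj.injective h.choose_spec]
  have hp' : ∀ x ∉ Set.range j, p x = ∞ := fun x hx => dif_neg hx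
  refine ⟨⟨p, continuous_def.2 fun U hU => ?_⟩, hp, hp'⟩
  by_cases hU' : ∞ ∈ U
  · have h : p ⁻¹' U = (j '' ((↑) ⁻¹' U : Set Y)ᶜ)ᶜ := by
      ext x
      by_cases hx : x ∈ Set.range j
      · obtain ⟨y, rfl⟩ := hx
        simp [hp, hj.injective.mem_set_image]
      · have : x ∉ j '' ((↑) ⁻¹' U : Set Y)ᶜ := fun h => hx (Set.image_subset_range _ _ h)
        simp [hp' x hx, hU', this]
    rw [h, isOpen_compl_iff]
    exact (((isOpen_iff_of_mem' hU').1 hU).1.image hj.continuous).isClosed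
  · have h : p ⁻¹' U = j '' ((↑) ⁻¹' U : Set Y) := by
      ext x
      by_cases hx : x ∈ Set.range j
      · obtain ⟨y, rfl⟩ := hx
        simp [hp, hj.injective.mem_set_image]
      · have : x ∉ j '' ((↑) ⁻¹' U : Set Y) := fun h => hx (Set.image_subset_range _ _ h)
        simp [hp' x hx, hU', this]
    rw [h]
    exact hj.isOpenMap _ ((isOpen_iff_of_notMem hU').1 hU)

theorem exists_onePoint_homeomorph_sphere {E : Type*} [AddCommGroup E] [Module ℝ E]
    [FiniteDimensional ℝ E] [TopologicalSpace E] [IsTopologicalAddGroup E]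
    [ContinuousSMul ℝ E] [T2Space E] {d : ℕ} (h : Module.finrank ℝ E = d) :
    ∃ e : OnePoint E ≃ₜ Metric.sphere (0 : EuclideanSpace ℝ (Fin (d + 1))) 1,
      e ∞ = spherePt d := by
  let v : EuclideanSpace ℝ (Fin (d + 1)) := EuclideanSpace.single 0 1
  have hv : ‖v‖ = 1 := by simp [v]
  have hv₀ : v ≠ 0 := norm_ne_zero_iff.1 (by simp [hv])
  have : Fact (Module.finrank ℝ (EuclideanSpace ℝ (Fin (d + 1))) = d + 1) := ⟨by simp⟩
  have hE : Module.finrank ℝ E = Module.finrank ℝ (Submodule.span ℝ {v})ᗮ := by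
    rw [h, Submodule.finrank_orthogonal_span_singleton (n := d) hv₀]
  obtain ⟨e⟩ := FiniteDimensional.nonempty_continuousLinearEquiv_of_finrank_eq hE
  exact ⟨e.toHomeomorph.onePointCongr.trans (onePointHyperplaneHomeoUnitSphere hv), rfl⟩

variable {α : Type*} [Fintype α] [DecidableEq α]

/-- The point of the open simplex `σ` whose coordinates are proportional to `exp (y b)` and, at the
vertex `b₀`, to `1`. -/
noncomputable def softmaxWeight (σ : Finset α) (b₀ : α) (y : {b // b ∈ σ.erase b₀} → ℝ) (b : α) :
    ℝ :=
  if h : b ∈ σ.erase b₀ then Real.exp (y ⟨b, h⟩) else if b = b₀ then 1 else 0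

omit [Fintype α] in
theorem softmaxWeight_nonneg (σ : Finset α) (b₀ : α) (y : {b // b ∈ σ.erase b₀} → ℝ) (b : α) :
    0 ≤ softmaxWeight σ b₀ y b := by
  unfold softmaxWeight
  split_ifs <;> positivity

omit [Fintype α] in
theorem softmaxWeight_ne_zero_iff {σ : Finset α} {b₀ : α} (hb₀ : b₀ ∈ σ)
    (y : {b // b ∈ σ.erase b₀} → ℝ) (b : α) : softmaxWeight σ b₀ y b ≠ 0 ↔ b ∈ σ := by
  unfold softmaxWeight
  split_ifs with h1 h2
  · simp [(mem_erase.1 h1).2]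
  · simp [h2, hb₀]
  · simpa [h2] using h1

omit [Fintype α] in
theorem softmaxWeight_self (σ : Finset α) (b₀ : α) (y : {b // b ∈ σ.erase b₀} → ℝ) :
    softmaxWeight σ b₀ y b₀ = 1 := by
  simp [softmaxWeight]

theorem sum_softmaxWeight_pos (σ : Finset α) (b₀ : α) (y : {b // b ∈ σ.erase b₀} → ℝ) :
    0 < ∑ b, softmaxWeight σ b₀ y b :=
  sum_pos' (fun b _ => softmaxWeight_nonneg σ b₀ y b)
    ⟨b₀, mem_univ _, by rw [softmaxWeight_self]; exact one_pos⟩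

omit [Fintype α] in
theorem continuous_softmaxWeight (σ : Finset α) (b₀ : α) : Continuous (softmaxWeight σ b₀) := by
  refine continuous_pi fun b => ?_
  unfold softmaxWeight
  split_ifs <;> fun_prop

/-- The open cell of a facet is an open subspace homeomorphic to a Euclidean space. -/
theorem exists_isOpenEmbedding_range_eq {K : Set (Finset α)} (hK : IsLowerSet K) {σ : Finset α}
    (hσ : σ ∈ K) (hmax : ∀ b ∉ σ, insert b σ ∉ K) {b₀ : α} (hb₀ : b₀ ∈ σ) :
    ∃ j : ({b // b ∈ σ.erase b₀} → ℝ) → realization K,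
      IsOpenEmbedding j ∧ Set.range j = {x | vsupp x.1 = σ} := by
  let w := softmaxWeight σ b₀
  have hpos := sum_softmaxWeight_pos σ b₀
  have hsupp : ∀ y, vsupp (fun b => w y b / ∑ c, w y c) = σ := fun y => by
    ext b
    simp [w, (hpos y).ne', softmaxWeight_ne_zero_iff hb₀]
  have hmem : ∀ y, (fun b => w y b / ∑ c, w y c) ∈ realization K := fun y =>
    (mem_realization_iff hK).2 ⟨fun b => div_nonneg (softmaxWeight_nonneg σ b₀ y b) (hpos y).le,
      by rw [← sum_div, div_self (hpos y).ne'], (hsupp y).symm ▸ hσ⟩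
  have hx0 : ∀ x : realization K, vsupp x.1 = σ → ∀ b ∈ σ, 0 < x.1 b := fun x hx b hb =>
    (x.2.1 b).lt_of_ne' (mem_vsupp.1 (hx.symm ▸ hb))
  have hw : ∀ x : realization K, vsupp x.1 = σ → ∀ b,
      w (fun b => Real.log (x.1 b / x.1 b₀)) b = x.1 b / x.1 b₀ := fun x hx b => by
    have h0 := hx0 x hx b₀ hb₀
    by_cases h1 : b ∈ σ.erase b₀
    · simp only [w, softmaxWeight, dif_pos h1]
      exact Real.exp_log (div_pos (hx0 x hx b (mem_erase.1 h1).2) h0)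
    · by_cases h2 : b = b₀
      · subst h2
        rw [div_self h0.ne']
        exact softmaxWeight_self _ _ _
      · have h3 : x.1 b = 0 := by
          by_contra h
          exact h1 (mem_erase.2 ⟨h2, hx ▸ mem_vsupp.2 h⟩)
        simp only [w, softmaxWeight, dif_neg h1, if_neg h2, h3, zero_div]
  let j (y : {b // b ∈ σ.erase b₀} → ℝ) : realization K := ⟨_, hmem y⟩
  have hj : Continuous j := by
    refine Continuous.subtype_mk (continuous_pi fun b => ?_) _
    have hc : ∀ b, Continuous fun y => w y b := fun b =>
      (continuous_apply b).comp (continuous_softmaxWeight σ b₀)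
    exact (hc b).div (continuous_finsetSum _ fun c _ => hc c) fun y => (hpos y).ne'
  let e : ({b // b ∈ σ.erase b₀} → ℝ) ≃ₜ {x : realization K // vsupp x.1 = σ} :=
    { toFun := fun y => ⟨j y, hsupp y⟩
      invFun := fun x b => Real.log (x.1.1 b / x.1.1 b₀)
      left_inv := fun y => by
        funext b
        have h : w y b / (∑ c, w y c) / (w y b₀ / ∑ c, w y c) = Real.exp (y b) := by
          rw [div_div_div_cancel_right₀ (hpos y).ne']
          simp only [w, softmaxWeight_self, div_one, softmaxWeight, dif_pos b.2]
        exact (congrArg Real.log h).trans (Real.log_exp _)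
      right_inv := fun x => by
        refine Subtype.ext (Subtype.ext (funext fun b => ?_))
        change w _ b / ∑ c, w _ c = _
        simp only [hw x.1 x.2]
        rw [← sum_div, x.1.2.2.1, div_div_div_cancel_right₀ (hx0 x.1 x.2 b₀ hb₀).ne', div_one]
      continuous_toFun := hj.subtype_mk _
      continuous_invFun := by
        refine continuous_pi fun b => ?_
        have hc : ∀ b, Continuous fun x : {x : realization K // vsupp x.1 = σ} => x.1.1 b :=
          fun b => (continuous_apply b).comp (continuous_subtype_val.comp continuous_subtype_val)
        refine ((hc b).div (hc b₀) fun x => (hx0 x.1 x.2 b₀ hb₀).ne').log fun x => ?_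
        exact (div_pos (hx0 x.1 x.2 b (mem_erase.1 b.2).2) (hx0 x.1 x.2 b₀ hb₀)).ne' }
  have hopen : IsOpen {x : realization K | vsupp x.1 = σ} := by
    have h : {x : realization K | vsupp x.1 = σ} = ⋂ b ∈ σ, {x : realization K | x.1 b ≠ 0} := by
      ext x
      simp only [Set.mem_ofPred_eq, Set.mem_iInter]
      refine ⟨fun h b hb => mem_vsupp.1 (h.symm ▸ hb), fun h => ?_⟩
      refine subset_antisymm (fun b hb => ?_) fun b hb => mem_vsupp.2 (h b hb)
      by_contra hbσ
      refine hmax b hbσ (hK (insert_subset hb fun c hc => mem_vsupp.2 (h c hc)) ?_)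
      exact ((mem_realization_iff hK).1 x.2).2.2
    rw [h]
    exact isOpen_biInter_finset fun b _ =>
      isOpen_ne_fun ((continuous_apply b).comp continuous_subtype_val) continuous_const
  have hje : j = Subtype.val ∘ e := rfl
  refine ⟨j, ?_, ?_⟩
  · rw [hje]
    exact (hopen.isOpenEmbedding_subtypeVal).comp e.isOpenEmbedding
  · rw [hje, Set.range_comp, e.surjective.range_eq, Set.image_univ]
    exact Subtype.range_coe

/-- Collapsing the complement of the open cell of a facet gives a sphere. -/
theorem exists_continuousMap_sphere {K : Set (Finset α)} (hK : IsLowerSet K) {σ : Finset α}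
    (hσ : σ ∈ K) (hmax : ∀ b ∉ σ, insert b σ ∉ K) {d : ℕ} (hd : σ.card = d + 1) :
    ∃ p : C(realization K, Metric.sphere (0 : EuclideanSpace ℝ (Fin (d + 1))) 1),
      (∀ x y, vsupp x.1 = σ → vsupp y.1 = σ → p x = p y → x = y) ∧
      (∀ x, p x = spherePt d ↔ vsupp x.1 ≠ σ) ∧
      ∀ z, z ≠ spherePt d → ∃ x, vsupp x.1 = σ ∧ p x = z := by
  obtain ⟨b₀, hb₀⟩ : σ.Nonempty := card_pos.1 (by omega)
  obtain ⟨j, hj, hrange⟩ := exists_isOpenEmbedding_range_eq hK hσ hmax hb₀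
  obtain ⟨p, hp, hp'⟩ := exists_continuousMap_onePoint hj
  obtain ⟨e, he⟩ := exists_onePoint_homeomorph_sphere
    (E := {b // b ∈ σ.erase b₀} → ℝ) (d := d)
    (by rw [Module.finrank_pi, Fintype.card_coe, card_erase_of_mem hb₀, hd, Nat.add_sub_cancel])
  have hr : ∀ x : realization K, vsupp x.1 = σ ↔ x ∈ Set.range j := fun x => by
    rw [hrange]; rfl
  refine ⟨(e : C(_, _)).comp p, fun x y hx hy hxy => ?_, fun x => ?_, fun z hz => ?_⟩
  · obtain ⟨x, rfl⟩ := (hr x).1 hx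
    obtain ⟨y, rfl⟩ := (hr y).1 hy
    have h : p (j x) = p (j y) := e.injective hxy
    rw [hp, hp] at h
    rw [OnePoint.coe_injective h]
  · rw [← he]
    refine e.injective.eq_iff.trans ?_
    rw [Ne, hr]
    refine ⟨?_, hp' x⟩
    rintro h ⟨y, rfl⟩
    exact OnePoint.coe_ne_infty y ((hp y).symm.trans h)
  · have h : e.symm z ≠ ∞ := fun h => hz (by rw [← he, ← h, e.apply_symm_apply])
    obtain ⟨y, hy⟩ := OnePoint.ne_infty_iff_exists.1 h
    refine ⟨j y, (hr _).2 ⟨y, rfl⟩, ?_⟩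
    change e (p (j y)) = z
    rw [hp, hy, e.apply_symm_apply]

end Cells
section Wedge

open Topology

namespace WedgeOfSpheres

variable {ι : Type*} {d : ι → ℕ}

/-- The quotient map onto a wedge of spheres. -/
def mk (z : Unit ⊕ (Σ i : ι, Metric.sphere (0 : EuclideanSpace ℝ (Fin (d i + 1))) 1)) :
    WedgeOfSpheres ι d :=
  Quot.mk _ z

variable (ι d) in
/-- The base point of a wedge of spheres. -/
def base : WedgeOfSpheres ι d :=
  mk (Sum.inl ())

/-- The inclusion of a sphere into a wedge of spheres. -/
def incl (i : ι) (z : Metric.sphere (0 : EuclideanSpace ℝ (Fin (d i + 1))) 1) :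
    WedgeOfSpheres ι d :=
  mk (Sum.inr ⟨i, z⟩)

theorem incl_spherePt (i : ι) : incl i (spherePt (d i)) = base ι d :=
  Quot.sound ⟨Or.inr ⟨i, rfl⟩, Or.inl rfl⟩

theorem isQuotientMap_mk : IsQuotientMap (mk : _ → WedgeOfSpheres ι d) :=
  isQuotientMap_quot_mk

theorem continuous_incl (i : ι) : Continuous (incl (d := d) i) :=
  isQuotientMap_mk.continuous.comp (continuous_inr.comp continuous_sigmaMk)

theorem isOpen_iff {U : Set (WedgeOfSpheres ι d)} : IsOpen U ↔ ∀ i, IsOpen (incl i ⁻¹' U) := by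
  refine ⟨fun h i => h.preimage (continuous_incl i), fun h => ?_⟩
  rw [← isQuotientMap_mk.isOpen_preimage, isOpen_sum_iff]
  exact ⟨isOpen_discrete _, isOpen_sigma_iff.2 h⟩

theorem eq_base_or_exists_eq_incl (w : WedgeOfSpheres ι d) :
    w = base ι d ∨ ∃ i z, z ≠ spherePt (d i) ∧ w = incl i z := by
  obtain ⟨⟨⟩ | ⟨i, z⟩, rfl⟩ := Quot.exists_rep w
  · exact Or.inl rfl
  · by_cases hz : z = spherePt (d i)
    · subst hz
      exact Or.inl (incl_spherePt i)
    · exact Or.inr ⟨i, z, hz, rfl⟩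

open Classical in
/-- The sphere containing a point other than the base point, and the point. -/
noncomputable def toOption (w : WedgeOfSpheres ι d) :
    Option (Σ i : ι, Metric.sphere (0 : EuclideanSpace ℝ (Fin (d i + 1))) 1) :=
  Quot.lift (Sum.elim (fun _ => none) fun z => if z.2 = spherePt (d z.1) then none else some z)
    (by rintro _ _ ⟨rfl | ⟨i, rfl⟩, rfl | ⟨j, rfl⟩⟩ <;> simp) w

theorem toOption_base : toOption (base ι d) = none :=
  rfl

theorem toOption_incl {i : ι} {z : Metric.sphere (0 : EuclideanSpace ℝ (Fin (d i + 1))) 1}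
    (hz : z ≠ spherePt (d i)) : toOption (incl i z) = some ⟨i, z⟩ :=
  if_neg hz

end WedgeOfSpheres

open WedgeOfSpheres

/-- If `K` is obtained from a subcomplex `A` by adding facets, then collapsing `A` gives a wedge of
spheres, one for each facet. -/
theorem exists_isQuotientMap_wedgeOfSpheres {α : Type*} [Fintype α] [DecidableEq α]
    {K A : Set (Finset α)} (hK : IsLowerSet K) (hA : IsLowerSet A) (hne : (carried K A).Nonempty)
    {n : ℕ} {σ : Fin n → Finset α} (hinj : Function.Injective σ) {d : Fin n → ℕ}
    (hσ : ∀ ρ, (∃ i, σ i = ρ) ↔ ρ ∈ K ∧ ρ ∉ A) (hmax : ∀ i, ∀ b ∉ σ i, insert b (σ i) ∉ K)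
    (hd : ∀ i, (σ i).card = d i + 1) :
    ∃ q : C(realization K, WedgeOfSpheres (Fin n) d), IsQuotientMap q ∧
      (∀ x ∈ carried K A, ∀ y ∈ carried K A, q x = q y) ∧
      ∀ x y, q x = q y → x = y ∨ (x ∈ carried K A ∧ y ∈ carried K A) := by
  classical
  have hσK : ∀ i, σ i ∈ K := fun i => ((hσ _).1 ⟨i, rfl⟩).1
  have hσA : ∀ i, σ i ∉ A := fun i => ((hσ _).1 ⟨i, rfl⟩).2
  have hxK : ∀ x : realization K, vsupp x.1 ∈ K := fun x => ((mem_realization_iff hK).1 x.2).2.2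
  choose p hpinj hpbase hpsurj using fun i => exists_continuousMap_sphere hK (hσK i) (hmax i) (hd i)
  let q (x : realization K) : WedgeOfSpheres (Fin n) d :=
    if h : ∃ i, σ i = vsupp x.1 then incl h.choose (p h.choose x) else base _ _
  have hqi : ∀ i x, vsupp x.1 = σ i → q x = incl i (p i x) := fun i x hx => by
    have h : ∃ i, σ i = vsupp x.1 := ⟨i, hx.symm⟩
    simp only [q, dif_pos h]
    rw [hinj (h.choose_spec.trans hx)]
  have hqA : ∀ x ∈ carried K A, q x = base _ _ := fun x hx => by
    refine dif_neg ?_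
    rintro ⟨i, hi⟩
    exact hσA i (hi ▸ hx)
  have hcases : ∀ x, x ∈ carried K A ∨ ∃ i, vsupp x.1 = σ i := fun x => by
    by_cases hx : x ∈ carried K A
    · exact Or.inl hx
    · obtain ⟨i, hi⟩ := (hσ (vsupp x.1)).2 ⟨hxK x, hx⟩
      exact Or.inr ⟨i, hi.symm⟩
  let B (i : Fin n) : Set (Finset α) := A ∪ {σ i}
  have hB : ∀ i, IsLowerSet (B i) := fun i ρ π hle hρ => by
    rcases hρ with hρ | rfl
    · exact Or.inl (hA hle hρ)
    · rcases eq_or_ne π (σ i) with rfl | hne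
      · exact Or.inr rfl
      · obtain ⟨b, hb, hbπ⟩ := exists_of_ssubset (hle.lt_of_ne hne)
        by_contra h
        obtain ⟨k, rfl⟩ := (hσ π).2 ⟨hK hle (hσK i), fun h' => h (Or.inl h')⟩
        exact hmax k b hbπ (hK (insert_subset hb hle) (hσK i))
  have hqB : ∀ i, ∀ x ∈ carried K (B i), q x = incl i (p i x) := by
    rintro i x (hx | hx)
    · have h : vsupp x.1 ≠ σ i := fun h => hσA i (h ▸ hx)
      rw [hqA x hx, (hpbase i x).2 h, incl_spherePt]
    · exact hqi i x hx
  have hqc : Continuous q := by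
    let C (o : Option (Fin n)) : Set (realization K) :=
      o.elim (carried K A) fun i => carried K (B i)
    refine (locallyFinite_of_finite C).continuous ?_ ?_ ?_
    · refine Set.eq_univ_of_forall fun x => Set.mem_iUnion.2 ?_
      rcases hcases x with hx | ⟨i, hi⟩
      · exact ⟨none, hx⟩
      · exact ⟨some i, Or.inr hi⟩
    · rintro (_ | i)
      · exact isClosed_carried K hA
      · exact isClosed_carried K (hB i)
    · rintro (_ | i)
      · exact continuousOn_const.congr hqA
      · exact ((continuous_incl i).comp (p i).continuous).continuousOn.congr (hqB i)
  have hps : ∀ i z, ∃ x ∈ carried K (B i), p i x = z := fun i z => by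
    by_cases hz : z = spherePt (d i)
    · obtain ⟨x, hx⟩ := hne
      exact ⟨x, Or.inl hx, hz ▸ (hpbase i x).2 fun h => hσA i (h ▸ hx)⟩
    · obtain ⟨x, hx, hxz⟩ := hpsurj i z hz
      exact ⟨x, Or.inr hx, hxz⟩
  have hqs : Function.Surjective q := fun w => by
    rcases eq_base_or_exists_eq_incl w with rfl | ⟨i, z, -, rfl⟩
    · obtain ⟨x, hx⟩ := hne
      exact ⟨x, hqA x hx⟩
    · obtain ⟨x, hx, rfl⟩ := hps i z
      exact ⟨x, hqB i x hx⟩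
  refine ⟨⟨q, hqc⟩, (isQuotientMap_iff _).2 ⟨isCoinducing_iff.2 fun U =>
    ⟨fun h => ?_, fun h => h.preimage hqc⟩, hqs⟩,
    fun x hx y hy => (hqA x hx).trans (hqA y hy).symm, fun x y hxy => ?_⟩
  · refine isOpen_iff.2 fun i => ?_
    have : CompactSpace (carried K (B i)) :=
      isCompact_iff_compactSpace.1 (isClosed_carried K (hB i)).isCompact
    let r (x : carried K (B i)) := p i x.1
    have hr : IsQuotientMap r := by
      have hc : Continuous r := (p i).continuous.comp continuous_subtype_val
      refine hc.isClosedMap.isQuotientMap hc fun z => ?_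
      obtain ⟨x, hx, hz⟩ := hps i z
      exact ⟨⟨x, hx⟩, hz⟩
    rw [← hr.isOpen_preimage]
    convert h.preimage (continuous_subtype_val : Continuous fun x : carried K (B i) => x.1) using 1
    ext x
    change incl i (p i x.1) ∈ U ↔ q x.1 ∈ U
    rw [hqB i x.1 x.2]
  · have hto : ∀ i x, vsupp x.1 = σ i → toOption (q x) = some ⟨i, p i x⟩ := fun i x hx => by
      rw [hqi i x hx, toOption_incl fun h => (hpbase i x).1 h hx]
    have hxy' : toOption (q x) = toOption (q y) := congrArg toOption hxy
    rcases hcases x with hx | ⟨i, hi⟩ <;> rcases hcases y with hy | ⟨k, hk⟩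
    · exact Or.inr ⟨hx, hy⟩
    · rw [hqA x hx, hto k y hk, toOption_base] at hxy'
      cases hxy'
    · rw [hqA y hy, hto i x hi, toOption_base] at hxy'
      cases hxy'
    · rw [hto i x hi, hto k y hk, Option.some_inj] at hxy'
      obtain rfl : i = k := congrArg Sigma.fst hxy'
      exact Or.inl (hpinj i x y hi hk (eq_of_heq (Sigma.mk.inj hxy').2))

end Wedge

section Main

theorem isWedgeOfSpheres_realization {α : Type*} [Fintype α] [DecidableEq α] {K : Set (Finset α)}
    (hK : IsLowerSet K) {f : α → Prop} (h : FacetExtension K f) :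
    IsWedgeOfSpheres (realization K) := by
  classical
  obtain ⟨A, hAK, hA, hmax⟩ := h
  by_cases hne : ∅ ∈ A
  · right
    obtain ⟨p, hpA, hp⟩ := hA.exists_deformsInto hK hAK hne
    let T : Finset (Finset α) := univ.filter fun σ => σ ∈ K ∧ σ ∉ A
    let σ (i : Fin T.card) : Finset α := T.equivFin.symm i
    have hσ : ∀ ρ, (∃ i, σ i = ρ) ↔ ρ ∈ K ∧ ρ ∉ A := fun ρ => by
      constructor
      · rintro ⟨i, rfl⟩
        exact (mem_filter.1 (T.equivFin.symm i).2).2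
      · intro hρ
        exact ⟨T.equivFin ⟨ρ, by simpa [T] using hρ⟩, by simp [σ]⟩
    have hd : ∀ i, (σ i).card = ((σ i).card - 1) + 1 := fun i => by
      have : (σ i).Nonempty := nonempty_iff_ne_empty.2 fun h => ((hσ _).1 ⟨i, rfl⟩).2 (h ▸ hne)
      have := this.card_pos
      omega
    obtain ⟨q, hq, hq1, hq2⟩ := exists_isQuotientMap_wedgeOfSpheres hK hA.isLowerSet ⟨p, hpA⟩
      (Subtype.val_injective.comp T.equivFin.symm.injective) hσ
      (fun i => (hmax _ ((hσ _).1 ⟨i, rfl⟩).1 ((hσ _).1 ⟨i, rfl⟩).2).1) hd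
    exact ⟨_, _, nonempty_homotopyEquiv_of_isQuotientMap q hq hq1 hq2 hp⟩
  · left
    refine ⟨fun x => ?_⟩
    have hx := ((mem_realization_iff hK).1 x.2).2.2
    obtain ⟨b, hb⟩ := vsupp_nonempty x.2.2.1
    refine (hmax ∅ (hK (empty_subset _) hx) hne).1 b (notMem_empty b) ?_
    exact hK (by simpa using hb) hx

theorem isLowerSet_BD {V : Type*} [DecidableEq V] (G : SimpleGraph V) (lam : V → ℕ) :
    IsLowerSet (BD G lam) := fun _ _ hle hH =>
  ⟨(coe_subset.2 hle).trans hH.1, fun v => (edgeDeg_mono hle v).trans (hH.2 v)⟩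

end Main

/-- for a forest `F`, the geometric realization of `BD^λ(F)` is either contractible
or homotopy equivalent to a wedge of spheres. -/
theorem BD_forest_contractible_or_wedge {V : Type*} [Fintype V] [DecidableEq V]
    (G : SimpleGraph V) (hG : G.IsAcyclic) (lam : V → ℕ) :
    ContractibleSpace (realization (BD G lam)) ∨
      IsWedgeOfSpheres (realization (BD G lam)) := by
  exact Or.inr (isWedgeOfSpheres_realization (isLowerSet_BD G lam) (facetExtension_BD hG lam))
end
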